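/- arXiv:1108.2221 — 9 statements merged into one kernel-verified Lean document; each statement's English description precedes it below -/
import Mathlib

section
/- Let $V$ be a finite dimensional real normed vector space and let $S$ be a subsemigroup of $GL(V)$ generated by a finite set of pairwise commuting invertible linear maps. If for some $v \in V$ the orbit $S \cdot v = \{s(v) : s \in S\}$ is coarsely dense in $V$, then $S \cdot v$ is dense in $V$. -/
open Filter Topology Polynomial

lemma isUnit_of_forall_aeval_ne_zero {A : Type*} [CommRing A] [Algebra ℝ A]
    [FiniteDimensional ℝ A] (g : A) (p : ℝ[X])
    (h : ∀ r : ℂ, aeval r (minpoly ℝ g) = 0 → aeval r p ≠ 0) : IsUnit (aeval g p) := by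
  have hc : IsCoprime p (minpoly ℝ g) :=
    (isCoprime_iff_aeval_ne_zero_of_isAlgClosed ℝ ℂ p _).2 fun r => by
      by_cases hr : aeval r (minpoly ℝ g) = 0
      · exact Or.inl (h r hr)
      · exact Or.inr hr
  obtain ⟨u, w, huw⟩ := hc
  have := congrArg (aeval g) huw
  rw [map_add, map_mul, map_mul, minpoly.aeval, mul_zero, add_zero, map_one, mul_comm] at this
  exact IsUnit.of_mul_eq_one _ this

/-- For a unit `g`, the norm from `ℂ` to `ℝ` of the complex affine line through `1` and `g` meets
the non-units only at finitely many parameters. -/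
lemma finite_setOf_not_isUnit {A : Type*} [CommRing A] [Algebra ℝ A]
    [FiniteDimensional ℝ A] (g : A) :
    {z : ℂ | ¬ IsUnit ((1 + z.re • (g - 1)) ^ 2 + (z.im • (g - 1)) ^ 2)}.Finite := by
  have hm : minpoly ℝ g ≠ 0 := minpoly.ne_zero (IsIntegral.of_finite ℝ g)
  have hfin : ((minpoly ℝ g).rootSet ℂ).Finite := rootSet_finite _ _
  refine ((hfin.image fun r => (1 - r)⁻¹).union
    (hfin.image fun r => star ((1 - r)⁻¹))).subset fun z hz => ?_
  set p : ℝ[X] := (1 + z.re • (X - 1)) ^ 2 + (z.im • (X - 1)) ^ 2 with hp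
  by_contra hcon
  refine hz ?_
  have := isUnit_of_forall_aeval_ne_zero g p fun r hr h0 => hcon ?_
  · simpa [hp] using this
  have hr' : r ∈ (minpoly ℝ g).rootSet ℂ := (mem_rootSet).2 ⟨hm, hr⟩
  have h1 : (1 + z * (r - 1)) * (1 + star z * (r - 1)) = 0 := by
    rw [← h0]
    simp only [hp, map_add, map_pow, map_one, map_sub, aeval_X, map_smul, Complex.real_smul]
    have e1 : z = z.re + z.im * Complex.I := (Complex.re_add_im z).symm
    have e2 : star z = z.re - z.im * Complex.I := by
      apply Complex.ext <;> simp
    linear_combination (r - 1) * (1 + star z * (r - 1)) * e1 +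
      (1 + (z.re + z.im * Complex.I) * (r - 1)) * (r - 1) * e2 +
      (-(z.im : ℂ) ^ 2 * (r - 1) ^ 2) * Complex.I_sq
  rcases mul_eq_zero.1 h1 with h | h
  · refine Or.inl ⟨r, hr', inv_eq_of_mul_eq_one_left (?_ : z * (1 - r) = 1)⟩
    linear_combination -h
  · refine Or.inr ⟨r, hr', ?_⟩
    have : (1 - r)⁻¹ = star z := inv_eq_of_mul_eq_one_left (by linear_combination -h)
    simp only [this, star_star]

/-- Stiemke's alternative, relative to a subspace. -/
lemma stiemke_alternative {E ι : Type*} [AddCommGroup E] [Module ℝ E] [Fintype ι]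
    (W : Submodule ℝ E) (a : ι → E) :
    (∃ φ : E →ₗ[ℝ] ℝ, (∀ w ∈ W, φ w = 0) ∧ (∀ i, 0 ≤ φ (a i)) ∧ ∃ i, 0 < φ (a i)) ∨
      ∃ α : ι → ℝ, (∀ i, 0 < α i) ∧ ∑ i, α i • a i ∈ W := by
  classical
  rw [or_iff_not_imp_left]
  intro hno
  let ev : (E →ₗ[ℝ] ℝ) →ₗ[ℝ] (ι → ℝ) := LinearMap.pi fun i => LinearMap.applyₗ (a i)
  let M : Submodule ℝ (ι → ℝ) := W.dualAnnihilator.map ev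
  have hdisj : Disjoint (stdSimplex ℝ ι) (M : Set (ι → ℝ)) := by
    rw [Set.disjoint_left]
    rintro x ⟨hx0, hx1⟩ ⟨φ, hφ, rfl⟩
    refine hno ⟨φ, (Submodule.mem_dualAnnihilator φ).1 hφ, hx0, ?_⟩
    by_contra! h
    have : ∑ i, ev φ i ≤ 0 := Finset.sum_nonpos fun i _ => h i
    linarith
  obtain ⟨f, u, v, hfu, huv, hfv⟩ := geometric_hahn_banach_compact_closed
    (convex_stdSimplex ℝ ι) (isCompact_stdSimplex ℝ ι) M.convex M.closed_of_finiteDimensional hdisj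
  have hv : v < 0 := by simpa using hfv 0 M.zero_mem
  have hM : ∀ m ∈ M, f m = 0 := by
    intro m hm
    by_contra hne
    have := hfv _ (M.smul_mem (v / f m) hm)
    rw [map_smul, smul_eq_mul, div_mul_cancel₀ _ hne] at this
    exact lt_irrefl _ this
  refine ⟨fun i => -f (Pi.single i 1), fun i => ?_, ?_⟩
  · have := hfu _ (single_mem_stdSimplex ℝ i)
    linarith
  · by_contra hcon
    obtain ⟨φ, hφ, hφW⟩ := W.exists_le_ker_of_notMem hcon
    have h1 : φ ∈ W.dualAnnihilator := (Submodule.mem_dualAnnihilator φ).2 fun w hw => hφW hw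
    have h2 : f (ev φ) = 0 := hM _ ⟨φ, h1, rfl⟩
    apply hφ
    rw [pi_eq_sum_univ' (ev φ)] at h2
    simp only [map_sum, map_smul, smul_eq_mul] at h2 ⊢
    rw [← neg_eq_zero, ← h2, ← Finset.sum_neg_distrib]
    refine Finset.sum_congr rfl fun i _ => ?_
    have : ev φ i = φ (a i) := rfl
    rw [this, Pi.single]
    ring

/-- The values of a nonnegative linear form on `ℕ ^ ι` are not exponentially dense at infinity. -/
lemma not_exponentially_dense_values {ι : Type*} [Fintype ι] (c : ι → ℝ) (hc : ∀ i, 0 ≤ c i)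
    {C : ℝ} (hC : 0 < C) (r₀ : ℝ) :
    ¬ ∀ r ≥ r₀, ∃ n : ι → ℕ, |∑ i, n i * c i - r| ≤ C * Real.exp (-r) := by
  classical
  intro h
  obtain ⟨c₀, hc₀, hcc₀⟩ : ∃ c₀ > 0, ∀ i, c i = 0 ∨ c₀ ≤ c i := by
    have h0 : ∀ i, ∀ᶠ x in 𝓝[>] (0 : ℝ), c i = 0 ∨ x ≤ c i := by
      intro i
      rcases (hc i).eq_or_lt with h | h
      · exact Eventually.of_forall fun _ => Or.inl h.symm
      · filter_upwards [mem_nhdsWithin_of_mem_nhds (Iio_mem_nhds h)] with x hx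
        exact Or.inr (le_of_lt hx)
    obtain ⟨x, hx, hx0⟩ := ((eventually_all.2 h0).and self_mem_nhdsWithin).exists
    exact ⟨x, hx0, hx⟩
  have hcount : ∀ R ≥ max r₀ 0, ∀ M : ℕ, M = ⌊(R + 1 + C) / c₀⌋₊ →
      1 ≤ ((M : ℝ) + 1) ^ Fintype.card ι * (2 * (C * Real.exp (-R))) := by
    intro R hR M hM
    have hR0 : 0 ≤ R := (le_max_right _ _).trans hR
    have hcover : Set.Icc R (R + 1) ⊆ ⋃ n : ι → Fin (M + 1),
        Metric.closedBall (∑ i, (n i : ℕ) * c i) (C * Real.exp (-R)) := by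
      intro r hr
      obtain ⟨n, hn⟩ := h r ((le_max_left _ _).trans (hR.trans hr.1))
      have hexp : Real.exp (-r) ≤ Real.exp (-R) := Real.exp_le_exp.2 (neg_le_neg hr.1)
      have hexp1 : Real.exp (-R) ≤ 1 := Real.exp_le_one_iff.2 (neg_nonpos.2 hR0)
      have hlt : ∀ i, (if c i = 0 then 0 else n i) < M + 1 := by
        intro i
        split_ifs with hi
        · exact M.succ_pos
        · have hi' : c₀ ≤ c i := (hcc₀ i).resolve_left hi
          have h1 : n i * c i ≤ ∑ i, n i * c i :=
            Finset.single_le_sum (f := fun i => (n i : ℝ) * c i)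
              (fun j _ => mul_nonneg (n j).cast_nonneg (hc j)) (Finset.mem_univ i)
          have h2 : (n i : ℝ) * c₀ ≤ n i * c i := by gcongr
          rw [Nat.lt_succ_iff, hM]
          refine Nat.le_floor ((le_div_iff₀ hc₀).2 ?_)
          have h3 := (abs_le.1 hn).2
          have h4 : C * Real.exp (-r) ≤ C * 1 := by gcongr; exact hexp.trans hexp1
          linarith [hr.2]
      refine Set.mem_iUnion.2 ⟨fun i => ⟨_, hlt i⟩, ?_⟩
      have hsum : ∑ i, ((if c i = 0 then 0 else n i : ℕ) : ℝ) * c i = ∑ i, n i * c i := by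
        refine Finset.sum_congr rfl fun i _ => ?_
        split_ifs with hi
        · simp [hi]
        · rfl
      rw [Metric.mem_closedBall, dist_comm, Real.dist_eq, hsum]
      exact hn.trans (by gcongr)
    have hvol := (MeasureTheory.measure_mono (μ := MeasureTheory.volume) hcover).trans
      (MeasureTheory.measure_iUnion_fintype_le _ _)
    simp only [Real.volume_Icc, Real.volume_closedBall, Finset.sum_const, Finset.card_univ,
      Fintype.card_fun, Fintype.card_fin, add_sub_cancel_left, nsmul_eq_mul] at hvol
    rw [← ENNReal.ofReal_natCast, ← ENNReal.ofReal_mul (Nat.cast_nonneg _),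
      ENNReal.ofReal_le_ofReal_iff (by positivity)] at hvol
    exact_mod_cast hvol
  set k := Fintype.card ι
  set B : ℝ := (1 + C) / c₀ + 1 with hB
  have hBpos : 0 < B := by positivity
  have hlim : Tendsto (fun x : ℝ => 2 * C * B ^ k * Real.exp 1 * (x ^ k * Real.exp (-x)))
      atTop (𝓝 0) := by
    simpa using (Real.tendsto_pow_mul_exp_neg_atTop_nhds_zero k).const_mul
      (2 * C * B ^ k * Real.exp 1)
  obtain ⟨x, hx1, hx⟩ := ((hlim.eventually_lt_const one_pos).and
    (eventually_ge_atTop (max r₀ 0 + 1))).exists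
  have hR : x - 1 ≥ max r₀ 0 := by linarith
  have hx0 : 1 ≤ x := by linarith [le_max_right r₀ 0]
  have hM : ((⌊(x - 1 + 1 + C) / c₀⌋₊ : ℕ) : ℝ) + 1 ≤ B * x := by
    have h1 := Nat.floor_le (show 0 ≤ (x - 1 + 1 + C) / c₀ by
      apply div_nonneg _ hc₀.le; linarith)
    have h2 : (x - 1 + 1 + C) / c₀ ≤ (1 + C) * x / c₀ := by
      gcongr
      nlinarith
    have h3 : B * x = (1 + C) * x / c₀ + x := by rw [hB]; ring
    linarith
  have h5 := hcount (x - 1) hR _ rfl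
  have h6 : Real.exp (-(x - 1)) = Real.exp 1 * Real.exp (-x) := by
    rw [← Real.exp_add]; congr 1; ring
  have h7 : ((⌊(x - 1 + 1 + C) / c₀⌋₊ : ℝ) + 1) ^ k * (2 * (C * Real.exp (-(x - 1)))) ≤
      (B * x) ^ k * (2 * (C * Real.exp (-(x - 1)))) := by gcongr
  rw [h6, mul_pow] at h7
  rw [h6] at h5
  nlinarith [h5, h7, hx1]

section ExpUnits

variable {A : Type*} [NormedCommRing A] [NormedAlgebra ℝ A]

lemma realAlgebra_exp_smul_one (r : ℝ) :
    NormedSpace.exp (r • (1 : A)) = Real.exp r • (1 : A) := by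
  rw [← Algebra.algebraMap_eq_smul_one, ← Algebra.algebraMap_eq_smul_one, Real.exp_eq_exp_ℝ,
    NormedSpace.algebraMap_exp_comm]

variable [CompleteSpace A]

lemma realAlgebra_exp_continuous : Continuous (NormedSpace.exp : A → A) := by
  let _ : NormedAlgebra ℚ A := NormedAlgebra.restrictScalars ℚ ℝ A
  exact NormedSpace.exp_continuous

lemma realAlgebra_exp_add (x y : A) :
    NormedSpace.exp (x + y) = NormedSpace.exp x * NormedSpace.exp y := by
  let _ : NormedAlgebra ℚ A := NormedAlgebra.restrictScalars ℚ ℝ A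
  exact NormedSpace.exp_add_of_commute (Commute.all x y)

lemma realAlgebra_exp_nsmul (n : ℕ) (x : A) :
    NormedSpace.exp (n • x) = NormedSpace.exp x ^ n := by
  let _ : NormedAlgebra ℚ A := NormedAlgebra.restrictScalars ℚ ℝ A
  exact NormedSpace.exp_nsmul n x

lemma realAlgebra_exp_sum {ι : Type*} (s : Finset ι) (f : ι → A) :
    NormedSpace.exp (∑ i ∈ s, f i) = ∏ i ∈ s, NormedSpace.exp (f i) := by
  let _ : NormedAlgebra ℚ A := NormedAlgebra.restrictScalars ℚ ℝ A
  exact NormedSpace.exp_sum s f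

lemma realAlgebra_exp_mul_exp_neg (x : A) :
    NormedSpace.exp x * NormedSpace.exp (-x) = 1 := by
  rw [← realAlgebra_exp_add, add_neg_cancel, NormedSpace.exp_zero]

/-- Near `1` the exponential has a local inverse that is Lipschitz at `1`. -/
lemma exists_exp_eq_one_add : ∃ C > 0, ∃ δ > 0, ∀ e : A, ‖e‖ < δ →
    ∃ b : A, NormedSpace.exp b = 1 + e ∧ ‖b‖ ≤ C * ‖e‖ := by
  have h0 : HasStrictFDerivAt (NormedSpace.exp : A → A)
      ((ContinuousLinearEquiv.refl ℝ A : A ≃L[ℝ] A) : A →L[ℝ] A) 0 :=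
    hasStrictFDerivAt_exp_zero
  have h1 := h0.eventually_right_inverse
  have h2 := h0.to_localInverse.hasFDerivAt.isBigO_sub
  have h3 := h0.localInverse_apply_image
  obtain ⟨C, hC, hO⟩ := h2.exists_pos
  have hO' := hO.bound
  rw [NormedSpace.exp_zero] at h1 hO' h3
  obtain ⟨δ, hδ, H⟩ := Metric.eventually_nhds_iff.1 (h1.and hO')
  refine ⟨C, hC, δ, hδ, fun e he => ⟨_, (H (y := 1 + e) (by simpa using he)).1, ?_⟩⟩
  have := (H (y := 1 + e) (by simpa using he)).2
  simpa [h3] using this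

lemma range_exp_mem_nhds_one : Set.range (NormedSpace.exp : A → A) ∈ 𝓝 (1 : A) := by
  obtain ⟨C, -, δ, hδ, H⟩ := exists_exp_eq_one_add (A := A)
  refine Metric.mem_nhds_iff.2 ⟨δ, hδ, fun x hx => ?_⟩
  obtain ⟨b, hb, -⟩ := H (x - 1) (by simpa [dist_eq_norm] using hx)
  exact ⟨b, by simpa using hb⟩

/-- Two units that are close differ by an exponential factor. -/
lemma eventually_exists_eq_mul_exp {x : A} (hx : IsUnit x) :
    ∀ᶠ y in 𝓝 x, ∃ b : A, y = x * NormedSpace.exp b := by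
  obtain ⟨u, rfl⟩ := hx
  have hc : Tendsto (fun y : A => (↑u⁻¹ : A) * y) (𝓝 (u : A)) (𝓝 1) := by
    have : Continuous fun y : A => (↑u⁻¹ : A) * y := by fun_prop
    simpa using this.tendsto (u : A)
  filter_upwards [hc range_exp_mem_nhds_one] with y hy
  obtain ⟨b, hb⟩ := hy
  exact ⟨b, by rw [hb]; simp⟩

/-- A unit joined to `1` by a connected set of units is an exponential. -/
lemma mem_range_exp_of_isPreconnected {s : Set A} (hs : IsPreconnected s)
    (hu : ∀ x ∈ s, IsUnit x) (h1 : (1 : A) ∈ s) {x : A} (hx : x ∈ s) :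
    ∃ a : A, NormedSpace.exp a = x := by
  obtain ⟨a, ha⟩ := hs.induction₂ (fun x y => ∃ b : A, y = x * NormedSpace.exp b)
    (fun y hy => mem_nhdsWithin_of_mem_nhds (eventually_exists_eq_mul_exp (hu y hy)))
    (fun x y z _ _ _ ⟨b, hb⟩ ⟨c, hc⟩ =>
      ⟨b + c, by rw [hc, hb, realAlgebra_exp_add, mul_assoc]⟩)
    (fun x y _ _ ⟨b, hb⟩ =>
      ⟨-b, by rw [hb, mul_assoc, realAlgebra_exp_mul_exp_neg, mul_one]⟩) h1 hx
  exact ⟨a, by rw [ha, one_mul]⟩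

/-- The square of a unit of a finite dimensional commutative real algebra has a logarithm. -/
lemma exists_exp_eq_sq [FiniteDimensional ℝ A] {g : A} (hg : IsUnit g) :
    ∃ a : A, NormedSpace.exp a = g ^ 2 := by
  have hconn := ((finite_setOf_not_isUnit g).countable.isPathConnected_compl_of_one_lt_rank
    (by rw [Complex.rank_real_complex]; norm_num)).isConnected.isPreconnected
  have hcont : Continuous fun z : ℂ => (1 + z.re • (g - 1)) ^ 2 + (z.im • (g - 1)) ^ 2 := by
    fun_prop
  refine mem_range_exp_of_isPreconnected (hconn.image _ hcont.continuousOn) ?_ ?_ ?_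
  · rintro _ ⟨z, hz, rfl⟩
    simpa using hz
  · exact ⟨0, by simp, by simp⟩
  · exact ⟨1, by simpa using hg.pow 2, by simp⟩

/-- Multiples of a vector in the span of the kernel of the exponential stay at bounded distance
from that kernel. -/
lemma exists_dist_exp_ker_le {w : A}
    (hw : w ∈ Submodule.span ℝ {l : A | NormedSpace.exp l = 1}) :
    ∃ R : ℝ, ∀ r : ℝ, ∃ l : A, NormedSpace.exp l = 1 ∧ ‖r • w - l‖ ≤ R := by
  have hneg : ∀ l : A, NormedSpace.exp l = 1 → NormedSpace.exp (-l) = 1 := fun l hl => by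
    simpa [hl] using realAlgebra_exp_mul_exp_neg l
  induction hw using Submodule.span_induction with
  | mem w hw =>
    refine ⟨‖w‖, fun r => ⟨⌊r⌋ • w, ?_, ?_⟩⟩
    · obtain ⟨n, hn | hn⟩ := ⌊r⌋.eq_nat_or_neg
      · rw [hn, natCast_zsmul, realAlgebra_exp_nsmul, hw, one_pow]
      · rw [hn, neg_smul, natCast_zsmul]
        exact hneg _ (by rw [realAlgebra_exp_nsmul, hw, one_pow])
    · rw [← Int.cast_smul_eq_zsmul ℝ, ← sub_smul, norm_smul, Int.self_sub_floor, Real.norm_eq_abs,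
        Int.abs_fract]
      exact mul_le_of_le_one_left (norm_nonneg _) (Int.fract_lt_one r).le
  | zero => exact ⟨0, fun r => ⟨0, by simp⟩⟩
  | add x y _ _ hx hy =>
    obtain ⟨R, hR⟩ := hx
    obtain ⟨R', hR'⟩ := hy
    refine ⟨R + R', fun r => ?_⟩
    obtain ⟨l, hl, hlR⟩ := hR r
    obtain ⟨l', hl', hlR'⟩ := hR' r
    refine ⟨l + l', by rw [realAlgebra_exp_add, hl, hl', one_mul], ?_⟩
    rw [smul_add, add_sub_add_comm]
    exact (norm_add_le _ _).trans (add_le_add hlR hlR')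
  | smul c x _ hx =>
    obtain ⟨R, hR⟩ := hx
    exact ⟨R, fun r => by simpa [smul_smul] using hR (r * c)⟩

/-- Simultaneous recurrence: if a positive combination of the `a i` lies in the span of the kernel
of the exponential, then products of positive powers of the `exp (a i)` accumulate at `1`. -/
lemma exists_prod_exp_pow_mem [FiniteDimensional ℝ A] {ι : Type*} [Fintype ι] (a : ι → A)
    (α : ι → ℝ) (hα : ∀ i, 0 < α i)
    (hW : ∑ i, α i • a i ∈ Submodule.span ℝ {l : A | NormedSpace.exp l = 1})
    {U : Set A} (hU : U ∈ 𝓝 (1 : A)) :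
    ∃ N : ι → ℕ, (∀ i, 0 < N i) ∧ ∏ i, NormedSpace.exp (a i) ^ N i ∈ U := by
  obtain ⟨R, hR⟩ := exists_dist_exp_ker_le hW
  choose l hl hlR using fun n : ℕ => hR n
  let m : ℕ → ι → ℕ := fun n i => ⌊n * α i⌋₊
  let b : ℕ → A := fun n => ∑ i, m n i • a i - l n
  have hb : ∀ n, b n ∈ Metric.closedBall (0 : A) (∑ i, ‖a i‖ + R) := by
    intro n
    have h1 : b n = -∑ i, ((n * α i - m n i) • a i) + ((n : ℝ) • ∑ i, α i • a i - l n) := by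
      simp only [b, sub_smul, Finset.sum_sub_distrib, Finset.smul_sum, smul_smul,
        Nat.cast_smul_eq_nsmul]
      abel
    rw [mem_closedBall_zero_iff, h1]
    refine (norm_add_le _ _).trans (add_le_add ?_ (hlR n))
    rw [norm_neg]
    refine (norm_sum_le _ _).trans (Finset.sum_le_sum fun i _ => ?_)
    rw [norm_smul]
    refine mul_le_of_le_one_left (norm_nonneg _) ?_
    have h2 := Nat.floor_le (mul_nonneg n.cast_nonneg (hα i).le)
    have h3 := Nat.lt_floor_add_one (n * α i)
    rw [Real.norm_eq_abs, abs_le]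
    constructor <;> simp only [m] <;> linarith
  have : ProperSpace A := FiniteDimensional.proper ℝ A
  obtain ⟨c, -, ψ, hψ, hc⟩ := tendsto_subseq_of_bounded Metric.isBounded_closedBall hb
  have hV : NormedSpace.exp ⁻¹' U ∈ 𝓝 (0 : A) :=
    realAlgebra_exp_continuous.continuousAt.preimage_mem_nhds (by rwa [NormedSpace.exp_zero])
  obtain ⟨ε, hε, hεV⟩ := Metric.mem_nhds_iff.1 hV
  obtain ⟨K, hK⟩ := Metric.cauchySeq_iff'.1 hc.cauchySeq ε hε
  have hm : ∀ᶠ j in atTop, ∀ i, m (ψ K) i < m (ψ j) i := by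
    rw [eventually_all]
    intro i
    have : Tendsto (fun j => ⌊(ψ j : ℝ) * α i⌋₊) atTop atTop :=
      tendsto_nat_floor_atTop.comp
        ((tendsto_natCast_atTop_atTop.comp hψ.tendsto_atTop).atTop_mul_const (hα i))
    exact this.eventually_gt_atTop _
  obtain ⟨j, hj, hjK⟩ := (hm.and (eventually_ge_atTop K)).exists
  refine ⟨fun i => m (ψ j) i - m (ψ K) i, fun i => Nat.sub_pos_of_lt (hj i), ?_⟩
  have hmem : NormedSpace.exp (b (ψ j) - b (ψ K)) ∈ U :=
    hεV (by simpa [dist_eq_norm] using hK j hjK)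
  convert hmem using 1
  have h4 : ∑ i, (m (ψ j) i - m (ψ K) i) • a i + l (ψ K) = (b (ψ j) - b (ψ K)) + l (ψ j) := by
    have : ∑ i, (m (ψ j) i - m (ψ K) i) • a i =
        ∑ i, m (ψ j) i • a i - ∑ i, m (ψ K) i • a i := by
      rw [← Finset.sum_sub_distrib]
      refine Finset.sum_congr rfl fun i _ => ?_
      rw [eq_sub_iff_add_eq, ← add_smul, Nat.sub_add_cancel (hj i).le]
    rw [this]
    simp only [b]
    abel
  have h5 := congrArg NormedSpace.exp h4
  simpa only [realAlgebra_exp_add, hl, mul_one, realAlgebra_exp_sum, realAlgebra_exp_nsmul] using h5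

end ExpUnits

lemma Subsemigroup.pow_succ_mem {M : Type*} [Monoid M] (S : Subsemigroup M) {x : M} (hx : x ∈ S)
    (n : ℕ) : x ^ (n + 1) ∈ S := by
  induction n with
  | zero => simpa using hx
  | succ n ih => rw [pow_succ]; exact S.mul_mem ih hx

lemma Subsemigroup.prod_pow_mem_or_eq_one {M ι : Type*} [CommMonoid M] (S : Subsemigroup M)
    (s : Finset ι) (t : ι → M) (ht : ∀ i, t i ∈ S) (n : ι → ℕ) :
    ∏ i ∈ s, t i ^ n i ∈ S ∨ ∏ i ∈ s, t i ^ n i = 1 := by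
  refine Finset.prod_induction _ (fun x => x ∈ S ∨ x = 1) ?_ (Or.inr rfl) fun i _ => ?_
  · rintro x y (hx | rfl) (hy | rfl)
    · exact Or.inl (S.mul_mem hx hy)
    · exact Or.inl (by rwa [mul_one])
    · exact Or.inl (by rwa [one_mul])
    · exact Or.inr (mul_one 1)
  · cases n i with
    | zero => exact Or.inr (pow_zero _)
    | succ k => exact Or.inl (S.pow_succ_mem (ht i) k)

lemma Subsemigroup.exists_eq_prod_pow {M ι : Type*} [CommMonoid M] [Fintype ι] {t : ι → M} {s : M}
    (hs : s ∈ Subsemigroup.closure (Set.range t)) : ∃ n : ι → ℕ, s = ∏ i, t i ^ n i := by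
  classical
  induction hs using Subsemigroup.closure_induction with
  | mem x hx =>
    obtain ⟨i, rfl⟩ := hx
    exact ⟨Pi.single i 1, by simp [Pi.single_apply, pow_ite]⟩
  | mul x y _ _ hx hy =>
    obtain ⟨m, rfl⟩ := hx
    obtain ⟨n, rfl⟩ := hy
    exact ⟨m + n, by simp [pow_add, Finset.prod_mul_distrib]⟩

/-- Every point is a limit of rescaled points of a coarsely dense set. -/
lemma exists_seq_tendsto_inv_smul {V : Type*} [SeminormedAddCommGroup V] [NormedSpace ℝ V]
    {P : Set V} {D : ℝ} (h : ∀ x : V, ∃ s ∈ P, dist x s < D) (x : V) :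
    ∃ s : ℕ → V, (∀ n, s n ∈ P) ∧ Tendsto (fun n : ℕ => ((n : ℝ) + 1)⁻¹ • s n) atTop (𝓝 x) := by
  choose s hs hsD using fun n : ℕ => h (((n : ℝ) + 1) • x)
  refine ⟨s, hs, ?_⟩
  rw [tendsto_iff_dist_tendsto_zero]
  have hlim : Tendsto (fun n : ℕ => D * (1 / ((n : ℝ) + 1))) atTop (𝓝 0) := by
    simpa using tendsto_one_div_add_atTop_nhds_zero_nat.const_mul D
  refine squeeze_zero (fun _ => dist_nonneg) (fun n => ?_) hlim
  have hn : (0 : ℝ) < n + 1 := by positivity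
  rw [← inv_smul_smul₀ hn.ne' x, dist_smul₀, dist_comm, Real.norm_of_nonneg (by positivity),
    mul_comm, one_div]
  gcongr
  exact (hsD n).le

/-- A coarsely dense subspace of a finite dimensional space is everything. -/
lemma Submodule.eq_top_of_coarselyDense {V : Type*} [NormedAddCommGroup V] [NormedSpace ℝ V]
    [FiniteDimensional ℝ V] (W : Submodule ℝ V) {D : ℝ} (h : ∀ x : V, ∃ w ∈ W, dist x w < D) :
    W = ⊤ := by
  refine Submodule.eq_top_iff'.2 fun x => ?_
  obtain ⟨w, hw, hlim⟩ := exists_seq_tendsto_inv_smul (P := (W : Set V)) h x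
  exact W.closed_of_finiteDimensional.mem_of_tendsto hlim
    (Eventually.of_forall fun n => W.smul_mem _ (hw n))

section CoarselyDense

variable {A : Type*} [NormedCommRing A] [NormedAlgebra ℝ A] [FiniteDimensional ℝ A]

/-- A coarsely dense subsemigroup all of whose elements are invertible in its closure is dense. -/
lemma dense_of_coarselyDense_of_inverses {S : Subsemigroup A} {D : ℝ}
    (hcd : ∀ x : A, ∃ s ∈ S, ‖x - s‖ < D)
    (hinv : ∀ s ∈ S, ∃ u ∈ S.topologicalClosure, s * u = 1) : Dense (S : Set A) := by
  have : CompleteSpace A := FiniteDimensional.complete ℝ A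
  have happrox := exists_seq_tendsto_inv_smul (P := (S : Set A))
    (by simpa only [dist_eq_norm, SetLike.mem_coe] using hcd)
  intro x
  obtain ⟨s, hs, hsx⟩ := happrox x
  obtain ⟨s', hs', hs1⟩ := happrox 1
  choose u hu hsu using fun n => hinv _ (hs' n)
  have hinv1 : Tendsto (fun n : ℕ => ((n : ℝ) + 1) • u n) atTop (𝓝 1) := by
    have h1 := (NormedRing.inverse_continuousAt (1 : Aˣ)).tendsto.comp hs1
    rw [Units.val_one, Ring.inverse_one] at h1
    refine h1.congr fun n => ?_
    have hn : (n : ℝ) + 1 ≠ 0 := by positivity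
    have h2 : (((n : ℝ) + 1)⁻¹ • s' n) * (((n : ℝ) + 1) • u n) = 1 := by
      rw [smul_mul_smul_comm, inv_mul_cancel₀ hn, one_smul, hsu]
    have h3 := Ring.inverse_mul_cancel_left _ (((n : ℝ) + 1) • u n) (IsUnit.of_mul_eq_one _ h2)
    rw [h2, mul_one] at h3
    exact h3
  have hlim := hsx.mul hinv1
  rw [mul_one] at hlim
  refine (S.isClosed_topologicalClosure).mem_of_tendsto hlim (Eventually.of_forall fun n => ?_)
  have hn : (n : ℝ) + 1 ≠ 0 := by positivity
  rw [smul_mul_smul_comm, inv_mul_cancel₀ hn, one_smul]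
  exact S.topologicalClosure.mul_mem (S.le_topologicalClosure (hs n)) (hu n)

variable {ι : Type*} [Fintype ι]

/-- Along the ray of scalars, translated by `exp d`, a linear form vanishing on the kernel of the
exponential takes on logarithms of a coarsely dense semigroup values that are exponentially close to
all prescribed ones. -/
lemma exists_abs_sum_sub_le {t a : ι → A} (ha : ∀ i, NormedSpace.exp (a i) = t i ^ 2) {D : ℝ}
    (hcd : ∀ x : A, ∃ s ∈ Subsemigroup.closure (Set.range t), ‖x - s‖ < D)
    (φ : A →ₗ[ℝ] ℝ) (hφ : ∀ l : A, NormedSpace.exp l = 1 → φ l = 0) (d : A) :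
    ∃ C > 0, ∃ r₀ : ℝ, ∀ r ≥ r₀, ∃ n : ι → ℕ,
      |∑ i, n i * φ (a i) - 2 * (r * φ 1 + φ d)| ≤ C * Real.exp (-r) := by
  have : CompleteSpace A := FiniteDimensional.complete ℝ A
  obtain ⟨C₁, hC₁, δ, hδ, hlog⟩ := exists_exp_eq_one_add (A := A)
  have hD : 0 ≤ D := by
    obtain ⟨s, -, hs⟩ := hcd 0
    exact (norm_nonneg _).trans hs.le
  set Φ : A →L[ℝ] ℝ := LinearMap.toContinuousLinearMap φ with hΦ
  have hΦφ : ∀ x, Φ x = φ x := fun x => rfl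
  set E : ℝ := ‖NormedSpace.exp (-d)‖ * D with hE
  have hE0 : 0 ≤ E := by positivity
  have hlim : Tendsto (fun r : ℝ => E * Real.exp (-r)) atTop (𝓝 0) := by
    simpa using (Real.tendsto_exp_neg_atTop_nhds_zero).const_mul E
  obtain ⟨r₀, hr₀⟩ := eventually_atTop.1 (hlim.eventually_lt_const hδ)
  refine ⟨2 * (‖Φ‖ * (C₁ * E)) + 1, by positivity, r₀, fun r hr => ?_⟩
  obtain ⟨s, hs, hsD⟩ := hcd (NormedSpace.exp (r • 1 + d))
  set y : A := NormedSpace.exp (r • 1 + d) with hy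
  set e : A := NormedSpace.exp (-(r • 1 + d)) * (s - y) with he
  have heE : ‖e‖ ≤ E * Real.exp (-r) := by
    have h1 : e = Real.exp (-r) • (NormedSpace.exp (-d) * (s - y)) := by
      rw [he, neg_add, realAlgebra_exp_add, ← neg_smul, realAlgebra_exp_smul_one, smul_one_mul,
        smul_mul_assoc]
    rw [h1, norm_smul, Real.norm_of_nonneg (Real.exp_pos _).le, mul_comm]
    gcongr
    refine (norm_mul_le _ _).trans ?_
    rw [hE]
    gcongr
    rw [norm_sub_rev]
    exact hsD.le
  obtain ⟨b, hb, hbe⟩ := hlog e (heE.trans_lt (hr₀ r hr))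
  have hsy : s = NormedSpace.exp (r • 1 + d + b) := by
    rw [realAlgebra_exp_add, hb, mul_add, mul_one, he, ← mul_assoc, realAlgebra_exp_mul_exp_neg,
      one_mul, hy, add_sub_cancel]
  obtain ⟨n, hn⟩ := Subsemigroup.exists_eq_prod_pow hs
  have hsn : s ^ 2 = NormedSpace.exp (∑ i, n i • a i) := by
    rw [hn, realAlgebra_exp_sum, ← Finset.prod_pow]
    refine Finset.prod_congr rfl fun i _ => ?_
    rw [realAlgebra_exp_nsmul, ha, ← pow_mul, ← pow_mul, mul_comm]
  have hker : NormedSpace.exp (∑ i, n i • a i + -(2 • (r • 1 + d + b))) = 1 := by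
    rw [realAlgebra_exp_add, ← hsn, hsy, ← realAlgebra_exp_nsmul, realAlgebra_exp_mul_exp_neg]
  have h0 := hφ _ hker
  simp only [map_add, map_neg, map_sum, map_nsmul, map_smul] at h0
  simp only [smul_eq_mul, nsmul_eq_mul, Nat.cast_ofNat] at h0
  refine ⟨n, ?_⟩
  have h1 : ∑ i, n i * φ (a i) - 2 * (r * φ 1 + φ d) = 2 * Φ b := by
    rw [hΦφ]; linarith
  have h2 : |Φ b| ≤ ‖Φ‖ * (C₁ * (E * Real.exp (-r))) :=
    (Φ.le_opNorm b).trans (by gcongr; exact hbe.trans (by gcongr))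
  rw [h1, abs_mul, abs_two]
  nlinarith [Real.exp_pos (-r)]

/-- A linear form vanishing on the kernel of the exponential cannot be nonnegative and nontrivial on
logarithms of generators of a coarsely dense semigroup. -/
lemma not_exists_nonneg_form {t a : ι → A} (ha : ∀ i, NormedSpace.exp (a i) = t i ^ 2) {D : ℝ}
    (hcd : ∀ x : A, ∃ s ∈ Subsemigroup.closure (Set.range t), ‖x - s‖ < D)
    (φ : A →ₗ[ℝ] ℝ) (hφ : ∀ l : A, NormedSpace.exp l = 1 → φ l = 0)
    (hnonneg : ∀ i, 0 ≤ φ (a i)) : ¬ ∃ i, 0 < φ (a i) := by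
  rintro ⟨i, hi⟩
  have happrox := exists_abs_sum_sub_le ha hcd φ hφ
  rcases le_or_gt (φ 1) 0 with h1 | h1
  · obtain ⟨C, -, r₀, H⟩ := happrox (-a i)
    have hlim : Tendsto (fun r : ℝ => C * Real.exp (-r)) atTop (𝓝 0) := by
      simpa using (Real.tendsto_exp_neg_atTop_nhds_zero).const_mul C
    obtain ⟨r, hr, hr0, hrr⟩ := ((hlim.eventually_lt_const hi).and
      ((eventually_ge_atTop 0).and (eventually_ge_atTop r₀))).exists
    obtain ⟨n, hn⟩ := H r hrr
    have hsum : 0 ≤ ∑ i, n i * φ (a i) :=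
      Finset.sum_nonneg fun j _ => mul_nonneg (n j).cast_nonneg (hnonneg j)
    have := (abs_le.1 hn).2
    rw [map_neg] at this
    nlinarith [mul_nonpos_of_nonneg_of_nonpos hr0 h1]
  · obtain ⟨C, hC, r₀, H⟩ := happrox 0
    have h2 : 0 < 2 * φ 1 := by positivity
    refine not_exponentially_dense_values (fun i => φ (a i) / (2 * φ 1))
      (fun i => div_nonneg (hnonneg i) h2.le) (div_pos hC h2) r₀ fun r hr => ?_
    obtain ⟨n, hn⟩ := H r hr
    refine ⟨n, ?_⟩
    have : ∑ i, n i * (φ (a i) / (2 * φ 1)) - r =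
        (∑ i, n i * φ (a i) - 2 * (r * φ 1 + φ 0)) / (2 * φ 1) := by
      rw [map_zero, add_zero, sub_div, Finset.sum_div]
      congr 1
      · exact Finset.sum_congr rfl fun i _ => by rw [mul_div_assoc]
      · field_simp
    rw [this, abs_div, abs_of_pos h2, div_mul_eq_mul_div]
    gcongr

/-- A finitely generated coarsely dense semigroup of units of a finite dimensional commutative real
algebra is dense. -/
theorem dense_closure_of_coarselyDense {t : ι → A} (ht : ∀ i, IsUnit (t i)) {D : ℝ}
    (hcd : ∀ x : A, ∃ s ∈ Subsemigroup.closure (Set.range t), ‖x - s‖ < D) :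
    Dense (Subsemigroup.closure (Set.range t) : Set A) := by
  classical
  have : CompleteSpace A := FiniteDimensional.complete ℝ A
  set S := Subsemigroup.closure (Set.range t) with hS
  have htS : ∀ i, t i ∈ S := fun i => Subsemigroup.subset_closure ⟨i, rfl⟩
  choose a ha using fun i => exists_exp_eq_sq (ht i)
  obtain ⟨φ, hφ, hnonneg, hpos⟩ | ⟨α, hα, hW⟩ :=
    stiemke_alternative (Submodule.span ℝ {l : A | NormedSpace.exp l = 1}) a
  · exact absurd hpos (not_exists_nonneg_form ha hcd φ
      (fun l hl => hφ l (Submodule.subset_span hl)) hnonneg)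
  have hgen : ∀ i, ∃ u ∈ S.topologicalClosure, t i * u = 1 := by
    intro i
    obtain ⟨u, hu⟩ := (ht i).exists_right_inv
    refine ⟨u, mem_closure_iff_nhds.2 fun U hU => ?_, hu⟩
    have hcont : ContinuousAt (fun y : A => u * y) 1 := by fun_prop
    obtain ⟨N, hN, hNU⟩ := exists_prod_exp_pow_mem a α hα hW
      (hcont.preimage_mem_nhds (by rwa [mul_one]))
    refine ⟨_, hNU, ?_⟩
    obtain ⟨k, hk⟩ := Nat.exists_eq_add_of_lt (hN i)
    have h1 : u * ∏ j, NormedSpace.exp (a j) ^ N j =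
        t i ^ (2 * k + 1) * ∏ j ∈ Finset.univ.erase i, t j ^ (2 * N j) := by
      rw [← Finset.mul_prod_erase _ _ (Finset.mem_univ i), ha, hk, ← mul_assoc, ← pow_mul]
      congr 1
      · calc u * t i ^ (2 * (0 + k + 1)) = t i * u * t i ^ (2 * k + 1) := by ring
          _ = _ := by rw [hu, one_mul]
      · exact Finset.prod_congr rfl fun j _ => by rw [ha, ← pow_mul]
    change u * _ ∈ S
    rw [h1]
    rcases S.prod_pow_mem_or_eq_one (Finset.univ.erase i) t htS (fun j => 2 * N j) with h | h
    · exact S.mul_mem (S.pow_succ_mem (htS i) _) h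
    · rw [h, mul_one]
      exact S.pow_succ_mem (htS i) _
  refine dense_of_coarselyDense_of_inverses hcd fun s hs => ?_
  induction hs using Subsemigroup.closure_induction with
  | mem x hx =>
    obtain ⟨i, rfl⟩ := hx
    exact hgen i
  | mul x y _ _ hx hy =>
    obtain ⟨u, hu, hxu⟩ := hx
    obtain ⟨w, hw, hyw⟩ := hy
    exact ⟨u * w, S.topologicalClosure.mul_mem hu hw, by rw [mul_mul_mul_comm, hxu, hyw, mul_one]⟩

/-- The density of coarsely dense semigroups of units, transported by a linear equivalence. -/
theorem dense_image_closure_of_coarselyDense {V : Type*} [NormedAddCommGroup V] [NormedSpace ℝ V]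
    {t : ι → A} (ht : ∀ i, IsUnit (t i)) (e : A ≃ₗ[ℝ] V) {D : ℝ}
    (hcd : ∀ x : V, ∃ s ∈ Subsemigroup.closure (Set.range t), dist x (e s) < D) :
    Dense (e '' (Subsemigroup.closure (Set.range t) : Set A)) := by
  have : FiniteDimensional ℝ V := e.finiteDimensional
  let f : A ≃L[ℝ] V := e.toContinuousLinearEquiv
  have hfe : ∀ a, f a = e a := fun _ => rfl
  have hdense := dense_closure_of_coarselyDense ht
    (D := ‖(f.symm : V →L[ℝ] A)‖ * D + 1) fun x => by
      obtain ⟨s, hs, hsx⟩ := hcd (e x)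
      refine ⟨s, hs, ?_⟩
      rw [dist_eq_norm, ← map_sub] at hsx
      have h1 := (f.symm : V →L[ℝ] A).le_opNorm (f (x - s))
      rw [ContinuousLinearEquiv.coe_coe, f.symm_apply_apply, hfe] at h1
      exact lt_of_le_of_lt (h1.trans (by gcongr)) (lt_add_one _)
  exact f.surjective.denseRange.dense_image f.continuous hdense

end CoarselyDense

/-- Let `V` be a finite dimensional real normed vector space and `S` a
subsemigroup of `GL(V)` generated by a finite set of pairwise commuting invertible linear
maps.  If for some `v ∈ V` the orbit `S ⬝ v` is coarsely dense in `V`, then it is dense. -/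
theorem coarsely_dense_orbit_is_dense
    {V : Type*} [NormedAddCommGroup V] [NormedSpace ℝ V] [FiniteDimensional ℝ V]
    (T : Set (V →L[ℝ] V)ˣ) (hTfin : T.Finite)
    (hTcomm : ∀ s ∈ T, ∀ t ∈ T, s * t = t * s)
    (S : Subsemigroup (V →L[ℝ] V)ˣ) (hS : S = Subsemigroup.closure T)
    (v : V)
    (hcd : ∃ D : ℝ, 0 < D ∧ ∀ x : V, ∃ s ∈ S, dist x ((s : V →L[ℝ] V) v) < D) :
    Dense {w : V | ∃ s ∈ S, (s : V →L[ℝ] V) v = w} := by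
  obtain ⟨D, -, hD⟩ := hcd
  let gens : Set (V →L[ℝ] V) := (fun u : (V →L[ℝ] V)ˣ => (u : V →L[ℝ] V)) '' T
  let A : Subalgebra ℝ (V →L[ℝ] V) := Algebra.adjoin ℝ gens
  have hcomm : ∀ a ∈ gens, ∀ b ∈ gens, a * b = b * a := by
    rintro _ ⟨s, hs, rfl⟩ _ ⟨t, ht, rfl⟩
    exact congrArg Units.val (hTcomm s hs t ht)
  let _ : NormedCommRing A :=
    { (inferInstance : NormedRing A) with
      mul_comm := (Algebra.isMulCommutative_adjoin ℝ hcomm).is_comm.comm }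
  have : Fintype T := hTfin.fintype
  let t : T → A := fun u => ⟨(u.1 : V →L[ℝ] V), Algebra.subset_adjoin ⟨u, u.2, rfl⟩⟩
  have hlift : ∀ s ∈ S, ∃ a ∈ Subsemigroup.closure (Set.range t), (a : V →L[ℝ] V) = s := by
    intro s hs
    rw [hS] at hs
    induction hs using Subsemigroup.closure_induction with
    | mem x hx => exact ⟨t ⟨x, hx⟩, Subsemigroup.subset_closure ⟨_, rfl⟩, rfl⟩
    | mul x y _ _ hx hy =>
      obtain ⟨a, ha, hax⟩ := hx
      obtain ⟨b, hb, hby⟩ := hy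
      exact ⟨a * b, Subsemigroup.mul_mem _ ha hb, by
        rw [Units.val_mul, ← hax, ← hby]; rfl⟩
  have hdesc : ∀ a ∈ Subsemigroup.closure (Set.range t), ∃ s ∈ S, (s : V →L[ℝ] V) = a := by
    intro a ha
    induction ha using Subsemigroup.closure_induction with
    | mem x hx =>
      obtain ⟨u, rfl⟩ := hx
      exact ⟨u, hS ▸ Subsemigroup.subset_closure u.2, rfl⟩
    | mul x y _ _ hx hy =>
      obtain ⟨s, hs, hsx⟩ := hx
      obtain ⟨r, hr, hry⟩ := hy
      exact ⟨s * r, S.mul_mem hs hr, by rw [Units.val_mul, hsx, hry]; rfl⟩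
  let ev : A →ₗ[ℝ] V :=
    { toFun := fun a => (a : V →L[ℝ] V) v
      map_add' := fun _ _ => rfl
      map_smul' := fun _ _ => rfl }
  have hev : ∀ a : A, ev a = (a : V →L[ℝ] V) v := fun _ => rfl
  have hsurj : LinearMap.range ev = ⊤ := by
    refine Submodule.eq_top_of_coarselyDense _ (D := D) fun x => ?_
    obtain ⟨s, hs, hsx⟩ := hD x
    obtain ⟨a, -, ha⟩ := hlift s hs
    exact ⟨ev a, ⟨a, rfl⟩, by rwa [hev, ha]⟩
  have hinj : Function.Injective ev := by
    refine (injective_iff_map_eq_zero ev).2 fun a ha => ?_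
    ext x
    obtain ⟨b, rfl⟩ := LinearMap.range_eq_top.1 hsurj x
    have h1 : (a : V →L[ℝ] V) ((b : V →L[ℝ] V) v) = (b : V →L[ℝ] V) ((a : V →L[ℝ] V) v) :=
      congrArg (fun c : A => (c : V →L[ℝ] V) v) (mul_comm a b)
    rw [hev] at ha ⊢
    rw [h1, ha, map_zero]
    rfl
  have hunit : ∀ u, IsUnit (t u) := by
    intro u
    have : IsArtinianRing A := IsArtinianRing.of_finite ℝ A
    refine IsArtinianRing.isUnit_of_mem_nonZeroDivisors (mem_nonZeroDivisors_iff_right.2 ?_)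
    intro b hb
    have h1 : (b : V →L[ℝ] V) * (u.1 : V →L[ℝ] V) = 0 := congrArg Subtype.val hb
    exact Subtype.ext ((u.1.isUnit.mul_left_eq_zero).1 h1)
  let e : A ≃ₗ[ℝ] V := LinearEquiv.ofBijective ev ⟨hinj, LinearMap.range_eq_top.1 hsurj⟩
  have he : ∀ a : A, e a = (a : V →L[ℝ] V) v := fun _ => rfl
  refine (dense_image_closure_of_coarselyDense hunit e (D := D) fun x => ?_).mono ?_
  · obtain ⟨s, hs, hsx⟩ := hD x
    obtain ⟨a, ha, has⟩ := hlift s hs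
    exact ⟨a, ha, by rwa [he, has]⟩
  · rintro _ ⟨a, ha, rfl⟩
    obtain ⟨s, hs, hsa⟩ := hdesc a ha
    exact ⟨s, hs, by rw [hsa, he]⟩
end

section
/- Let $S$ be an additive subsemigroup of $\mathbb{R}^n$ with the property that whenever a linear form $l : \mathbb{R}^n \to \mathbb{R}$ has a positive value at some element of $S$, it also has a negative value at some element of $S$. Then the topological closure of $S$ is an additive subgroup of $\mathbb{R}^n$. -/
theorem convex_span_nnreal {E : Type*} [AddCommGroup E] [Module ℝ E] (S : Set E) :
    Convex ℝ (Submodule.span NNReal S : Set E) := by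
  intro y hy z hz a b ha hb _
  exact add_mem (Submodule.smul_mem _ (⟨a, ha⟩ : NNReal) hy)
    (Submodule.smul_mem _ (⟨b, hb⟩ : NNReal) hz)

/-- If every linear form taking a positive value on a spanning set `S` also takes a negative value
on `S`, then the convex cone generated by `S` is dense. -/
theorem dense_span_nnreal_of_forall_linearMap {E : Type*} [NormedAddCommGroup E] [NormedSpace ℝ E]
    {S : Set E} (hS : Submodule.span ℝ S = ⊤)
    (hl : ∀ l : E →ₗ[ℝ] ℝ, (∃ s ∈ S, 0 < l s) → ∃ s ∈ S, l s < 0) :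
    Dense (Submodule.span NNReal S : Set E) := by
  intro x
  by_contra hx
  obtain ⟨f, u, hfu, hux⟩ := geometric_hahn_banach_closed_point
    (convex_span_nnreal S).closure isClosed_closure hx
  have hu : 0 < u := by
    simpa using hfu 0 (subset_closure (zero_mem _))
  have hf : ∀ s ∈ S, f s ≤ 0 := by
    intro s hs
    by_contra! hpos
    have hmem : (⟨u / f s, by positivity⟩ : NNReal) • s ∈ Submodule.span NNReal S :=
      Submodule.smul_mem _ _ (Submodule.subset_span hs)
    have h : f ((u / f s) • s) < u := hfu _ (subset_closure hmem)
    rw [map_smul, smul_eq_mul, div_mul_cancel₀ _ hpos.ne'] at h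
    exact lt_irrefl _ h
  have hf0 : ∀ s ∈ S, f s = 0 := by
    intro s hs
    by_contra hne
    obtain ⟨t, ht, htneg⟩ := hl (-(f : E →ₗ[ℝ] ℝ)) ⟨s, hs, by
      simpa using lt_of_le_of_ne (hf s hs) hne⟩
    have := hf t ht
    simp at htneg
    linarith
  have hker : Submodule.span ℝ S ≤ LinearMap.ker (f : E →ₗ[ℝ] ℝ) :=
    Submodule.span_le.2 fun s hs => by simpa using hf0 s hs
  have hfx : f x = 0 := by
    simpa using hker (hS ▸ Submodule.mem_top : x ∈ Submodule.span ℝ S)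
  linarith

/-- In finite dimension, a dense convex cone generated by a spanning set is the whole space. -/
theorem span_nnreal_eq_top_of_dense {E : Type*} [NormedAddCommGroup E] [NormedSpace ℝ E]
    [FiniteDimensional ℝ E] {S : Set E} (hS : Submodule.span ℝ S = ⊤)
    (hd : Dense (Submodule.span NNReal S : Set E)) :
    Submodule.span NNReal S = ⊤ := by
  have hint : (interior (Submodule.span NNReal S : Set E)).Nonempty := by
    rw [(convex_span_nnreal S).interior_nonempty_iff_affineSpan_eq_top,
      AffineSubspace.affineSpan_eq_top_iff_vectorSpan_eq_top_of_nonempty ℝ E E ⟨0, zero_mem _⟩,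
      eq_top_iff, ← hS, Submodule.span_le]
    intro s hs
    simpa using vsub_mem_vectorSpan ℝ (Submodule.subset_span hs : s ∈
      (Submodule.span NNReal S : Set E)) (zero_mem (Submodule.span NNReal S))
  rw [Submodule.eq_top_iff']
  intro x
  obtain ⟨u, hu⟩ := hint
  obtain ⟨c, hc, hcS⟩ := hd.inter_open_nonempty
    ((fun y => x - y) ⁻¹' interior (Submodule.span NNReal S : Set E))
    (isOpen_interior.preimage (by fun_prop)) ⟨x - u, by simpa using hu⟩
  simpa using add_mem (interior_subset hc : x - c ∈ Submodule.span NNReal S) hcS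

/-- If every linear form taking a positive value on `S` also takes a negative value on `S`, then
the convex cone generated by `S` contains `-S`. -/
theorem neg_mem_span_nnreal {E : Type*} [NormedAddCommGroup E] [NormedSpace ℝ E]
    [FiniteDimensional ℝ E] {S : Set E}
    (hl : ∀ l : E →ₗ[ℝ] ℝ, (∃ s ∈ S, 0 < l s) → ∃ s ∈ S, l s < 0) {s : E} (hs : s ∈ S) :
    -s ∈ Submodule.span NNReal S := by
  set V := Submodule.span ℝ S
  set T : Set V := (↑) ⁻¹' S
  have hT : Submodule.span ℝ T = ⊤ := Submodule.span_span_coe_preimage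
  have hlT : ∀ l : V →ₗ[ℝ] ℝ, (∃ t ∈ T, 0 < l t) → ∃ t ∈ T, l t < 0 := by
    rintro l ⟨t, ht, hpos⟩
    obtain ⟨g, rfl⟩ := l.exists_extend
    obtain ⟨r, hr, hneg⟩ := hl g ⟨t, ht, hpos⟩
    exact ⟨⟨r, Submodule.subset_span hr⟩, hr, hneg⟩
  have htop := span_nnreal_eq_top_of_dense hT (dense_span_nnreal_of_forall_linearMap hT hlT)
  have hmem : -(⟨s, Submodule.subset_span hs⟩ : V) ∈ Submodule.span NNReal T :=
    htop ▸ Submodule.mem_top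
  have := Submodule.mem_map_of_mem (f := V.subtype.restrictScalars NNReal) hmem
  rw [Submodule.map_span] at this
  exact Submodule.span_mono (Set.image_preimage_subset _ _) this

/-- The ray through an element of the convex cone generated by `S` stays at bounded distance from
a sequence with increments in the additive monoid generated by `S`. -/
theorem exists_seq_near_ray {E : Type*} [NormedAddCommGroup E] [NormedSpace ℝ E]
    {S : Set E} {c : E} (hc : c ∈ Submodule.span NNReal S) :
    ∃ f : ℕ → E, (∀ j k, j ≤ k → f k - f j ∈ AddSubmonoid.closure S) ∧
      ∃ B : ℝ, ∀ k, ‖f k - (k : ℝ) • c‖ ≤ B := by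
  induction hc using Submodule.span_induction with
  | mem s hs =>
    refine ⟨fun k => k • s, fun j k hjk => ?_, 0, fun k => by simp [Nat.cast_smul_eq_nsmul]⟩
    obtain ⟨d, rfl⟩ := Nat.exists_eq_add_of_le hjk
    simpa [add_smul] using nsmul_mem (AddSubmonoid.subset_closure hs) d
  | zero => exact ⟨fun _ => 0, fun _ _ _ => by simp, 0, fun _ => by simp⟩
  | add x y _ _ hx hy =>
    obtain ⟨f, hf, A, hA⟩ := hx
    obtain ⟨g, hg, B, hB⟩ := hy
    refine ⟨fun k => f k + g k, fun j k hjk => ?_, A + B, fun k => ?_⟩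
    · rw [add_sub_add_comm]
      exact add_mem (hf j k hjk) (hg j k hjk)
    · rw [smul_add, add_sub_add_comm]
      exact norm_add_le_of_le (hA k) (hB k)
  | smul a x _ hx =>
    obtain ⟨f, hf, B, hB⟩ := hx
    refine ⟨fun k => f ⌊k * a⌋₊, fun j k hjk => hf _ _ (Nat.floor_mono (by gcongr)),
      B + ‖x‖, fun k => ?_⟩
    have hsplit : f ⌊k * a⌋₊ - (k : ℝ) • a • x =
        (f ⌊k * a⌋₊ - (⌊k * a⌋₊ : ℝ) • x) + ((⌊k * a⌋₊ : ℝ) - k * a) • x := by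
      rw [NNReal.smul_def, smul_smul, sub_smul]
      abel
    have hfloor : |(⌊k * a⌋₊ : ℝ) - k * a| ≤ 1 := by
      have h1 : (⌊k * a⌋₊ : ℝ) ≤ k * a := mod_cast Nat.floor_le (zero_le (a := k * a))
      have h2 : (k * a : ℝ) < ⌊k * a⌋₊ + 1 := mod_cast Nat.lt_floor_add_one (k * a)
      rw [abs_le]
      constructor <;> linarith
    rw [hsplit]
    refine norm_add_le_of_le (hB _) ?_
    rw [norm_smul, Real.norm_eq_abs]
    exact mul_le_of_le_one_left (norm_nonneg _) hfloor

/-- If `S` is closed under addition and the convex cone it generates contains the opposite of an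
element of `S`, then so does the closure of `S`. -/
theorem neg_mem_closure_of_neg_mem_span_nnreal {E : Type*} [NormedAddCommGroup E]
    [NormedSpace ℝ E] [FiniteDimensional ℝ E] {S : Set E}
    (hadd : ∀ a ∈ S, ∀ b ∈ S, a + b ∈ S) {s : E} (hs : s ∈ S)
    (hneg : -s ∈ Submodule.span NNReal S) : -s ∈ closure S := by
  have hadd_closure : ∀ m ∈ AddSubmonoid.closure S, ∀ a ∈ S, a + m ∈ S := by
    intro m hm
    induction hm using AddSubmonoid.closure_induction with
    | mem x hx => exact fun a ha => hadd a ha x hx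
    | zero => simp
    | add x y _ _ hx hy => exact fun a ha => add_assoc a x y ▸ hy _ (hx a ha)
  obtain ⟨f, hf, B, hB⟩ := exists_seq_near_ray hneg
  have : ProperSpace E := FiniteDimensional.proper ℝ E
  obtain ⟨L, -, φ, hφ, hL⟩ := tendsto_subseq_of_bounded
    (Metric.isBounded_closedBall (x := (0 : E)) (r := B))
    (x := fun k : ℕ => f k - (k : ℝ) • (-s)) (fun k => by simpa using hB k)
  rw [Metric.mem_closure_iff]
  intro ε hε
  obtain ⟨N, hN⟩ := Metric.cauchySeq_iff.1 hL.cauchySeq ε hε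
  have hlt : φ N + 2 ≤ φ (N + 2) := by
    have h1 := hφ (Nat.lt_succ_self N)
    have h2 := hφ (Nat.lt_succ_self (N + 1))
    simp only [Nat.succ_eq_add_one, add_assoc, Nat.reduceAdd] at h1 h2
    omega
  obtain ⟨d, hd⟩ := Nat.exists_eq_add_of_le hlt
  refine ⟨s + (d • s + (f (φ (N + 2)) - f (φ N))), hadd_closure _
    (add_mem (nsmul_mem (AddSubmonoid.subset_closure hs) d) (hf _ _ (by omega))) s hs, ?_⟩
  have h := hN N le_rfl (N + 2) (by omega)
  rw [dist_eq_norm] at h ⊢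
  convert h using 2
  simp only [Function.comp_apply]
  rw [show ((φ (N + 2) : ℕ) : ℝ) = φ N + 2 + d by rw [hd]; push_cast; ring,
    ← Nat.cast_smul_eq_nsmul ℝ d s]
  module


/-- If `S` is an additive subsemigroup of `ℝⁿ` such that every linear form
taking a positive value on `S` also takes a negative value on `S`, then the closure of `S`
is an additive subgroup of `ℝⁿ`. -/
theorem closure_of_semigroup_is_group
    {n : ℕ} (S : Set (Fin n → ℝ)) (hne : S.Nonempty)
    (hadd : ∀ a ∈ S, ∀ b ∈ S, a + b ∈ S)
    (hl : ∀ l : (Fin n → ℝ) →ₗ[ℝ] ℝ, (∃ s ∈ S, 0 < l s) → ∃ s ∈ S, l s < 0) :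
    ∃ H : AddSubgroup (Fin n → ℝ), (H : Set (Fin n → ℝ)) = closure S := by
  have hadd' : ∀ a ∈ closure S, ∀ b ∈ closure S, a + b ∈ closure S := fun a ha b hb =>
    map_mem_closure₂ continuous_add ha hb hadd
  have hneg : ∀ a ∈ closure S, -a ∈ closure S := fun a ha =>
    closure_minimal (fun s hs => neg_mem_closure_of_neg_mem_span_nnreal hadd hs
      (neg_mem_span_nnreal hl hs)) (isClosed_closure.preimage continuous_neg) ha
  obtain ⟨s, hs⟩ := hne
  have hs' := subset_closure hs
  exact ⟨{ carrier := closure S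
           add_mem' := fun {a b} ha hb => hadd' a ha b hb
           zero_mem' := by simpa using hadd' s hs' _ (hneg s hs')
           neg_mem' := fun {a} ha => hneg a ha }, rfl⟩
end

section
/- Let $S$ be an additive subsemigroup of $\mathbb{R}^n$ such that $l(S)$ is dense in $\mathbb{R}$ for every nonzero linear form $l : \mathbb{R}^n \to \mathbb{R}$. Then $S$ is dense in $\mathbb{R}^n$. -/
/-- A closed additive subgroup of a finite-dimensional real normed space that contains no line
is bounded away from zero outside zero. -/
theorem AddSubgroup.exists_forall_le_norm_of_no_line {E : Type*} [NormedAddCommGroup E]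
    [NormedSpace ℝ E] [FiniteDimensional ℝ E] (H : AddSubgroup E) (hH : IsClosed (H : Set E))
    (hline : ∀ v : E, (∀ t : ℝ, t • v ∈ H) → v = 0) :
    ∃ r : ℝ, 0 < r ∧ ∀ x ∈ H, x ≠ 0 → r ≤ ‖x‖ := by
  by_contra! hcon
  choose x hxH hx0 hxr using fun k : ℕ => hcon (1 / ((k : ℝ) + 1)) (by positivity)
  have hpos : ∀ k, 0 < ‖x k‖ := fun k => norm_pos_iff.2 (hx0 k)
  have hxlim : Filter.Tendsto (fun k => ‖x k‖) Filter.atTop (nhds 0) :=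
    squeeze_zero (fun k => norm_nonneg _) (fun k => (hxr k).le)
      tendsto_one_div_add_atTop_nhds_zero_nat
  have : ProperSpace E := FiniteDimensional.proper ℝ E
  obtain ⟨v, hv, φ, hφ, hlim⟩ := (isCompact_sphere (0 : E) 1).tendsto_subseq
    (x := fun k => ‖x k‖⁻¹ • x k)
    (fun k => by simp [norm_smul, inv_mul_cancel₀ (hpos k).ne'])
  have hv0 : v ≠ 0 := by
    rintro rfl
    simp at hv
  refine hv0 (hline v fun t => ?_)
  have hcoef : Filter.Tendsto (fun k => (⌊t / ‖x (φ k)‖⌋ : ℝ) * ‖x (φ k)‖)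
      Filter.atTop (nhds t) := by
    have hsub := hxlim.comp hφ.tendsto_atTop
    refine tendsto_of_tendsto_of_tendsto_of_le_of_le
      (g := fun k => t - ‖x (φ k)‖) (h := fun _ => t) ?_ tendsto_const_nhds ?_ ?_
    · simpa using tendsto_const_nhds.sub hsub
    · intro k
      have h1 := Int.lt_floor_add_one (t / ‖x (φ k)‖)
      rw [div_lt_iff₀ (hpos _)] at h1
      dsimp only
      linarith
    · intro k
      exact (le_div_iff₀ (hpos _)).1 (Int.floor_le (t / ‖x (φ k)‖))
  refine hH.mem_of_tendsto (hcoef.smul hlim) (Filter.Eventually.of_forall fun k => ?_)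
  have : ((⌊t / ‖x (φ k)‖⌋ : ℝ) * ‖x (φ k)‖) • (‖x (φ k)‖⁻¹ • x (φ k))
      = ⌊t / ‖x (φ k)‖⌋ • x (φ k) := by
    rw [smul_smul, mul_assoc, mul_inv_cancel₀ (hpos _).ne', mul_one, Int.cast_smul_eq_zsmul]
  simp only [Function.comp_apply, this]
  exact H.zsmul_mem (hxH _) _

/-- A discrete subgroup of a nontrivial finite-dimensional real normed space takes integer values
under some nonzero linear form. -/
theorem AddSubgroup.exists_form_int_of_le_norm {E : Type*} [NormedAddCommGroup E]
    [NormedSpace ℝ E] [FiniteDimensional ℝ E] [Nontrivial E] (H : AddSubgroup E) {r : ℝ}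
    (hr : 0 < r) (hH : ∀ x ∈ H, x ≠ 0 → r ≤ ‖x‖) :
    ∃ l : E →ₗ[ℝ] ℝ, l ≠ 0 ∧ ∀ x ∈ H, ∃ m : ℤ, l x = m := by
  by_cases hspan : Submodule.span ℝ (H : Set E) = ⊤
  · let L : Submodule ℤ E := AddSubgroup.toIntSubmodule H
    have hd : DiscreteTopology L := DiscreteTopology.of_forall_le_norm hr fun x hx =>
      hH x x.2 (by simpa using hx)
    have hL : IsZLattice ℝ L := ⟨hspan⟩
    have : Module.Finite ℤ L := ZLattice.module_finite ℝ L
    have : Module.Free ℤ L := ZLattice.module_free ℝ L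
    let b := Module.Free.chooseBasis ℤ L
    let B := b.ofZLatticeBasis ℝ L
    obtain ⟨i⟩ := B.index_nonempty
    refine ⟨B.coord i, fun h => ?_, fun x hx => ⟨b.repr ⟨x, hx⟩ i, ?_⟩⟩
    · have := LinearMap.congr_fun h (B i)
      simp at this
    · exact b.ofZLatticeBasis_repr_apply ℝ L ⟨x, hx⟩ i
  · obtain ⟨l, hl, hle⟩ := Submodule.exists_le_ker_of_lt_top _ (lt_top_iff_ne_top.2 hspan)
    exact ⟨l, hl, fun x hx => ⟨0, by simpa using hle (Submodule.subset_span hx)⟩⟩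

/-- A closed additive subgroup of a finite-dimensional real normed space whose image under every
nonzero linear form is dense is the whole space. -/
theorem AddSubgroup.eq_top_of_forms_dense {E : Type*} [NormedAddCommGroup E]
    [NormedSpace ℝ E] [FiniteDimensional ℝ E] (H : AddSubgroup E) (hH : IsClosed (H : Set E))
    (hl : ∀ l : E →ₗ[ℝ] ℝ, l ≠ 0 → Dense (l '' (H : Set E))) : H = ⊤ := by
  let V : Submodule ℝ E :=
    { carrier := {v | ∀ t : ℝ, t • v ∈ H}
      add_mem' := fun ha hb t => by
        rw [smul_add]
        exact H.add_mem (ha t) (hb t)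
      zero_mem' := fun t => by simp
      smul_mem' := fun c v hv t => by
        rw [smul_smul]
        exact hv _ }
  have hVH : ∀ v ∈ V, v ∈ H := fun v hv => by simpa using hv 1
  obtain ⟨W, hW⟩ := V.exists_isCompl
  rcases subsingleton_or_nontrivial W with hsub | hnon
  · have hVtop : V = ⊤ := by
      have := hW.sup_eq_top
      rwa [Submodule.subsingleton_iff_eq_bot.1 hsub, sup_bot_eq] at this
    exact (AddSubgroup.eq_top_iff' H).2 fun x => hVH x (hVtop ▸ Submodule.mem_top)
  · exfalso
    let K : AddSubgroup W := H.comap W.subtype.toAddMonoidHom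
    have hK : IsClosed (K : Set W) := hH.preimage continuous_subtype_val
    obtain ⟨r, hr, hrK⟩ := K.exists_forall_le_norm_of_no_line hK fun v hv => by
      have hvV : (v : E) ∈ V := fun t => hv t
      exact Subtype.ext (Submodule.disjoint_def.1 hW.disjoint v hvV v.2)
    obtain ⟨l, hl0, hlK⟩ := K.exists_form_int_of_le_norm hr hrK
    let p : E →ₗ[ℝ] W := W.projectionOnto V hW.symm
    have hlp : l ∘ₗ p ≠ 0 := fun h => hl0 <| LinearMap.ext fun w => by
      have := LinearMap.congr_fun h (w : E)
      simpa [p] using this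
    have hint : (l ∘ₗ p) '' (H : Set E) ⊆ Set.range ((↑) : ℤ → ℝ) := by
      rintro _ ⟨x, hx, rfl⟩
      have hpV : x - (p x : E) ∈ V := by
        rw [← Submodule.ker_projectionOnto hW.symm, LinearMap.mem_ker, map_sub,
          Submodule.projectionOnto_apply_left, sub_self]
      have hpK : p x ∈ K := by
        have := H.sub_mem hx (hVH _ hpV)
        rwa [sub_sub_cancel] at this
      obtain ⟨m, hm⟩ := hlK _ hpK
      exact ⟨m, hm.symm⟩
    have hdense := (hl _ hlp).mono hint
    have huniv := Real.isClosed_range_intCast.closure_eq ▸ hdense.closure_eq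
    obtain ⟨m, hm⟩ : (1 / 2 : ℝ) ∈ Set.range ((↑) : ℤ → ℝ) := huniv ▸ Set.mem_univ _
    have h2 : (2 * m : ℝ) = 1 := by linarith
    have : 2 * m = 1 := by exact_mod_cast h2
    omega

/-- A set on which no nonzero linear form is nonpositive generates the whole space as a
convex cone. -/
theorem PointedCone.hull_eq_top_of_forms {E : Type*} [NormedAddCommGroup E]
    [NormedSpace ℝ E] [FiniteDimensional ℝ E] (S : Set E)
    (hS : ∀ l : E →ₗ[ℝ] ℝ, l ≠ 0 → ∃ s ∈ S, 0 < l s) : PointedCone.hull ℝ S = ⊤ := by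
  set C := PointedCone.hull ℝ S
  have hSC : S ⊆ C := Submodule.subset_span
  have hspan : Submodule.span ℝ S = ⊤ := by
    by_contra h
    obtain ⟨l, hl, hle⟩ := Submodule.exists_le_ker_of_lt_top _ (lt_top_iff_ne_top.2 h)
    obtain ⟨s, hs, hpos⟩ := hS l hl
    have : l s = 0 := hle (Submodule.subset_span hs)
    exact hpos.ne' this
  have hconv : Convex ℝ (C : Set E) := PointedCone.convex C
  have hint : (interior (C : Set E)).Nonempty := by
    rw [hconv.interior_nonempty_iff_affineSpan_eq_top,
      AffineSubspace.affineSpan_eq_top_iff_vectorSpan_eq_top_of_nonempty ℝ E E ⟨0, C.zero_mem⟩,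
      eq_top_iff, ← hspan, Submodule.span_le]
    intro s hs
    simpa using vsub_mem_vectorSpan ℝ (hSC hs) C.zero_mem
  by_contra hne
  obtain ⟨x, hx⟩ : ∃ x, x ∉ C := by
    by_contra! h
    exact hne ((Submodule.eq_top_iff').2 h)
  obtain ⟨f, hf⟩ := geometric_hahn_banach_open_point hconv.interior isOpen_interior
    fun h => hx (interior_subset h)
  have hfC : ∀ y ∈ C, f y ≤ f x := fun y hy => by
    have hcl : y ∈ closure (interior (C : Set E)) := by
      rw [hconv.closure_interior_eq_closure_of_nonempty_interior hint]
      exact subset_closure hy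
    exact closure_minimal (fun a ha => (hf a ha).le)
      (isClosed_le f.continuous continuous_const) hcl
  have hf0 : (f : E →ₗ[ℝ] ℝ) ≠ 0 := fun h => by
    obtain ⟨a, ha⟩ := hint
    have h1 : f a = 0 := LinearMap.congr_fun h a
    have h2 : f x = 0 := LinearMap.congr_fun h x
    have := hf a ha
    linarith
  obtain ⟨s, hs, hpos⟩ := hS _ hf0
  have hpos' : 0 < f s := hpos
  have hx0 : 0 ≤ f x := by simpa using hfC 0 C.zero_mem
  have hc : 0 ≤ (f x + 1) / f s := by positivity
  have hle := hfC _ (C.smul_mem hc (hSC hs))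
  rw [map_smul, smul_eq_mul, div_mul_cancel₀ _ hpos'.ne'] at hle
  linarith

/-- If a subsemigroup generates the whole space as a convex cone, its closure is stable under
negation. -/
theorem neg_mem_closure_of_hull_eq_top {E : Type*} [NormedAddCommGroup E]
    [NormedSpace ℝ E] [FiniteDimensional ℝ E] (S : Set E)
    (hadd : ∀ a ∈ S, ∀ b ∈ S, a + b ∈ S) (hC : PointedCone.hull ℝ S = ⊤) {s : E} (hs : s ∈ S) :
    -s ∈ closure S := by
  obtain ⟨m, c, g, hsum⟩ := Submodule.mem_span_set'.1
    (show -s ∈ PointedCone.hull ℝ S from hC ▸ Submodule.mem_top)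
  have hsum' : ∑ i, (c i : ℝ) • (g i : E) = -s := hsum
  have hadd_sum : ∀ (q : Fin m → ℕ) (a : E), a ∈ S → ∀ t : Finset (Fin m),
      a + ∑ i ∈ t, q i • (g i : E) ∈ S := by
    have hnsmul : ∀ (k : ℕ) (a : E), a ∈ S → ∀ b ∈ S, a + k • b ∈ S := by
      intro k a ha b hb
      induction k with
      | zero => simpa using ha
      | succ k ih =>
        rw [succ_nsmul, ← add_assoc]
        exact hadd _ ih _ hb
    intro q a ha t
    induction t using Finset.induction_on with
    | empty => simpa using ha
    | insert i t hi ih =>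
      rw [Finset.sum_insert hi, add_left_comm, add_comm]
      exact hnsmul _ _ ih _ (g i).2
  obtain ⟨y, -, φ, hφ, hlim⟩ := (isCompact_Icc (a := (0 : Fin m → ℝ)) (b := 1)).tendsto_subseq
    (x := fun (k : ℕ) i => Int.fract ((k : ℝ) * c i))
    (fun k => ⟨fun i => Int.fract_nonneg _, fun i => (Int.fract_lt_one _).le⟩)
  let z : ℕ → Fin m → ℝ := fun k i => Int.fract ((φ k : ℝ) * c i)
  have hz : Filter.Tendsto z Filter.atTop (nhds y) := hlim
  have hdiff : Filter.Tendsto (fun k => ∑ i, (z k i - z (k + 2) i) • (g i : E) - s)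
      Filter.atTop (nhds (-s)) := by
    have h0 : Filter.Tendsto (fun k => ∑ i, (z k i - z (k + 2) i) • (g i : E))
        Filter.atTop (nhds (∑ i, (y i - y i) • (g i : E))) :=
      tendsto_finsetSum _ fun i _ => ((tendsto_pi_nhds.1 hz i).sub
        (tendsto_pi_nhds.1 (hz.comp (Filter.tendsto_add_atTop_nat 2)) i)).smul_const _
    simpa using h0.sub_const s
  refine mem_closure_of_tendsto hdiff (Filter.Eventually.of_forall fun k => ?_)
  have hlt : φ k + 2 ≤ φ (k + 2) :=
    (Nat.succ_le_succ (Nat.succ_le_of_lt (hφ k.lt_succ_self))).trans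
      (Nat.succ_le_of_lt (hφ (k + 1).lt_succ_self))
  obtain ⟨d, hd⟩ := Nat.exists_eq_add_of_le hlt
  have hmono : ∀ i, ∃ q : ℕ, ⌊(φ (k + 2) : ℝ) * c i⌋ - ⌊(φ k : ℝ) * c i⌋ = q := fun i =>
    Int.eq_ofNat_of_zero_le <| sub_nonneg.2 <| Int.floor_le_floor <|
      mul_le_mul_of_nonneg_right (by exact_mod_cast (by omega : φ k ≤ φ (k + 2))) (c i).2
  choose q hq using hmono
  have hS1 : ∀ j : ℕ, (j + 1) • s ∈ S := fun j => by
    induction j with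
    | zero => simpa using hs
    | succ j ih =>
      rw [succ_nsmul]
      exact hadd _ ih _ hs
  have hcoef : ∀ i, z k i - z (k + 2) i = q i - ((d : ℝ) + 2) * c i := fun i => by
    have h1 : ((⌊(φ (k + 2) : ℝ) * c i⌋ : ℝ)) - ⌊(φ k : ℝ) * c i⌋ = q i := by
      exact_mod_cast hq i
    have h2 : (φ (k + 2) : ℝ) = φ k + 2 + d := by exact_mod_cast hd
    have h3 := Int.floor_add_fract ((φ (k + 2) : ℝ) * c i)
    have h4 := Int.floor_add_fract ((φ k : ℝ) * c i)
    have h5 : (φ (k + 2) : ℝ) * c i = φ k * c i + (d + 2) * c i := by rw [h2]; ring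
    simp only [z]
    linarith
  have heq : ∑ i, (z k i - z (k + 2) i) • (g i : E) - s
      = (d + 1) • s + ∑ i, q i • (g i : E) := by
    simp only [hcoef, sub_smul, Finset.sum_sub_distrib, mul_smul, ← Finset.smul_sum, hsum',
      Nat.cast_smul_eq_nsmul]
    rw [← Nat.cast_smul_eq_nsmul ℝ (d + 1) s]
    push_cast
    module
  rw [heq]
  exact hadd_sum q _ (hS1 d) _


/-- If `S` is an additive subsemigroup of `ℝⁿ` such that `l(S)` is dense in
`ℝ` for every nonzero linear form `l`, then `S` is dense in `ℝⁿ`. -/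
theorem dense_of_forms_dense
    {n : ℕ} (S : Set (Fin n → ℝ)) (hne : S.Nonempty)
    (hadd : ∀ a ∈ S, ∀ b ∈ S, a + b ∈ S)
    (hl : ∀ l : (Fin n → ℝ) →ₗ[ℝ] ℝ, l ≠ 0 → Dense (l '' S)) :
    Dense S := by
  have hcone : PointedCone.hull ℝ S = ⊤ := PointedCone.hull_eq_top_of_forms S fun l hl0 => by
    obtain ⟨_, hpos, s, hs, rfl⟩ := (hl l hl0).inter_open_nonempty _ isOpen_Ioi
      ⟨(1 : ℝ), Set.mem_Ioi.2 one_pos⟩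
    exact ⟨s, hs, hpos⟩
  have hneg : ∀ x ∈ closure S, -x ∈ closure S := fun x hx =>
    closure_minimal (s := S) (t := Neg.neg ⁻¹' closure S)
      (fun s hs => neg_mem_closure_of_hull_eq_top S hadd hcone hs)
      (isClosed_closure.preimage continuous_neg) hx
  have haddc : ∀ a ∈ closure S, ∀ b ∈ closure S, a + b ∈ closure S := fun a ha b hb =>
    map_mem_closure₂ continuous_add ha hb hadd
  obtain ⟨s, hs⟩ := hne
  let H : AddSubgroup (Fin n → ℝ) :=
    { carrier := closure S
      add_mem' := fun ha hb => haddc _ ha _ hb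
      zero_mem' := by
        simpa using haddc s (subset_closure hs) _ (hneg s (subset_closure hs))
      neg_mem' := fun hx => hneg _ hx }
  have hH : H = ⊤ := H.eq_top_of_forms_dense isClosed_closure fun l hl0 =>
    (hl l hl0).mono (Set.image_mono subset_closure)
  intro x
  exact (AddSubgroup.eq_top_iff' H).1 hH x
end

section
/- Let $S$ be an additive subsemigroup of $\mathbb{R}$ which contains both a positive real number and a negative real number. Then either $S$ is dense in $\mathbb{R}$, or there exists $a \in \mathbb{R}$ such that $S$ equals the cyclic subgroup $\{ n a : n \in \mathbb{Z} \}$ of $\mathbb{R}$. -/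
/-- Positive integer multiples of two positive reals come arbitrarily close to each other. -/
theorem exists_nat_abs_succ_mul_sub_succ_mul_lt {p q ε : ℝ} (hp : 0 < p) (hq : 0 < q)
    (hε : 0 < ε) : ∃ k m : ℕ, |((k : ℝ) + 1) * p - ((m : ℝ) + 1) * q| < ε := by
  obtain ⟨n, hn⟩ := exists_nat_gt (q / min ε p)
  have hmin : 0 < min ε p := lt_min hε hp
  have hn0 : 0 < n := by
    have : (0 : ℝ) < n := (div_pos hq hmin).trans hn
    exact_mod_cast this
  obtain ⟨k, hk0, -, hk⟩ := Real.exists_nat_abs_mul_sub_round_le (p / q) hn0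
  generalize round ((k : ℝ) * (p / q)) = j at hk
  have hbound : |(k : ℝ) * p - j * q| < min ε p := by
    have h : (k : ℝ) * p - j * q = (k * (p / q) - j) * q := by field_simp
    rw [h, abs_mul, abs_of_pos hq]
    calc |(k : ℝ) * (p / q) - j| * q ≤ 1 / (n + 1) * q := by gcongr
      _ < min ε p := by
        rw [div_lt_iff₀ hmin] at hn
        rw [one_div_mul_eq_div, div_lt_iff₀ (by positivity)]
        linarith
  have hk1 : (1 : ℝ) ≤ k := by exact_mod_cast hk0
  have hj : 0 < j := by
    by_contra! hj
    have hj' : (j : ℝ) ≤ 0 := by exact_mod_cast hj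
    have := (le_abs_self _).trans_lt (hbound.trans_le (min_le_right _ _))
    nlinarith
  refine ⟨k - 1, (j - 1).toNat, ?_⟩
  have e1 : (((k - 1 : ℕ) : ℝ)) + 1 = k := by
    exact_mod_cast Nat.sub_add_cancel hk0
  have e2 : ((((j - 1).toNat : ℕ) : ℝ)) + 1 = j := by
    have : (((j - 1).toNat : ℕ) : ℤ) + 1 = j := by omega
    exact_mod_cast this
  rw [e1, e2]
  exact hbound.trans_le (min_le_left _ _)

/-- The closure of an additive subsemigroup of `ℝ` containing a positive and a negative number
is a subgroup. -/
theorem exists_addSubgroup_coe_eq_closure {S : Set ℝ}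
    (hadd : ∀ a ∈ S, ∀ b ∈ S, a + b ∈ S)
    (hpos : ∃ s ∈ S, (0 : ℝ) < s) (hneg : ∃ s ∈ S, s < (0 : ℝ)) :
    ∃ G : AddSubgroup ℝ, (G : Set ℝ) = closure S := by
  have hmul : ∀ x ∈ S, ∀ y ∈ S, ∀ k : ℕ, x + k * y ∈ S := by
    intro x hx y hy k
    induction k with
    | zero => simpa using hx
    | succ k ih =>
      have := hadd _ ih _ hy
      convert this using 1
      push_cast
      ring
  obtain ⟨p, hpS, hp⟩ := hpos
  obtain ⟨t, htS, ht⟩ := hneg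
  have hzero : (0 : ℝ) ∈ closure S := by
    refine Metric.mem_closure_iff.2 fun ε hε => ?_
    obtain ⟨k, m, h⟩ := exists_nat_abs_succ_mul_sub_succ_mul_lt hp (neg_pos.2 ht) hε
    refine ⟨_, hadd _ (hmul p hpS p hpS k) _ (hmul t htS t htS m), ?_⟩
    rw [dist_comm, Real.dist_eq]
    convert h using 2
    ring
  have hnegS : ∀ x ∈ S, -x ∈ closure S := by
    intro x hx
    refine Metric.mem_closure_iff.2 fun ε hε => ?_
    rcases lt_trichotomy x 0 with hx0 | rfl | hx0
    · obtain ⟨k, m, h⟩ := exists_nat_abs_succ_mul_sub_succ_mul_lt hp (neg_pos.2 hx0) hε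
      refine ⟨_, hmul _ (hmul p hpS p hpS k) x hx m, ?_⟩
      rw [dist_comm, Real.dist_eq]
      convert h using 2
      ring
    · exact ⟨0, hx, by simpa using hε⟩
    · obtain ⟨k, m, h⟩ := exists_nat_abs_succ_mul_sub_succ_mul_lt hx0 (neg_pos.2 ht) hε
      refine ⟨_, hmul _ (hmul t htS t htS m) x hx k, ?_⟩
      rw [dist_comm, Real.dist_eq]
      convert h using 2
      ring
  exact ⟨{ carrier := closure S
           add_mem' := fun ha hb => map_mem_closure₂ continuous_add ha hb hadd
           zero_mem' := hzero
           neg_mem' := fun ha => by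
            simpa only [closure_closure] using map_mem_closure continuous_neg ha hnegS }, rfl⟩

/-- An additive subsemigroup of `ℝ` containing both a positive and a
negative number is either dense in `ℝ` or a cyclic subgroup of `ℝ`. -/
theorem dense_or_cyclic
    (S : Set ℝ) (hne : S.Nonempty)
    (hadd : ∀ a ∈ S, ∀ b ∈ S, a + b ∈ S)
    (hpos : ∃ s ∈ S, (0 : ℝ) < s) (hneg : ∃ s ∈ S, s < (0 : ℝ)) :
    Dense S ∨ ∃ a : ℝ, S = {x : ℝ | ∃ k : ℤ, x = (k : ℝ) * a} := by
  obtain ⟨G, hG⟩ := exists_addSubgroup_coe_eq_closure hadd hpos hneg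
  rcases G.dense_or_cyclic with hd | ⟨a, ha⟩
  · left
    rwa [hG, dense_closure] at hd
  · right
    have hmem : ∀ x, x ∈ closure S ↔ ∃ k : ℤ, x = (k : ℝ) * a := by
      intro x
      rw [← hG, SetLike.mem_coe, ha, AddSubgroup.mem_closure_singleton]
      simp only [zsmul_eq_mul, eq_comm]
    refine ⟨a, Set.Subset.antisymm (fun x hx => (hmem x).1 (subset_closure hx)) ?_⟩
    have ha0 : 0 < |a| := by
      obtain ⟨p, hpS, hp⟩ := hpos
      obtain ⟨k, hk⟩ := (hmem p).1 (subset_closure hpS)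
      refine abs_pos.2 ?_
      rintro rfl
      simp [hk] at hp
    rintro x ⟨k, rfl⟩
    obtain ⟨y, hy, hxy⟩ := Metric.mem_closure_iff.1 ((hmem _).2 ⟨k, rfl⟩) |a| ha0
    obtain ⟨l, rfl⟩ := (hmem y).1 (subset_closure hy)
    rw [Real.dist_eq, ← sub_mul, abs_mul, mul_lt_iff_lt_one_left ha0] at hxy
    have hkl : |k - l| < 1 := by exact_mod_cast hxy
    rw [Int.abs_lt_one_iff, sub_eq_zero] at hkl
    rwa [hkl]
end

section
/- Let $S$ be a finitely generated subsemigroup of the additive group $\mathbb{R}$. Then either $S$ is dense in $\mathbb{R}$, or every bounded interval in $\mathbb{R}$ contains only finitely many elements of $S$. -/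
theorem finite_zmultiples_inter_Icc (t a b : ℝ) :
    ((AddSubgroup.zmultiples t : Set ℝ) ∩ Set.Icc a b).Finite := by
  have h := AddSubgroup.tendsto_zmultiples_subtype_cofinite t
  have hc : (Set.Icc a b)ᶜ ∈ Filter.cocompact ℝ := isCompact_Icc.compl_mem_cocompact
  have hf := Filter.mem_cofinite.1 (h hc)
  refine (hf.image Subtype.val).subset ?_
  rintro x ⟨hx, hx'⟩
  exact ⟨⟨x, hx⟩, by simpa using hx', rfl⟩

theorem nonneg_of_mem_closure {T : Set ℝ} (hT : ∀ t ∈ T, 0 ≤ t) {x : ℝ}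
    (hx : x ∈ AddSubmonoid.closure T) : 0 ≤ x :=
  (AddSubmonoid.closure_le (S := AddSubmonoid.nonneg ℝ)).2 hT hx

theorem finite_closure_inter_Iic (T : Finset ℝ) (hT : ∀ t ∈ T, 0 ≤ t) (b : ℝ) :
    ((AddSubmonoid.closure (T : Set ℝ) : Set ℝ) ∩ Set.Iic b).Finite := by
  induction T using Finset.induction_on with
  | empty =>
    refine (Set.finite_singleton (0 : ℝ)).subset ?_
    rintro x ⟨hx, -⟩
    simpa using hx
  | insert t T _ ih =>
    have hT' : ∀ u ∈ T, 0 ≤ u := fun u hu => hT u (Finset.mem_insert_of_mem hu)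
    have ht : 0 ≤ t := hT t (Finset.mem_insert_self t T)
    refine ((finite_zmultiples_inter_Icc t 0 b).image2 (· + ·) (ih hT')).subset ?_
    rintro x ⟨hx, hxb⟩
    rw [Finset.coe_insert, Set.insert_eq, AddSubmonoid.closure_union, SetLike.mem_coe,
      AddSubmonoid.mem_sup] at hx
    obtain ⟨y, hy, z, hz, rfl⟩ := hx
    obtain ⟨n, rfl⟩ := AddSubmonoid.mem_closure_singleton.1 hy
    have hn : 0 ≤ n • t := nsmul_nonneg ht n
    have hz0 := nonneg_of_mem_closure hT' hz
    rw [Set.mem_Iic] at hxb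
    exact ⟨n • t, ⟨⟨n, by simp⟩, hn, by linarith⟩, z, ⟨hz, by rw [Set.mem_Iic]; linarith⟩, rfl⟩

theorem finite_addSubsemigroup_closure_inter_Icc (T : Finset ℝ) (hT : ∀ t ∈ T, 0 ≤ t)
    (a b : ℝ) : ((AddSubsemigroup.closure (T : Set ℝ) : Set ℝ) ∩ Set.Icc a b).Finite := by
  refine (finite_closure_inter_Iic T hT b).subset ?_
  rintro x ⟨hx, hx'⟩
  exact ⟨(AddSubsemigroup.closure_le (S := (AddSubmonoid.closure (T : Set ℝ)).toAddSubsemigroup)).2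
    AddSubmonoid.subset_closure hx, hx'.2⟩

/-- Positive integer combinations of a positive and a negative real can be made arbitrarily
small. -/
theorem exists_abs_succ_mul_add_succ_mul_lt {x y ε : ℝ} (hx : 0 < x) (hy : y < 0) (hε : 0 < ε) :
    ∃ j k : ℕ, |((j + 1 : ℕ) : ℝ) * x + ((k + 1 : ℕ) : ℝ) * y| < ε := by
  have hα : 0 < -y / x := div_pos (neg_pos.2 hy) hx
  obtain ⟨n, hn⟩ := exists_nat_one_div_lt (lt_min hα (div_pos hε hx))
  obtain ⟨hnα, hnε⟩ := lt_min_iff.1 hn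
  have hn1 : (1 : ℝ) / ((n + 1 : ℕ) + 1) < 1 / (n + 1) := by
    push_cast
    exact one_div_lt_one_div_of_lt (by positivity) (by linarith)
  obtain ⟨j, k, hk, -, h⟩ := Real.exists_int_int_abs_mul_sub_le (-y / x) (Nat.succ_pos n)
  replace h := h.trans_lt hn1
  have hk1 : (1 : ℝ) ≤ k := by exact_mod_cast hk
  have hj : 0 < j := by
    have : (0 : ℝ) < j := by nlinarith [(abs_lt.1 h).2]
    exact_mod_cast this
  lift j to ℕ using hj.le
  lift k to ℕ using hk.le
  obtain ⟨j, rfl⟩ := Nat.exists_eq_succ_of_ne_zero (by omega : j ≠ 0)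
  obtain ⟨k, rfl⟩ := Nat.exists_eq_succ_of_ne_zero (by omega : k ≠ 0)
  refine ⟨j, k, ?_⟩
  have key : ((j + 1 : ℕ) : ℝ) * x + ((k + 1 : ℕ) : ℝ) * y =
      -((((k + 1 : ℕ) : ℝ) * (-y / x) - ((j + 1 : ℕ) : ℝ)) * x) := by
    field_simp
    ring
  rw [key, abs_neg, abs_mul, abs_of_pos hx]
  exact (lt_div_iff₀ hx).1 (h.trans hnε)

theorem natCast_mul_add_mem (S : AddSubsemigroup ℝ) {x y : ℝ} (hx : x ∈ S) (hy : y ∈ S) (j : ℕ) :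
    (j : ℝ) * x + y ∈ S := by
  induction j with
  | zero => simpa using hy
  | succ j ih =>
    convert S.add_mem hx ih using 1
    push_cast
    ring

theorem natCast_succ_mul_mem (S : AddSubsemigroup ℝ) {x : ℝ} (hx : x ∈ S) (j : ℕ) :
    ((j + 1 : ℕ) : ℝ) * x ∈ S := by
  convert natCast_mul_add_mem S hx hx j using 1
  push_cast
  ring

/-- The closure of a subsemigroup of `ℝ` containing a positive and a negative element is
a subgroup. -/
theorem exists_addSubgroup_coe_eq_closure_s8 (S : AddSubsemigroup ℝ) {p q : ℝ} (hp : p ∈ S)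
    (hp0 : 0 < p) (hq : q ∈ S) (hq0 : q < 0) :
    ∃ G : AddSubgroup ℝ, (G : Set ℝ) = closure (S : Set ℝ) := by
  have zero_mem : (0 : ℝ) ∈ closure (S : Set ℝ) := by
    refine Metric.mem_closure_iff.2 fun ε hε => ?_
    obtain ⟨j, k, h⟩ := exists_abs_succ_mul_add_succ_mul_lt hp0 hq0 hε
    refine ⟨_, S.add_mem (natCast_succ_mul_mem S hp j) (natCast_succ_mul_mem S hq k), ?_⟩
    rwa [dist_comm, Real.dist_eq, sub_zero]
  have neg_mem : ∀ x ∈ S, -x ∈ closure (S : Set ℝ) := by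
    intro x hx
    rcases lt_trichotomy x 0 with hx0 | rfl | hx0
    · refine Metric.mem_closure_iff.2 fun ε hε => ?_
      obtain ⟨j, k, h⟩ := exists_abs_succ_mul_add_succ_mul_lt hp0 hx0 hε
      refine ⟨_, natCast_mul_add_mem S hx (natCast_succ_mul_mem S hp j) k, ?_⟩
      rw [dist_comm, Real.dist_eq]
      convert h using 2
      push_cast
      ring
    · simpa using zero_mem
    · refine Metric.mem_closure_iff.2 fun ε hε => ?_
      obtain ⟨j, k, h⟩ := exists_abs_succ_mul_add_succ_mul_lt hx0 hq0 hε
      refine ⟨_, natCast_mul_add_mem S hx (natCast_succ_mul_mem S hq k) j, ?_⟩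
      rw [dist_comm, Real.dist_eq]
      convert h using 2
      push_cast
      ring
  refine ⟨{ carrier := closure (S : Set ℝ)
            add_mem' := fun ha hb => S.topologicalClosure.add_mem ha hb
            zero_mem' := zero_mem
            neg_mem' := fun {x} hx => ?_ }, rfl⟩
  rw [← closure_closure (s := (S : Set ℝ))]
  exact map_mem_closure continuous_neg hx neg_mem

/-- A finitely generated additive subsemigroup of `ℝ` is either dense in
`ℝ`, or every bounded interval contains only finitely many of its elements. -/
theorem dense_or_locally_finite
    (S : Set ℝ) (hne : S.Nonempty)
    (hfg : ∃ T : Finset ℝ, S = (AddSubsemigroup.closure (T : Set ℝ) : Set ℝ)) :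
    Dense S ∨ ∀ a b : ℝ, (S ∩ Set.Icc a b).Finite := by
  obtain ⟨T, rfl⟩ := hfg
  by_cases hpos : ∀ t ∈ T, 0 ≤ t
  · exact Or.inr (finite_addSubsemigroup_closure_inter_Icc T hpos)
  by_cases hneg : ∀ t ∈ T, t ≤ 0
  · refine Or.inr fun a b => ?_
    have h := finite_addSubsemigroup_closure_inter_Icc (T.image Neg.neg)
      (by simpa using hneg) (-b) (-a)
    refine (h.image Neg.neg).subset ?_
    rintro x ⟨hx, hxa, hxb⟩
    refine ⟨-x, ⟨?_, neg_le_neg hxb, neg_le_neg hxa⟩, neg_neg x⟩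
    clear hxa hxb
    induction hx using AddSubsemigroup.closure_induction with
    | mem x hx => exact AddSubsemigroup.subset_closure (by simpa using hx)
    | add x y _ _ ihx ihy =>
      rw [neg_add]
      exact AddSubsemigroup.add_mem _ ihx ihy
  push Not at hpos hneg
  obtain ⟨q, hq, hq0⟩ := hpos
  obtain ⟨p, hp, hp0⟩ := hneg
  obtain ⟨G, hG⟩ := exists_addSubgroup_coe_eq_closure_s8 (AddSubsemigroup.closure (T : Set ℝ))
    (AddSubsemigroup.subset_closure hp) hp0 (AddSubsemigroup.subset_closure hq) hq0
  rcases G.dense_or_cyclic with h | ⟨g, rfl⟩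
  · rw [hG] at h
    exact Or.inl (dense_closure.1 h)
  · refine Or.inr fun a b => (finite_zmultiples_inter_Icc g a b).subset ?_
    rw [AddSubgroup.zmultiples_eq_closure, hG]
    exact Set.inter_subset_inter_left _ subset_closure
end

section
/- Let $\mathbb{R}^*_+$ denote the multiplicative group of positive real numbers, endowed with the metric induced from the Euclidean metric of $\mathbb{R}$. Then every finitely generated subsemigroup of $\mathbb{R}^*_+$ which is coarsely dense in $\mathbb{R}^*_+$ is dense in $\mathbb{R}^*_+$. -/
/-- Positive combinations of two numbers of opposite signs come arbitrarily close to `0`. -/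
lemma exists_nat_nat_abs_mul_add_mul_lt {a b ε : ℝ} (ha : 0 < a) (hb : b < 0) (hε : 0 < ε) :
    ∃ n m : ℕ, 2 ≤ n ∧ 2 ≤ m ∧ |n * a + m * b| < ε := by
  obtain ⟨N, hN⟩ := exists_nat_gt (2 * (-b) / min ε a)
  have hmin : 0 < min ε a := lt_min hε ha
  have hb' : 0 < -b := by linarith
  have hb0 : b ≠ 0 := hb.ne
  have hNpos : 0 < N := by
    have : (0 : ℝ) < N := lt_trans (by positivity) hN
    exact_mod_cast this
  obtain ⟨j, k, hk, -, hjk⟩ := Real.exists_int_int_abs_mul_sub_le (a / -b) hNpos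
  have hlt : |k * a + j * b| < min ε a / 2 := by
    have h1 : k * a + j * b = (k * (a / -b) - j) * -b := by
      field_simp
      ring
    rw [h1, abs_mul, abs_of_pos hb']
    refine (mul_le_mul_of_nonneg_right hjk hb'.le).trans_lt ?_
    rw [div_lt_iff₀ hmin] at hN
    rw [div_mul_eq_mul_div, div_lt_iff₀ (by positivity)]
    nlinarith
  have hk1 : (1 : ℝ) ≤ k := by exact_mod_cast hk
  have hj : 0 < j := by
    by_contra! hj
    have hj' : (j : ℝ) ≤ 0 := by exact_mod_cast hj
    have := (abs_lt.1 hlt).2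
    nlinarith [min_le_right ε a, mul_nonneg_of_nonpos_of_nonpos hj' hb.le]
  lift j to ℕ using hj.le
  lift k to ℕ using hk.le
  refine ⟨2 * k, 2 * j, by omega, by omega, ?_⟩
  push_cast at hlt ⊢
  rw [show (2 * k * a + 2 * j * b : ℝ) = 2 * (k * a + j * b) by ring, abs_mul, abs_two]
  linarith [min_le_left ε a]

lemma natCast_mul_mem_addSubsemigroup {A : AddSubsemigroup ℝ} {a : ℝ} (ha : a ∈ A) {n : ℕ}
    (hn : 1 ≤ n) : n * a ∈ A := by
  induction n, hn using Nat.le_induction with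
  | base => simpa using ha
  | succ n _ ih =>
    rw [Nat.cast_add_one, add_one_mul]
    exact A.add_mem ih ha

lemma neg_mem_closure_of_pos_of_neg {A : AddSubsemigroup ℝ} {a b : ℝ}
    (ha : a ∈ A) (hb : b ∈ A) (ha0 : 0 < a) (hb0 : b < 0) :
    0 ∈ closure (A : Set ℝ) ∧ -a ∈ closure (A : Set ℝ) ∧ -b ∈ closure (A : Set ℝ) := by
  simp only [Metric.mem_closure_iff, Real.dist_eq]
  refine ⟨fun ε hε => ?_, fun ε hε => ?_, fun ε hε => ?_⟩ <;>
    obtain ⟨n, m, hn, hm, h⟩ := exists_nat_nat_abs_mul_add_mul_lt ha0 hb0 hε <;>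
    rw [← abs_neg] at h
  · refine ⟨_, A.add_mem (natCast_mul_mem_addSubsemigroup ha (n := n) (by omega))
      (natCast_mul_mem_addSubsemigroup hb (n := m) (by omega)), ?_⟩
    convert h using 2
    ring
  · refine ⟨_, A.add_mem (natCast_mul_mem_addSubsemigroup ha (n := n - 1) (by omega))
      (natCast_mul_mem_addSubsemigroup hb (n := m) (by omega)), ?_⟩
    convert h using 2
    rw [Nat.cast_sub (by omega)]
    push_cast
    ring
  · refine ⟨_, A.add_mem (natCast_mul_mem_addSubsemigroup ha (n := n) (by omega))
      (natCast_mul_mem_addSubsemigroup hb (n := m - 1) (by omega)), ?_⟩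
    convert h using 2
    rw [Nat.cast_sub (by omega)]
    push_cast
    ring

/-- The closure of a subsemigroup of `ℝ` containing both positive and negative elements is a
subgroup. -/
lemma exists_addSubgroup_coe_eq_closure_s10 {A : AddSubsemigroup ℝ} {a b : ℝ}
    (ha : a ∈ A) (hb : b ∈ A) (ha0 : 0 < a) (hb0 : b < 0) :
    ∃ G : AddSubgroup ℝ, (G : Set ℝ) = closure (A : Set ℝ) := by
  have hneg : ∀ c ∈ A, -c ∈ closure (A : Set ℝ) := fun c hc => by
    rcases lt_trichotomy c 0 with h | rfl | h
    · exact (neg_mem_closure_of_pos_of_neg ha hc ha0 h).2.2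
    · rw [neg_zero]
      exact subset_closure hc
    · exact (neg_mem_closure_of_pos_of_neg hc hb h hb0).2.1
  refine ⟨{ carrier := closure (A : Set ℝ)
            add_mem' := fun hx hy => map_mem_closure₂ continuous_add hx hy
              fun _ hx _ hy => A.add_mem hx hy
            zero_mem' := (neg_mem_closure_of_pos_of_neg ha hb ha0 hb0).1
            neg_mem' := fun {x} hx => ?_ }, rfl⟩
  have h := map_mem_closure continuous_neg hx (t := closure (A : Set ℝ)) hneg
  rwa [closure_closure] at h

/-- A coarsely dense set of positive reals is not contained in a geometric progression. -/
lemma not_coarselyDense_of_subset_exp_zmultiples {S : Set ℝ} {c D : ℝ} (hc : 0 < c)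
    (hS : ∀ s ∈ S, ∃ n : ℤ, s = Real.exp (n * c))
    (hcd : ∀ x ∈ Set.Ioi (0 : ℝ), ∃ s ∈ S, |x - s| < D) : False := by
  have hq : 1 < Real.exp c := Real.one_lt_exp_iff.2 hc
  obtain ⟨n, hn⟩ := pow_unbounded_of_one_lt (2 * D / (Real.exp c - 1)) hq
  rw [div_lt_iff₀ (by linarith), ← Real.exp_nat_mul] at hn
  have hmul : Real.exp (n * c) * Real.exp c = Real.exp ((n + 1) * c) := by
    rw [← Real.exp_add]
    ring_nf
  obtain ⟨s, hs, hd⟩ := hcd ((Real.exp (n * c) + Real.exp ((n + 1) * c)) / 2)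
    (Set.mem_Ioi.2 (by positivity))
  obtain ⟨k, rfl⟩ := hS s hs
  rw [abs_lt] at hd
  have h1 : Real.exp (n * c) < Real.exp (k * c) := by linarith
  have h2 : Real.exp (k * c) < Real.exp ((n + 1) * c) := by linarith
  rw [Real.exp_lt_exp, mul_lt_mul_iff_left₀ hc] at h1 h2
  norm_cast at h1 h2
  omega

/-- Elements of bounded size in a semigroup generated by `k` numbers that are at least `r > 1`:
those up to `r ^ M` are at most `(M + 1) ^ k` in number. -/
lemma exists_finset_card_le_of_mem_closure {T : Finset ℝ} {r : ℝ} (hr : 1 < r)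
    (hT : ∀ t ∈ T, r ≤ t) (M : ℕ) :
    ∃ F : Finset ℝ, F.card ≤ (M + 1) ^ T.card ∧
      ∀ s ∈ Submonoid.closure (T : Set ℝ), s ≤ r ^ M → s ∈ F := by
  classical
  refine ⟨(Fintype.piFinset fun _ : T => Finset.range (M + 1)).image
    fun n => ∏ t : T, (t : ℝ) ^ n t, Finset.card_image_le.trans (by simp), ?_⟩
  intro s hs hsM
  obtain ⟨f, -, rfl⟩ := Submonoid.mem_closure_finset.1 hs
  refine Finset.mem_image.2 ⟨fun t => f t, Fintype.mem_piFinset.2 fun t => ?_,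
    Finset.prod_coe_sort T fun t => t ^ f t⟩
  have h1 : (t : ℝ) ^ f t ≤ ∏ u ∈ T, u ^ f u :=
    calc
      (t : ℝ) ^ f t = ∏ u ∈ {(t : ℝ)}, u ^ f u := (Finset.prod_singleton _ _).symm
      _ ≤ ∏ u ∈ T, u ^ f u := Finset.prod_le_prod_of_subset_of_one_le
        (Finset.singleton_subset_iff.2 t.2)
        (fun u hu => by rw [Finset.mem_singleton.1 hu]; exact pow_nonneg (by linarith [hT t t.2]) _)
        fun u hu _ => one_le_pow₀ (hr.le.trans (hT u hu))
  have h2 : r ^ f t ≤ r ^ M :=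
    (pow_le_pow_left₀ (by linarith) (hT t t.2) _).trans (h1.trans hsM)
  rw [pow_le_pow_iff_right₀ hr] at h2
  exact Finset.mem_range.2 (by omega)

/-- A finite set which is coarsely dense below `x` has at least linearly many elements in `x`. -/
lemma le_mul_card_of_coarselyDense {S : Set ℝ} {D x : ℝ} (hD : 0 < D)
    (hcd : ∀ x ∈ Set.Ioi (0 : ℝ), ∃ s ∈ S, |x - s| < D) {F : Finset ℝ}
    (hF : ∀ s ∈ S, s ≤ x → s ∈ F) : x ≤ 2 * D * (F.card + 2) := by
  by_contra! hx
  have hpos : ∀ i : ℕ, 2 * D * (i + 1) ∈ Set.Ioi (0 : ℝ) := fun i => Set.mem_Ioi.2 (by positivity)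
  choose! g hgS hg using hcd
  have hcard : (Finset.range (F.card + 1)).card ≤ F.card := by
    refine Finset.card_le_card_of_injOn (fun i : ℕ => g (2 * D * (i + 1))) (fun i hi => ?_) ?_
    · have hi' : (i : ℝ) ≤ F.card := by
        exact_mod_cast Nat.lt_succ_iff.1 (Finset.mem_range.1 hi)
      refine hF _ (hgS _ (hpos i)) ?_
      have := (abs_lt.1 (hg _ (hpos i))).1
      nlinarith
    · intro i _ j _ hij
      have h1 := abs_lt.1 (hg _ (hpos i))
      have h2 := abs_lt.1 (hg _ (hpos j))
      simp only at hij
      rw [hij] at h1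
      have h3 : (i : ℝ) < j + 1 := by
        by_contra! h
        nlinarith
      have h4 : (j : ℝ) < i + 1 := by
        by_contra! h
        nlinarith
      norm_cast at h3 h4
      omega
  simp at hcard

/-- The semigroup generated by finitely many numbers that are at least `1` grows too slowly to
be coarsely dense. -/
lemma exists_lt_one_of_coarselyDense_closure {T : Finset ℝ} {D : ℝ} (hD : 0 < D)
    (hcd : ∀ x ∈ Set.Ioi (0 : ℝ),
      ∃ s ∈ (Subsemigroup.closure (T : Set ℝ) : Set ℝ), |x - s| < D) :
    ∃ t ∈ T, t < 1 := by
  by_contra! hT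
  have hT' : ∀ t ∈ T.erase 1, 1 < t := fun t ht =>
    lt_of_le_of_ne (hT t (Finset.mem_of_mem_erase ht)) (Finset.ne_of_mem_erase ht).symm
  obtain ⟨r, hr, hrT⟩ : ∃ r : ℝ, 1 < r ∧ ∀ t ∈ T.erase 1, r ≤ t := by
    rcases (T.erase 1).eq_empty_or_nonempty with h | h
    · exact ⟨2, one_lt_two, by simp [h]⟩
    · exact ⟨(T.erase 1).min' h, hT' _ (Finset.min'_mem _ h), fun t ht => Finset.min'_le _ t ht⟩
  have hle : ∀ s ∈ (Subsemigroup.closure (T : Set ℝ) : Set ℝ),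
      s ∈ Submonoid.closure ((T.erase 1 : Finset ℝ) : Set ℝ) := by
    have : Subsemigroup.closure (T : Set ℝ) ≤
        (Submonoid.closure ((T.erase 1 : Finset ℝ) : Set ℝ)).toSubsemigroup := by
      refine Subsemigroup.closure_le.2 fun t ht => ?_
      by_cases h : t = 1
      · rw [h]
        exact Submonoid.one_mem _
      · exact Submonoid.subset_closure (Finset.mem_coe.2 (Finset.mem_erase.2 ⟨h, ht⟩))
    exact fun s hs => this hs
  set k := (T.erase 1).card
  have hbound : ∀ M : ℕ, r ^ M ≤ 2 * D * (((M + 1 : ℕ) : ℝ) ^ k + 2) := fun M => by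
    obtain ⟨F, hFc, hF⟩ := exists_finset_card_le_of_mem_closure hr hrT M
    have h := le_mul_card_of_coarselyDense hD hcd fun s hs => hF s (hle s hs)
    have hFc' : (F.card : ℝ) ≤ ((M + 1 : ℕ) : ℝ) ^ k := by exact_mod_cast hFc
    exact h.trans (by gcongr)
  have hlim := ((tendsto_pow_const_div_const_pow_of_one_lt k hr).comp
    (Filter.tendsto_add_atTop_nat 1)).eventually_lt_const
      (show (0 : ℝ) < 1 / (6 * D * r) by positivity)
  obtain ⟨M, hM⟩ := hlim.exists
  have hP : (1 : ℝ) ≤ ((M + 1 : ℕ) : ℝ) ^ k := one_le_pow₀ (by simp)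
  simp only [Function.comp_apply] at hM
  rw [div_lt_div_iff₀ (by positivity) (by positivity), one_mul, pow_succ] at hM
  have hM' : ((M + 1 : ℕ) : ℝ) ^ k * (6 * D) < r ^ M := by
    have hr0 : 0 < r := by linarith
    exact lt_of_mul_lt_mul_right (by linarith) hr0.le
  nlinarith [hbound M]

/-- Every finitely generated subsemigroup of the multiplicative group
`ℝ*₊ = (0,∞)` (with the metric induced from the Euclidean metric of `ℝ`) which is coarsely
dense in `ℝ*₊` is dense in `ℝ*₊`. -/
theorem coarsely_dense_multiplicative_semigroup_is_dense
    (S : Set ℝ) (hsub : S ⊆ Set.Ioi (0 : ℝ))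
    (T : Finset ℝ) (hTsub : (T : Set ℝ) ⊆ Set.Ioi (0 : ℝ))
    (hS : S = (Subsemigroup.closure (T : Set ℝ) : Set ℝ))
    (hcd : ∃ D : ℝ, 0 < D ∧ ∀ x ∈ Set.Ioi (0 : ℝ), ∃ s ∈ S, |x - s| < D) :
    Set.Ioi (0 : ℝ) ⊆ closure S := by
  obtain ⟨D, hD, hcd⟩ := hcd
  have hmul : ∀ x ∈ S, ∀ y ∈ S, x * y ∈ S := by
    subst hS
    exact fun x hx y hy => mul_mem hx hy
  obtain ⟨t, htT, ht1⟩ := exists_lt_one_of_coarselyDense_closure (T := T) hD (hS ▸ hcd)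
  have htS : t ∈ S := hS ▸ Subsemigroup.subset_closure htT
  have ht0 : 0 < t := hTsub htT
  obtain ⟨u, huS, hu⟩ := hcd (D + 1) (Set.mem_Ioi.2 (by linarith))
  have hu1 : 1 < u := by linarith [(abs_lt.1 hu).2]
  let A : AddSubsemigroup ℝ :=
    { carrier := {y | Real.exp y ∈ S}
      add_mem' := fun {x y} hx hy => by
        simp only [Set.mem_ofPred_eq, Real.exp_add]
        exact hmul _ hx _ hy }
  have hlog : ∀ s ∈ S, Real.log s ∈ A := fun s hs => by
    change Real.exp (Real.log s) ∈ S
    rwa [Real.exp_log (hsub hs)]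
  obtain ⟨G, hG⟩ := exists_addSubgroup_coe_eq_closure_s10 (hlog u huS) (hlog t htS)
    (Real.log_pos hu1) (Real.log_neg ht0 ht1)
  have hAG : ∀ y ∈ A, y ∈ G := fun y hy => by
    rw [← SetLike.mem_coe, hG]
    exact subset_closure hy
  rcases G.dense_or_cyclic with hdense | ⟨c, hc⟩
  · intro x hx
    have hx' : Real.log x ∈ closure (A : Set ℝ) := by
      have h := hdense (Real.log x)
      rwa [hG, closure_closure] at h
    have h := map_mem_closure Real.continuous_exp hx' (t := S) fun _ hy => hy
    rwa [Real.exp_log hx] at h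
  · have hmem : ∀ y ∈ A, ∃ n : ℤ, n * c = y := fun y hy => by
      have h := hAG y hy
      rw [hc, AddSubgroup.mem_closure_singleton] at h
      simpa using h
    have hc0 : c ≠ 0 := by
      rintro rfl
      obtain ⟨n, hn⟩ := hmem _ (hlog u huS)
      have := Real.log_pos hu1
      simp [← hn] at this
    refine (not_coarselyDense_of_subset_exp_zmultiples (abs_pos.2 hc0) (fun s hs => ?_) hcd).elim
    obtain ⟨n, hn⟩ := hmem _ (hlog s hs)
    rcases abs_choice c with h | h
    · exact ⟨n, by rw [h, hn, Real.exp_log (hsub hs)]⟩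
    · exact ⟨-n, by rw [h, Int.cast_neg, neg_mul_neg, hn, Real.exp_log (hsub hs)]⟩
end

section
/- Let $\mathbb{R}^n_+ = \{(x_1,\ldots,x_n) \in \mathbb{R}^n : x_i > 0 \text{ for all } i\}$, a group under componentwise multiplication, endowed with the metric induced from the Euclidean metric on $\mathbb{R}^n$. Let $S$ be a finitely generated subsemigroup of $\mathbb{R}^n_+$ such that for some $a \in \mathbb{R}^n_+$, the orbit $S \cdot a = \{s \cdot a : s \in S\}$ (componentwise product) contains a coarsely dense subset of some nonempty open cone $C \subseteq \mathbb{R}^n_+$. Then $S$ is dense in $\mathbb{R}^n_+$. -/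
open Filter Topology

theorem exists_pos_relation_or_exists_nonneg_functional {ι E : Type*} [Fintype ι]
    [AddCommGroup E] [Module ℝ E] (v : ι → E) :
    (∃ c : ι → ℝ, (∀ i, 0 < c i) ∧ ∑ i, c i • v i = 0) ∨
      ∃ f : E →ₗ[ℝ] ℝ, f ≠ 0 ∧ ∀ i, 0 ≤ f (v i) := by
  classical
  by_cases h : ∃ c : ι → ℝ, (∀ i, 0 < c i) ∧ ∑ i, c i • v i = 0
  · exact Or.inl h
  right
  set V := Fintype.linearCombination ℝ v with hV
  set O : Set (ι → ℝ) := {c | ∀ i, 0 < c i} with hO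
  have hOo : IsOpen O := by
    rw [hO, Set.ofPred_forall]
    exact isOpen_iInter_of_finite fun i => isOpen_lt continuous_const (continuous_apply i)
  have hOc : Convex ℝ O := by
    rw [hO, Set.ofPred_forall]
    exact convex_iInter fun i => convex_halfSpace_gt (LinearMap.proj i).isLinear 0
  have hd : Disjoint O (LinearMap.ker V : Set (ι → ℝ)) := by
    rw [Set.disjoint_left]
    intro c hc hc'
    exact h ⟨c, hc, by simpa [hV, Fintype.linearCombination_apply] using hc'⟩
  obtain ⟨φ, u, h1, h2⟩ := geometric_hahn_banach_open hOc hOo (LinearMap.ker V).convex hd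
  have hu : u ≤ 0 := by simpa using h2 0 (LinearMap.ker V).zero_mem
  have hker : ∀ b ∈ LinearMap.ker V, φ b = 0 := by
    intro b hb
    by_contra hne
    have := h2 (((u - 1) / φ b) • b) ((LinearMap.ker V).smul_mem _ hb)
    rw [map_smul, smul_eq_mul, div_mul_cancel₀ _ hne] at this
    linarith
  have hmem : (-φ : (ι → ℝ) →L[ℝ] ℝ).toLinearMap ∈ LinearMap.range V.dualMap := by
    rw [LinearMap.range_dualMap_eq_dualAnnihilator_ker, Submodule.mem_dualAnnihilator]
    intro b hb
    simp [hker b hb]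
  obtain ⟨f, hf⟩ := hmem
  have hf' : ∀ c, f (V c) = -φ c := fun c => by
    simpa using LinearMap.congr_fun hf c
  refine ⟨f, ?_, fun i => ?_⟩
  · rintro rfl
    have := hf' 1
    have h3 := h1 1 (fun i => by simp)
    simp at this
    linarith
  · have hvi : f (v i) = -φ (Pi.single i 1) := by
      rw [← hf']; simp [hV, Fintype.linearCombination_apply_single]
    rw [hvi]
    have key : ∀ δ : ℝ, 0 < δ → φ (Pi.single i 1) ≤ δ * -φ 1 := by
      intro δ hδ
      have := h1 (Pi.single i 1 + δ • 1) (fun j => by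
        by_cases hj : j = i
        · subst hj; simp; linarith
        · simp [hj, hδ])
      rw [map_add, map_smul, smul_eq_mul] at this
      linarith
    have hlim : Tendsto (fun δ : ℝ => δ * -φ 1) (𝓝[>] 0) (𝓝 0) := by
      have : Tendsto (fun δ : ℝ => δ * -φ 1) (𝓝 0) (𝓝 (0 * -φ 1)) :=
        tendsto_id.mul_const _
      rw [zero_mul] at this
      exact this.mono_left nhdsWithin_le_nhds
    have := ge_of_tendsto hlim (by filter_upwards [self_mem_nhdsWithin] with δ hδ using key δ hδ)
    linarith

theorem exists_pos_nat_combination_norm_lt {ι E : Type*} [Fintype ι] [NormedAddCommGroup E]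
    [NormedSpace ℝ E] {v : ι → E} {c : ι → ℝ} (hc : ∀ i, 0 < c i) (hcv : ∑ i, c i • v i = 0)
    {ε : ℝ} (hε : 0 < ε) :
    ∃ k : ι → ℕ, (∀ i, 1 ≤ k i) ∧ ‖∑ i, k i • v i‖ < ε := by
  set M := ∑ i, ‖v i‖ with hM
  have hM0 : 0 ≤ M := Finset.sum_nonneg fun i _ => norm_nonneg _
  set δ := min (1 / 2) (ε / (M + 1)) with hδ
  have hδ0 : 0 < δ := lt_min (by norm_num) (by positivity)
  obtain ⟨Q, hQ⟩ : ∃ Q : ℕ, ∀ i, 1 ≤ Q * c i := by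
    have : ∀ᶠ Q : ℕ in atTop, ∀ i, (1 : ℝ) ≤ Q * c i := by
      rw [eventually_all]
      intro i
      exact (tendsto_natCast_atTop_atTop.atTop_mul_const (hc i)).eventually_ge_atTop 1
    exact this.exists
  let x : ℕ → ι → ℝ := fun q i => Int.fract (q * c i)
  have hx : ∀ q, x q ∈ Set.Icc (0 : ι → ℝ) 1 := fun q =>
    ⟨fun i => Int.fract_nonneg _, fun i => (Int.fract_lt_one _).le⟩
  obtain ⟨y, -, φ, hφ, hlim⟩ := (isCompact_Icc (a := (0 : ι → ℝ)) (b := 1)).tendsto_subseq hx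
  obtain ⟨N, hN⟩ := Metric.cauchySeq_iff.1 hlim.cauchySeq δ hδ0
  have hclose := hN (N + Q) (by omega) N le_rfl
  have hle : φ N + Q ≤ φ (N + Q) := by
    have := hφ.add_le_nat Q N
    rw [add_comm Q N] at this
    omega
  let z : ι → ℤ := fun i => ⌊(φ (N + Q) : ℝ) * c i⌋ - ⌊(φ N : ℝ) * c i⌋
  have hz : ∀ i, |(z i : ℝ) - ((φ (N + Q) : ℝ) - φ N) * c i| < δ := by
    intro i
    have h1 := (dist_pi_lt_iff hδ0).1 hclose i
    rw [Real.dist_eq, abs_sub_comm] at h1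
    convert h1 using 2
    simp only [z, x, Function.comp, Int.fract]
    push_cast
    ring
  have hz1 : ∀ i, 1 ≤ z i := by
    intro i
    have h1 := (abs_lt.1 (hz i)).1
    have h2 : (Q : ℝ) * c i ≤ ((φ (N + Q) : ℝ) - φ N) * c i := by
      have : (φ N : ℝ) + Q ≤ φ (N + Q) := by exact_mod_cast hle
      exact mul_le_mul_of_nonneg_right (by linarith) (hc i).le
    have h3 := hQ i
    have h4 : δ ≤ 1 / 2 := min_le_left _ _
    have : (0 : ℝ) < z i := by linarith
    exact_mod_cast this
  refine ⟨fun i => (z i).toNat, fun i => (Int.le_toNat (by linarith [hz1 i])).2 (hz1 i), ?_⟩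
  have hcast : ∀ i, ((z i).toNat : ℝ) = z i := fun i => by
    have : ((z i).toNat : ℤ) = z i := Int.toNat_of_nonneg (by linarith [hz1 i])
    exact_mod_cast this
  have hsum : ∑ i, (z i).toNat • v i
      = ∑ i, ((z i : ℝ) - ((φ (N + Q) : ℝ) - φ N) * c i) • v i := by
    have h0 : ∑ i, (((φ (N + Q) : ℝ) - φ N) * c i) • v i = 0 := by
      simp_rw [mul_smul]
      rw [← Finset.smul_sum, hcv, smul_zero]
    simp_rw [sub_smul _ _ (v _)]
    rw [Finset.sum_sub_distrib, h0, sub_zero]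
    refine Finset.sum_congr rfl fun i _ => ?_
    rw [← hcast, Nat.cast_smul_eq_nsmul]
  rw [hsum]
  calc _ ≤ ∑ i, δ * ‖v i‖ := by
        refine norm_sum_le_of_le _ fun i _ => ?_
        rw [norm_smul, Real.norm_eq_abs]
        exact mul_le_mul_of_nonneg_right (hz i).le (norm_nonneg _)
    _ = δ * M := by rw [hM, Finset.mul_sum]
    _ ≤ ε / (M + 1) * M := mul_le_mul_of_nonneg_right (min_le_right _ _) hM0
    _ < ε := by
        rw [div_mul_eq_mul_div, div_lt_iff₀ (by positivity)]
        nlinarith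

theorem not_eventually_exp_dense_nat_combinations {ι : Type*} [Fintype ι] {g : ι → ℝ}
    (hg : ∀ i, 0 ≤ g i) (β γ : ℝ) {τ₀ M : ℝ} (hτ₀ : 0 < τ₀) (hM : 0 ≤ M) :
    ¬ ∀ᶠ j : ℕ in atTop, ∀ τ ∈ Set.Icc 0 τ₀, ∃ k : ι → ℕ,
      |∑ i, k i * g i - (β + j * γ + τ)| ≤ M * Real.exp (-j) := by
  classical
  intro H
  obtain ⟨R, hR⟩ : ∃ R : ℕ, ∀ i, 0 < g i → |β| + |γ| + τ₀ + M ≤ R * g i := by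
    have : ∀ᶠ R : ℕ in atTop, ∀ i, 0 < g i → |β| + |γ| + τ₀ + M ≤ R * g i := by
      rw [eventually_all]
      intro i
      by_cases hi : 0 < g i
      · filter_upwards [(tendsto_natCast_atTop_atTop.atTop_mul_const hi).eventually_ge_atTop
          (|β| + |γ| + τ₀ + M)] with R hR _ using hR
      · simp [hi]
    exact this.exists
  set m := Fintype.card ι
  have hbound : ∀ᶠ j : ℕ in atTop,
      τ₀ ≤ ((R * (1 + j) + 1 : ℕ) : ℝ) ^ m * (2 * (M * Real.exp (-j))) := by
    filter_upwards [H] with j hj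
    let F : Finset (ι → ℕ) := Fintype.piFinset fun _ => Finset.range (R * (1 + j) + 1)
    have hF : F.card = (R * (1 + j) + 1) ^ m := by
      simp [F, m]
    have he : 0 ≤ M * Real.exp (-j) := by positivity
    have hcover : Set.Icc 0 τ₀ ⊆ ⋃ k ∈ F, Metric.closedBall
        (∑ i, (k i : ℝ) * g i - (β + j * γ)) (M * Real.exp (-j)) := by
      intro τ hτ
      obtain ⟨k, hk⟩ := hj τ hτ
      simp only [Set.mem_iUnion, Metric.mem_closedBall, exists_prop]
      have hsum : ∑ i, ((if g i = 0 then 0 else k i : ℕ) : ℝ) * g i = ∑ i, (k i : ℝ) * g i := by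
        refine Finset.sum_congr rfl fun i _ => ?_
        by_cases hi : g i = 0 <;> simp [hi]
      refine ⟨fun i => if g i = 0 then 0 else k i, ?_, ?_⟩
      · simp only [F, Fintype.mem_piFinset, Finset.mem_range]
        intro i
        by_cases hi : g i = 0
        · simp [hi]
        have hi' : 0 < g i := lt_of_le_of_ne (hg i) (Ne.symm hi)
        simp only [hi, if_false, Nat.lt_succ_iff]
        have h1 : (k i : ℝ) * g i ≤ ∑ i, (k i : ℝ) * g i :=
          Finset.single_le_sum (f := fun i => (k i : ℝ) * g i)
            (fun i _ => mul_nonneg (Nat.cast_nonneg _) (hg i)) (Finset.mem_univ i)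
        have h2 := (abs_le.1 hk).2
        have h3 : Real.exp (-(j : ℝ)) ≤ 1 := Real.exp_le_one_iff.2 (by simp)
        have h4 := hR i hi'
        have h5 : M * Real.exp (-(j : ℝ)) ≤ M := mul_le_of_le_one_right hM h3
        have hj0 : (0 : ℝ) ≤ j := Nat.cast_nonneg _
        have h6 : (j : ℝ) * γ ≤ j * |γ| := mul_le_mul_of_nonneg_left (le_abs_self _) hj0
        have h7 := le_abs_self β
        have h8 : (k i : ℝ) * g i ≤ (1 + j) * (|β| + |γ| + τ₀ + M) := by
          have := mul_nonneg hj0 (abs_nonneg β)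
          have := mul_nonneg hj0 hM
          have := mul_nonneg hj0 hτ₀.le
          have := hτ.2
          have := abs_nonneg γ
          nlinarith
        have h9 : (k i : ℝ) * g i ≤ ((R * (1 + j) : ℕ) : ℝ) * g i := by
          push_cast
          nlinarith
        exact_mod_cast le_of_mul_le_mul_right h9 hi'
      · rw [hsum, Real.dist_eq, abs_sub_comm]
        convert hk using 2
        ring
    have hvol := (MeasureTheory.measure_mono (μ := MeasureTheory.volume) hcover).trans
      (MeasureTheory.measure_biUnion_finset_le F _)
    simp only [Real.volume_Icc, Real.volume_closedBall, sub_zero, Finset.sum_const, hF] at hvol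
    rw [nsmul_eq_mul, ← ENNReal.ofReal_natCast, ← ENNReal.ofReal_mul (by positivity),
      ENNReal.ofReal_le_ofReal_iff (by positivity)] at hvol
    exact_mod_cast hvol
  have hlim : Tendsto (fun j : ℕ => ((R * (1 + j) + 1 : ℕ) : ℝ) ^ m * (2 * (M * Real.exp (-j))))
      atTop (𝓝 0) := by
    have h1 : Tendsto (fun x : ℝ => (R + 1 : ℝ) ^ m * (2 * M) * Real.exp 1 *
        ((1 + x) ^ m * Real.exp (-(1 + x)))) atTop (𝓝 0) := by
      have := ((Real.tendsto_pow_mul_exp_neg_atTop_nhds_zero m).comp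
        (tendsto_atTop_add_const_left atTop (1 : ℝ) tendsto_id)).const_mul
        ((R + 1 : ℝ) ^ m * (2 * M) * Real.exp 1)
      rw [mul_zero] at this
      exact this
    refine squeeze_zero (fun j => by positivity) (fun j => ?_)
      (h1.comp tendsto_natCast_atTop_atTop)
    have h2 : ((R * (1 + j) + 1 : ℕ) : ℝ) ≤ (R + 1) * (1 + j) := by
      push_cast
      nlinarith [(Nat.cast_nonneg j : (0 : ℝ) ≤ j)]
    calc _ ≤ ((R + 1 : ℝ) * (1 + j)) ^ m * (2 * (M * Real.exp (-j))) := by gcongr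
      _ = _ := by
        have : Real.exp (-(j : ℝ)) = Real.exp 1 * Real.exp (-(1 + j)) := by
          rw [← Real.exp_add]; congr 1; ring
        simp only [Function.comp]
        rw [this, mul_pow]
        ring
  have := ge_of_tendsto hlim hbound
  linarith

theorem dense_span_nat_of_eventually_exp_dense {ι E : Type*} [Fintype ι] [NormedAddCommGroup E]
    [NormedSpace ℝ E] [FiniteDimensional ℝ E] {v : ι → E} {u₀ e : E} {ρ M : ℝ} (hρ : 0 < ρ)
    (hM : 0 ≤ M)
    (H : ∀ᶠ j : ℕ in atTop, ∀ u ∈ Metric.ball u₀ ρ, ∃ w ∈ Submodule.span ℕ (Set.range v),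
      ‖w - (u + (j : ℝ) • e)‖ ≤ M * Real.exp (-j)) :
    Dense (Submodule.span ℕ (Set.range v) : Set E) := by
  classical
  set G := Submodule.span ℕ (Set.range v) with hG
  obtain ⟨c, hc, hcv⟩ | ⟨f, hf, hfv⟩ := exists_pos_relation_or_exists_nonneg_functional v
  · set A := G.toAddSubmonoid.topologicalClosure with hA
    have hGA : ∀ w ∈ G, w ∈ A := fun w hw => G.toAddSubmonoid.le_topologicalClosure hw
    have hAc : IsClosed (A : Set E) := G.toAddSubmonoid.isClosed_topologicalClosure
    have hneg_gen : ∀ i, -v i ∈ A := by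
      intro i
      change -v i ∈ closure (G : Set E)
      rw [Metric.mem_closure_iff]
      intro ε hε
      obtain ⟨k, hk, hkv⟩ := exists_pos_nat_combination_norm_lt hc hcv hε
      refine ⟨∑ l, (k l - if l = i then 1 else 0) • v l, G.sum_mem fun l _ =>
        G.smul_mem _ (Submodule.subset_span ⟨l, rfl⟩), ?_⟩
      have : ∑ l, (k l - if l = i then 1 else 0) • v l + v i = ∑ l, k l • v l := by
        have h1 : v i = ∑ l, (if l = i then 1 else 0 : ℕ) • v l := by simp
        conv_lhs => rw [h1]
        rw [← Finset.sum_add_distrib]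
        refine Finset.sum_congr rfl fun l _ => ?_
        rw [← add_smul]
        congr 1
        have := hk l
        split_ifs <;> omega
      rw [dist_comm, dist_eq_norm, sub_neg_eq_add, this]
      exact hkv
    have hneg : ∀ w ∈ G, -w ∈ A := by
      intro w hw
      induction hw using Submodule.span_induction with
      | mem x hx => obtain ⟨i, rfl⟩ := hx; exact hneg_gen i
      | zero => simp
      | add x y _ _ hx hy => rw [neg_add]; exact A.add_mem hx hy
      | smul a x _ hx => rw [← smul_neg]; exact A.nsmul_mem hx a
    have hball : ∀ u ∈ Metric.ball (0 : E) ρ, u ∈ A := by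
      intro u hu
      have hdec : Tendsto (fun j : ℕ => M * Real.exp (-(j : ℝ)) + M * Real.exp (-(j : ℝ)))
          atTop (𝓝 0) := by
        have h1 : Tendsto (fun j : ℕ => M * Real.exp (-(j : ℝ))) atTop (𝓝 (M * 0)) :=
          (Real.tendsto_exp_neg_atTop_nhds_zero.comp tendsto_natCast_atTop_atTop).const_mul M
        simpa using h1.add h1
      rw [← SetLike.mem_coe, ← hAc.closure_eq, Metric.mem_closure_iff]
      intro ε hε
      obtain ⟨j, hj, hjε⟩ := (H.and (hdec.eventually_lt_const hε)).exists
      obtain ⟨w₁, hw₁, h₁⟩ := hj (u₀ + u) (by simpa using hu)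
      obtain ⟨w₂, hw₂, h₂⟩ := hj u₀ (Metric.mem_ball_self hρ)
      refine ⟨w₁ + -w₂, A.add_mem (hGA _ hw₁) (hneg _ hw₂), ?_⟩
      rw [dist_comm, dist_eq_norm]
      have : w₁ + -w₂ - u = (w₁ - (u₀ + u + (j : ℝ) • e)) - (w₂ - (u₀ + (j : ℝ) • e)) := by abel
      rw [this]
      exact (norm_sub_le _ _).trans_lt (lt_of_le_of_lt (add_le_add h₁ h₂) hjε)
    intro x
    change x ∈ A
    obtain ⟨N, hN⟩ := exists_nat_gt (‖x‖ / ρ)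
    have hN0 : (0 : ℝ) < N := lt_of_le_of_lt (by positivity) hN
    have hx : x = N • ((N : ℝ)⁻¹ • x) := by
      rw [← Nat.cast_smul_eq_nsmul ℝ, smul_smul, mul_inv_cancel₀ hN0.ne', one_smul]
    rw [hx]
    refine A.nsmul_mem (hball _ ?_) N
    rw [mem_ball_zero_iff, norm_smul, norm_inv, Real.norm_natCast, inv_mul_lt_iff₀ hN0]
    rwa [div_lt_iff₀ hρ] at hN
  · exfalso
    obtain ⟨h, hh⟩ : ∃ h, f h = 1 := by
      obtain ⟨y, hy⟩ := DFunLike.ne_iff.1 hf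
      exact ⟨(f y)⁻¹ • y, by simpa using inv_mul_cancel₀ hy⟩
    let F := LinearMap.toContinuousLinearMap f
    have hF : ∀ x, |f x| ≤ ‖F‖ * ‖x‖ := fun x => F.le_opNorm x
    set τ₀ := ρ / (2 * (‖h‖ + 1)) with hτ₀
    have hτ₀0 : 0 < τ₀ := by positivity
    refine not_eventually_exp_dense_nat_combinations hfv (f u₀) (f e) hτ₀0
      (mul_nonneg (norm_nonneg F) hM) ?_
    filter_upwards [H] with j hj τ hτ
    obtain ⟨w, hw, hwu⟩ := hj (u₀ + τ • h) (by
      rw [mem_ball_iff_norm, add_sub_cancel_left, norm_smul, Real.norm_eq_abs, abs_of_nonneg hτ.1]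
      calc τ * ‖h‖ ≤ τ₀ * (‖h‖ + 1) := by
            have := norm_nonneg h
            exact mul_le_mul hτ.2 (by linarith) this hτ₀0.le
        _ = ρ / 2 := by rw [hτ₀]; field_simp
        _ < ρ := by linarith)
    obtain ⟨k, rfl⟩ := (Submodule.mem_span_range_iff_exists_fun ℕ).1 hw
    refine ⟨k, ?_⟩
    have h1 := (hF _).trans (mul_le_mul_of_nonneg_left hwu (norm_nonneg F))
    rw [← mul_assoc] at h1
    have h2 : f (∑ i, k i • v i - (u₀ + τ • h + (j : ℝ) • e))
        = ∑ i, k i * f (v i) - (f u₀ + j * f e + τ) := by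
      simp only [map_sub, map_add, map_smul, map_sum, hh, smul_eq_mul, nsmul_eq_mul, map_nsmul]
      ring
    rwa [h2] at h1

theorem abs_log_le_two_mul_abs_sub_one {y : ℝ} (hy : |y - 1| ≤ 1 / 2) :
    |Real.log y| ≤ 2 * |y - 1| := by
  have h := abs_le.1 hy
  have hy0 : 0 < y := by linarith
  have h1 := Real.log_le_sub_one_of_pos hy0
  have h2 := Real.one_sub_inv_le_log_of_pos hy0
  have h3 : |1 - y⁻¹| ≤ 2 * |y - 1| := by
    have : 1 - y⁻¹ = y⁻¹ * (y - 1) := by field_simp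
    rw [this, abs_mul, abs_of_pos (inv_pos.2 hy0)]
    refine mul_le_mul_of_nonneg_right ?_ (abs_nonneg _)
    rw [inv_le_comm₀ hy0 two_pos]
    linarith
  rw [abs_le]
  constructor
  · linarith [(abs_le.1 h3).1]
  · linarith [le_abs_self (y - 1), abs_nonneg (y - 1)]

theorem log_mem_span_nat_of_mem_closure {κ : Type*} {T : Set (κ → ℝ)}
    (hT : ∀ t ∈ T, ∀ i, 0 < t i) {s : κ → ℝ} (hs : s ∈ Subsemigroup.closure T) :
    (∀ i, 0 < s i) ∧ (fun i => Real.log (s i)) ∈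
      Submodule.span ℕ (Set.range fun (t : T) i => Real.log (t.1 i)) := by
  induction hs using Subsemigroup.closure_induction with
  | mem t ht => exact ⟨hT t ht, Submodule.subset_span ⟨⟨t, ht⟩, rfl⟩⟩
  | mul x y _ _ hx hy =>
    refine ⟨fun i => mul_pos (hx.1 i) (hy.1 i), ?_⟩
    convert add_mem hx.2 hy.2 using 1
    ext i
    exact Real.log_mul (hx.1 i).ne' (hy.1 i).ne'

theorem exp_mul_mem_closure_of_mem_span_nat {κ : Type*} {T : Set (κ → ℝ)}
    (hT : ∀ t ∈ T, ∀ i, 0 < t i) {y : κ → ℝ}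
    (hy : y ∈ Submodule.span ℕ (Set.range fun (t : T) i => Real.log (t.1 i))) :
    ∀ s ∈ Subsemigroup.closure T, (fun i => Real.exp (y i)) * s ∈ Subsemigroup.closure T := by
  induction hy using Submodule.span_induction with
  | mem x hx =>
    obtain ⟨t, rfl⟩ := hx
    intro s hs
    have : (fun i => Real.exp (Real.log (t.1 i))) = t.1 :=
      funext fun i => Real.exp_log (hT t.1 t.2 i)
    simp only [this]
    exact mul_mem (Subsemigroup.subset_closure t.2) hs
  | zero =>
    intro s hs
    convert hs using 1
    ext i
    simp
  | add x y _ _ hx hy =>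
    intro s hs
    convert hx _ (hy s hs) using 1
    ext i
    simp [Real.exp_add, mul_assoc]
  | smul a x _ hx =>
    induction a with
    | zero =>
      intro s hs
      convert hs using 1
      ext i
      simp
    | succ a ih =>
      intro s hs
      convert hx _ (ih s hs) using 1
      ext i
      simp only [Pi.mul_apply, Pi.smul_apply, succ_nsmul', Real.exp_add, mul_assoc]


/-- Let `ℝⁿ₊` be the group of vectors with positive coordinates under
componentwise multiplication, with the metric induced from `ℝⁿ`.  If `S` is a finitely
generated subsemigroup of `ℝⁿ₊` such that for some `a ∈ ℝⁿ₊` the orbit `S ⬝ a` contains a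
coarsely dense subset of some nonempty open cone `C ⊆ ℝⁿ₊`, then `S` is dense in `ℝⁿ₊`. -/
theorem semigroup_dense_in_positive_orthant
    {n : ℕ} (P : Set (Fin n → ℝ)) (hP : P = {x : Fin n → ℝ | ∀ i, 0 < x i})
    (S : Set (Fin n → ℝ)) (T : Finset (Fin n → ℝ)) (hTsub : (T : Set (Fin n → ℝ)) ⊆ P)
    (hS : S = (Subsemigroup.closure (T : Set (Fin n → ℝ)) : Set (Fin n → ℝ)))
    (a : Fin n → ℝ) (ha : a ∈ P)
    (C : Set (Fin n → ℝ)) (hCne : C.Nonempty) (hCsub : C ⊆ P) (hCopen : IsOpen C)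
    (hCcone : ∀ x ∈ C, ∀ r : ℝ, 0 < r → r • x ∈ C)
    (hcd : ∃ D : ℝ, 0 < D ∧ ∀ x ∈ C, ∃ s ∈ S, dist x (s * a) < D) :
    P ⊆ closure S := by
  subst hP hS
  have hT : ∀ t ∈ (T : Set (Fin n → ℝ)), ∀ i, 0 < t i := fun t ht => hTsub ht
  obtain ⟨D, hD, hcd⟩ := hcd
  obtain ⟨x₀, hx₀⟩ := hCne
  obtain ⟨t₀, ht₀⟩ : (T : Set (Fin n → ℝ)).Nonempty := by
    obtain ⟨s, hs, -⟩ := hcd x₀ hx₀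
    by_contra hne
    rw [Set.not_nonempty_iff_eq_empty.1 hne, Subsemigroup.closure_empty] at hs
    exact hs
  let L : (Fin n → ℝ) → Fin n → ℝ := fun x i => Real.log (x i)
  let X : (Fin n → ℝ) → Fin n → ℝ := fun x i => Real.exp (x i)
  have hX : Continuous X := by fun_prop
  have hXL : ∀ x : Fin n → ℝ, (∀ i, 0 < x i) → X (L x) = x := fun x hx =>
    funext fun i => Real.exp_log (hx i)
  obtain ⟨ρ₀, hρ₀, hball⟩ := Metric.isOpen_iff.1 (hCopen.preimage hX) (L x₀)
    (by simpa [hXL x₀ (hCsub hx₀)] using hx₀)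
  set K := D * Real.exp (‖L x₀‖ + 1) with hK
  have hdense : Dense (Submodule.span ℕ
      (Set.range fun (t : (T : Set (Fin n → ℝ))) i => Real.log (t.1 i)) : Set (Fin n → ℝ)) := by
    refine dense_span_nat_of_eventually_exp_dense (u₀ := L x₀ - L a) (e := 1)
      (ρ := min ρ₀ 1) (M := 2 * K) (lt_min hρ₀ one_pos) (by positivity) ?_
    have hdec : Tendsto (fun j : ℕ => K * Real.exp (-(j : ℝ))) atTop (𝓝 0) := by
      simpa using (Real.tendsto_exp_neg_atTop_nhds_zero.comp
        tendsto_natCast_atTop_atTop).const_mul K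
    filter_upwards [hdec.eventually_le_const (show (0 : ℝ) < 1 / 2 by norm_num)] with j hj u hu
    set u' := u + L a with hu'
    have hdist : ‖u' - L x₀‖ < min ρ₀ 1 := by
      rw [mem_ball_iff_norm] at hu
      have : u' - L x₀ = u - (L x₀ - L a) := by rw [hu']; abel
      rw [this]
      exact hu
    have hu'C : X u' ∈ C := hball (mem_ball_iff_norm.2 (hdist.trans_le (min_le_left _ _)))
    obtain ⟨s, hs, hsd⟩ := hcd _ (hCcone _ hu'C (Real.exp j) (Real.exp_pos _))
    obtain ⟨hspos, hsmem⟩ := log_mem_span_nat_of_mem_closure hT hs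
    refine ⟨_, hsmem, (pi_norm_le_iff_of_nonneg (by positivity)).2 fun i => ?_⟩
    have hu'i : -u' i ≤ ‖L x₀‖ + 1 := by
      have h1 : ‖u'‖ ≤ ‖u' - L x₀‖ + ‖L x₀‖ := by
        simpa using norm_add_le (u' - L x₀) (L x₀)
      have h2 := (norm_le_pi_norm u' i).trans h1
      have h3 := neg_abs_le (u' i)
      rw [Real.norm_eq_abs] at h2
      linarith [hdist.trans_le (min_le_right _ _)]
    have hsdi := (dist_pi_lt_iff hD).1 hsd i
    rw [dist_comm, Real.dist_eq] at hsdi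
    simp only [Pi.mul_apply, Pi.smul_apply, smul_eq_mul, X, ← Real.exp_add] at hsdi
    set y := s i * a i * Real.exp (-(j + u' i)) with hy
    have hysub : y - 1 = (s i * a i - Real.exp (j + u' i)) * Real.exp (-(j + u' i)) := by
      rw [sub_mul, ← Real.exp_add, add_neg_cancel, Real.exp_zero]
    have hy1 : |y - 1| ≤ K * Real.exp (-(j : ℝ)) := by
      rw [hysub, abs_mul, Real.abs_exp]
      calc _ ≤ D * Real.exp (-(j + u' i)) := by gcongr
        _ ≤ D * Real.exp ((‖L x₀‖ + 1) + -j) := by gcongr; linarith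
        _ = _ := by rw [Real.exp_add, hK]; ring
    have hlog : Real.log y = Real.log (s i) - (u i + j) := by
      rw [hy, Real.log_mul (mul_pos (hspos i) (ha i)).ne' (Real.exp_pos _).ne', Real.log_exp,
        Real.log_mul (hspos i).ne' (ha i).ne']
      simp only [hu', Pi.add_apply, L]
      ring
    have hfin := abs_log_le_two_mul_abs_sub_one (hy1.trans hj)
    rw [hlog] at hfin
    simp only [Pi.sub_apply, Pi.add_apply, Pi.smul_apply, Pi.one_apply, smul_eq_mul, mul_one,
      Real.norm_eq_abs]
    linarith
  intro x hx
  have hΦ : Continuous fun y : Fin n → ℝ => X y * t₀ := hX.mul continuous_const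
  have hmem := map_mem_closure hΦ (hdense (L x - L t₀)) fun y hy =>
    exp_mul_mem_closure_of_mem_span_nat hT hy t₀ (Subsemigroup.subset_closure ht₀)
  convert hmem using 1
  ext i
  have ht : t₀ i ≠ 0 := (hT t₀ ht₀ i).ne'
  simp only [Pi.mul_apply, Pi.sub_apply, X, L, Real.exp_sub, Real.exp_log (hx i),
    Real.exp_log (hT t₀ ht₀ i)]
  field_simp
end

section
/- Let $V = \mathbb{R}^r \times \mathbb{C}^{d-r}$ (viewed as a real vector space with a norm) and let $G = (\mathbb{R}^*)^r \times (\mathbb{C}^*)^{d-r}$ act on $V$ by componentwise scalar multiplication. Let $S$ be a finitely generated subsemigroup of $G$, and suppose there exist $v_0 \in V$ and a nonempty open cone $C$ in $V$ such that the orbit $S \cdot v_0 = \{s \cdot v_0 : s \in S\}$ intersected with $C$ is coarsely dense in $C$. Then the topological closure of $S$ in $G$ is a subgroup of $G$ which contains the connected component of the identity $G^0 = (\mathbb{R}^*_+)^r \times (\mathbb{C}^*)^{d-r}$. -/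
open Filter Topology

/-- If no nonzero functional is nonnegative on the finite family `v`, then `0` is a strictly
positive combination of `v`. -/
theorem exists_pos_sum_smul_eq_zero {ι E : Type*} [Fintype ι] [NormedAddCommGroup E]
    [NormedSpace ℝ E] [FiniteDimensional ℝ E] (v : ι → E)
    (h : ∀ f : E →ₗ[ℝ] ℝ, f ≠ 0 → ∃ i, f (v i) < 0) :
    ∃ c : ι → ℝ, (∀ i, 0 < c i) ∧ ∑ i, c i • v i = 0 := by
  set F : (ι → ℝ) →ₗ[ℝ] E := Fintype.linearCombination ℝ v with hF
  have hFv : ∀ c, F c = ∑ i, c i • v i := fun c => Fintype.linearCombination_apply ℝ v c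
  classical
  have hFs : ∀ i, F (Pi.single i 1) = v i := fun i => by
    rw [hF, Fintype.linearCombination_apply_single, one_smul]
  have hsurj : Function.Surjective F := by
    rw [← LinearMap.range_eq_top]
    by_contra hne
    obtain ⟨f, hf0, hf⟩ := Submodule.exists_le_ker_of_lt_top _ (lt_top_iff_ne_top.2 hne)
    obtain ⟨i, hi⟩ := h f hf0
    have : f (F (Pi.single i 1)) = 0 := hf ⟨_, rfl⟩
    rw [hFs] at this
    exact hi.ne this
  have hopen : IsOpenMap F :=
    (LinearMap.toContinuousLinearMap F).isOpenMap hsurj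
  set P : Set (ι → ℝ) := Set.univ.pi fun _ => Set.Ioi 0 with hP
  have hPo : IsOpen P := isOpen_set_pi Set.finite_univ fun _ _ => isOpen_Ioi
  have hPc : Convex ℝ P := convex_pi fun _ _ => convex_Ioi 0
  by_contra hcon
  have h0 : (0 : E) ∉ F '' P := by
    rintro ⟨c, hc, hc0⟩
    exact hcon ⟨c, fun i => hc i trivial, by rw [← hFv, hc0]⟩
  obtain ⟨f, hf⟩ := geometric_hahn_banach_open_point (hPc.linear_image F) (hopen P hPo) h0
  rw [map_zero] at hf
  have hlt : ∀ c ∈ P, f (F c) < 0 := fun c hc => hf _ ⟨c, hc, rfl⟩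
  have h1 : (fun _ => 1 : ι → ℝ) ∈ P := fun _ _ => Set.mem_Ioi.2 one_pos
  obtain ⟨i, hi⟩ := h (-(f : E →ₗ[ℝ] ℝ)) (fun h0 => by
    have := hlt _ h1
    have h2 := LinearMap.congr_fun h0 (F fun _ => 1)
    simp at h2
    linarith)
  have hle : ∀ c ∈ closure P, f (F c) ≤ 0 := by
    have hcl : IsClosed {c | f (F c) ≤ 0} :=
      isClosed_le (f.continuous.comp (LinearMap.toContinuousLinearMap F).continuous)
        continuous_const
    exact fun c hc => closure_minimal (fun c hc => (hlt c hc).le) hcl hc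
  have hmem : (Pi.single i 1 : ι → ℝ) ∈ closure P := by
    rw [hP, closure_pi_set]
    intro k _
    rw [closure_Ioi]
    by_cases hk : k = i
    · subst hk; simp
    · simp [hk]
  have := hle _ hmem
  rw [hFs] at this
  simp at hi
  linarith

/-- Translates of a fixed interval cannot be covered to exponential precision by a finitely
generated additive semigroup of nonnegative reals. -/
theorem not_exponentially_dense_of_nonneg {ι : Type*} [Fintype ι] (a : ι → ℝ)
    (ha : ∀ i, 0 ≤ a i) (p q c D τ₀ : ℝ) (hc : 0 < c)
    (h : ∀ τ ≥ τ₀, ∀ σ ∈ Set.Icc (-c) c, ∃ m : ι → ℕ,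
      |∑ i, (m i : ℝ) * a i - (p * τ + q + σ)| ≤ D * Real.exp (-τ)) : False := by
  classical
  obtain ⟨μ, hμ, hμa⟩ : ∃ μ > 0, ∀ i, a i ≠ 0 → μ ≤ a i := by
    have : ∀ᶠ μ in 𝓝[>] (0 : ℝ), ∀ i, a i ≠ 0 → μ ≤ a i := by
      refine eventually_all.2 fun i => ?_
      by_cases hi : a i = 0
      · simp [hi]
      · filter_upwards [Ioc_mem_nhdsGT ((ha i).lt_of_ne' hi)] with μ hμ _ using hμ.2
    obtain ⟨μ, h1, h2⟩ := (this.and self_mem_nhdsWithin).exists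
    exact ⟨μ, h2, h1⟩
  have hD : 0 ≤ D := by
    obtain ⟨m, hm⟩ := h τ₀ le_rfl 0 ⟨by linarith, hc.le⟩
    exact nonneg_of_mul_nonneg_left ((abs_nonneg _).trans hm) (Real.exp_pos _)
  set k := Fintype.card ι
  -- the number of relevant semigroup elements is polynomially bounded
  have key : ∀ τ ≥ max τ₀ 0,
      2 * c ≤ ((|p| * τ + |q| + c + D) / μ + 1) ^ k * (2 * (D * Real.exp (-τ))) := by
    intro τ hτ
    have hτ0 : 0 ≤ τ := (le_max_right _ _).trans hτ
    set R := |p| * τ + |q| + c + D with hR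
    have hR0 : 0 ≤ R := by positivity
    set B : Finset (ι → ℕ) := Fintype.piFinset fun _ => Finset.range (⌊R / μ⌋₊ + 1) with hB
    have hsub : Set.Icc (p * τ + q - c) (p * τ + q + c) ⊆
        ⋃ m ∈ B, Metric.closedBall (∑ i, (m i : ℝ) * a i) (D * Real.exp (-τ)) := by
      intro x hx
      obtain ⟨m, hm⟩ := h τ ((le_max_left _ _).trans hτ) (x - (p * τ + q))
        ⟨by linarith [hx.1], by linarith [hx.2]⟩
      rw [add_sub_cancel] at hm
      set m' : ι → ℕ := fun i => if a i = 0 then 0 else m i with hm'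
      have hsum : ∑ i, (m' i : ℝ) * a i = ∑ i, (m i : ℝ) * a i := by
        refine Finset.sum_congr rfl fun i _ => ?_
        by_cases hi : a i = 0 <;> simp [hm', hi]
      refine Set.mem_iUnion₂.2 ⟨m', ?_, ?_⟩
      · refine Fintype.mem_piFinset.2 fun i => ?_
        rw [Finset.mem_range, Nat.lt_succ_iff]
        by_cases hi : a i = 0
        · simp [hm', hi]
        · simp only [hm', hi, if_false]
          refine Nat.le_floor ((le_div_iff₀ hμ).2 ?_)
          have h1 : (m i : ℝ) * μ ≤ m i * a i := by gcongr; exact hμa i hi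
          have h2 : (m i : ℝ) * a i ≤ ∑ i, (m i : ℝ) * a i :=
            Finset.single_le_sum (f := fun i => (m i : ℝ) * a i)
              (fun i _ => mul_nonneg (Nat.cast_nonneg _) (ha i)) (Finset.mem_univ i)
          have h3 : D * Real.exp (-τ) ≤ D :=
            mul_le_of_le_one_right hD (Real.exp_le_one_iff.2 (by linarith))
          have h4 := (abs_le.1 hm).2
          have h5 : p * τ ≤ |p| * τ := by gcongr; exact le_abs_self p
          have h6 := le_abs_self q
          have := hx.2
          linarith
      · rw [hsum, Metric.mem_closedBall, Real.dist_eq, abs_sub_comm]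
        exact hm
    have hvol := (MeasureTheory.measure_mono (μ := MeasureTheory.volume) hsub).trans
      (MeasureTheory.measure_biUnion_finset_le B _)
    simp only [Real.volume_Icc, Real.volume_closedBall, Finset.sum_const] at hvol
    rw [← ENNReal.ofReal_nsmul, ENNReal.ofReal_le_ofReal_iff (by positivity)] at hvol
    have hcard : (B.card : ℝ) ≤ (R / μ + 1) ^ k := by
      rw [hB, Fintype.card_piFinset, Finset.prod_const, Finset.card_range, Finset.card_univ]
      push_cast
      gcongr
      exact Nat.floor_le (by positivity)
    calc 2 * c = p * τ + q + c - (p * τ + q - c) := by ring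
      _ ≤ B.card * (2 * (D * Real.exp (-τ))) := by simpa using hvol
      _ ≤ _ := by gcongr
  have hlim : Tendsto (fun τ : ℝ =>
      ((|p| * τ + |q| + c + D) / μ + 1) ^ k * (2 * (D * Real.exp (-τ)))) atTop (𝓝 0) := by
    set Q : Polynomial ℝ :=
      (Polynomial.C (|p| / μ) * Polynomial.X + Polynomial.C ((|q| + c + D) / μ + 1)) ^ k *
        Polynomial.C (2 * D) with hQ
    refine (Polynomial.tendsto_div_exp_atTop Q).congr fun τ => ?_
    simp only [hQ, Polynomial.eval_mul, Polynomial.eval_pow, Polynomial.eval_add,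
      Polynomial.eval_C, Polynomial.eval_X, Real.exp_neg]
    have : |p| / μ * τ + ((|q| + c + D) / μ + 1) = (|p| * τ + |q| + c + D) / μ + 1 := by ring
    rw [this]
    ring
  have := ge_of_tendsto hlim ((eventually_ge_atTop (max τ₀ 0)).mono key)
  linarith

theorem Subsemigroup.prod_pow_mem {ι G : Type*} [CommMonoid G] [Fintype ι] [Nonempty ι]
    (S : Subsemigroup G) {g : ι → G} (hg : ∀ i, g i ∈ S) {k : ι → ℕ} (hk : ∀ i, 1 ≤ k i) :
    ∏ i, g i ^ k i ∈ S := by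
  refine Finset.prod_induction_nonempty _ (· ∈ S) (fun _ _ => S.mul_mem)
    Finset.univ_nonempty fun i _ => ?_
  induction k i, hk i using Nat.le_induction with
  | base => simpa using hg i
  | succ n _ ih => rw [pow_succ]; exact S.mul_mem ih (hg i)

/-- If a positive real combination of the `g i` is recurrent, then the inverses of the `g i` lie
in the closure of the semigroup they generate. -/
theorem inv_mem_closure_of_recurrent {ι G : Type*} [Fintype ι] [CommGroup G] [TopologicalSpace G]
    [IsTopologicalGroup G] (S : Subsemigroup G) {g : ι → G} (hg : ∀ i, g i ∈ S) {c : ι → ℝ}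
    (hc : ∀ i, 0 < c i) {K : Set G} (hK : IsCompact K)
    (hmem : ∀ N : ℕ, ∏ i, g i ^ ⌊N * c i⌋₊ ∈ K) (j : ι) :
    (g j)⁻¹ ∈ closure (S : Set G) := by
  classical
  have : Nonempty ι := ⟨j⟩
  set u : ℕ → G := fun N => ∏ i, g i ^ ⌊N * c i⌋₊ with hu
  obtain ⟨z, -, hz⟩ := hK.exists_mapClusterPt_of_frequently (l := atTop) (f := u)
    (Eventually.of_forall hmem).frequently
  obtain ⟨B, hB⟩ : ∃ B : ℕ, ∀ i, 2 ≤ B * c i :=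
    (eventually_all.2 fun i => (tendsto_natCast_atTop_atTop.atTop_mul_const
      (hc i)).eventually_ge_atTop 2).exists
  rw [mem_closure_iff_nhds]
  intro W hW
  have hcont : Tendsto (fun x : G × G => (g j)⁻¹ * (x.1 / x.2)) (𝓝 (z, z)) (𝓝 (g j)⁻¹) := by
    have : Continuous fun x : G × G => (g j)⁻¹ * (x.1 / x.2) := by fun_prop
    simpa using this.tendsto (z, z)
  rw [nhds_prod_eq] at hcont
  obtain ⟨A, hA, hAW⟩ := mem_prod_same_iff.1 (hcont hW)
  have hfreq : ∃ᶠ N in atTop, u N ∈ A := hz.frequently hA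
  obtain ⟨N, hN⟩ := hfreq.exists
  obtain ⟨M, hM, hMA⟩ := (frequently_atTop.1 hfreq) (N + B)
  refine ⟨_, hAW (Set.mk_mem_prod hMA hN), ?_⟩
  have hfl : ∀ i, ⌊N * c i⌋₊ + 2 ≤ ⌊M * c i⌋₊ := by
    intro i
    refine Nat.le_floor ?_
    push_cast
    have h1 := Nat.floor_le (mul_nonneg (Nat.cast_nonneg N) (hc i).le)
    have h2 : ((N : ℝ) + B) * c i ≤ M * c i := by
      gcongr
      · exact (hc i).le
      · exact_mod_cast hM
    linarith [hB i]
  set k : ι → ℕ := fun i => ⌊M * c i⌋₊ - ⌊N * c i⌋₊ - if i = j then 1 else 0 with hk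
  have hk1 : ∀ i, 1 ≤ k i := fun i => by
    have := hfl i
    simp only [hk]
    split_ifs <;> omega
  have hprod : (g j)⁻¹ * (u M / u N) = ∏ i, g i ^ k i := by
    rw [inv_mul_eq_iff_eq_mul, div_eq_iff_eq_mul]
    have hgj : g j = ∏ i, g i ^ (if i = j then 1 else 0) := by
      simp [pow_ite]
    conv_rhs => rw [hgj]
    simp only [hu]
    rw [← Finset.prod_mul_distrib, ← Finset.prod_mul_distrib]
    refine Finset.prod_congr rfl fun i _ => ?_
    rw [← pow_add, ← pow_add]
    congr 1
    have := hfl i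
    simp only [hk]
    split_ifs <;> omega
  change (g j)⁻¹ * (u M / u N) ∈ S
  rw [hprod]
  exact S.prod_pow_mem hg hk1

/-- The closure of a finitely generated semigroup of an abelian topological group is a group as
soon as it contains the inverses of the generators. -/
theorem exists_subgroup_eq_closure {G : Type*} [CommGroup G] [TopologicalSpace G]
    [IsTopologicalGroup G] {T : Set G} (hT : T.Nonempty)
    (h : ∀ t ∈ T, t⁻¹ ∈ closure (Subsemigroup.closure T : Set G)) :
    ∃ H : Subgroup G, (H : Set G) = closure (Subsemigroup.closure T : Set G) := by
  set A := (Subsemigroup.closure T).topologicalClosure with hA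
  have hAc : (A : Set G) = closure (Subsemigroup.closure T : Set G) := rfl
  have hAcl : IsClosed (A : Set G) := isClosed_closure
  have hTA : ∀ t ∈ T, t ∈ A := fun t ht =>
    subset_closure (Subsemigroup.subset_closure ht)
  have hinv : ∀ x ∈ Subsemigroup.closure T, x⁻¹ ∈ A := by
    intro x hx
    induction hx using Subsemigroup.closure_induction with
    | mem t ht => exact h t ht
    | mul x y _ _ hx hy => rw [mul_inv]; exact A.mul_mem hx hy
  have hinv' : ∀ x ∈ A, x⁻¹ ∈ A := fun x hx =>
    closure_minimal (s := (Subsemigroup.closure T : Set G)) (t := Inv.inv ⁻¹' (A : Set G))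
      hinv (hAcl.preimage continuous_inv) hx
  obtain ⟨t, ht⟩ := hT
  exact ⟨{ carrier := A
           mul_mem' := A.mul_mem
           one_mem' := by simpa using A.mul_mem (hTA t ht) (h t ht)
           inv_mem' := hinv' _ }, hAc⟩

theorem isCompact_units_abs_log_norm_le {𝕜 : Type*} [NormedField 𝕜] [ProperSpace 𝕜] (R : ℝ) :
    IsCompact {u : 𝕜ˣ | |Real.log ‖(u : 𝕜)‖| ≤ R} := by
  rw [Units.isEmbedding_val₀.isCompact_iff]
  have : Units.val '' {u : 𝕜ˣ | |Real.log ‖(u : 𝕜)‖| ≤ R} =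
      Metric.closedBall 0 (Real.exp R) ∩ {x | Real.exp (-R) ≤ ‖x‖} := by
    ext x
    constructor
    · rintro ⟨u, hu, rfl⟩
      have hpos : 0 < ‖(u : 𝕜)‖ := norm_pos_iff.2 u.ne_zero
      obtain ⟨h1, h2⟩ := abs_le.1 (show |Real.log ‖(u : 𝕜)‖| ≤ R from hu)
      exact ⟨by simpa using (Real.log_le_iff_le_exp hpos).1 h2,
        (Real.le_log_iff_exp_le hpos).1 h1⟩
    · rintro ⟨h1, h2⟩
      have hpos : 0 < ‖x‖ := (Real.exp_pos _).trans_le h2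
      exact ⟨Units.mk0 x (norm_pos_iff.1 hpos), abs_le.2 ⟨(Real.le_log_iff_exp_le hpos).2 h2,
        (Real.log_le_iff_le_exp hpos).2 (by simpa using h1)⟩, rfl⟩
  rw [this]
  exact (isCompact_closedBall _ _).inter_right (isClosed_le continuous_const continuous_norm)

theorem abs_log_norm_sub_le {E : Type*} [NormedAddCommGroup E] [NormedSpace ℝ E] {a b : E}
    {m D τ : ℝ} (hm : 0 < m) (ha : m ≤ ‖a‖) (h : ‖Real.exp τ • a - b‖ ≤ D)
    (hτ : 2 * D ≤ Real.exp τ * m) :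
    |Real.log ‖b‖ - (Real.log ‖a‖ + τ)| ≤ 2 * D / m * Real.exp (-τ) := by
  have he := Real.exp_pos τ
  have hapos : 0 < ‖a‖ := hm.trans_le ha
  have hA : ‖Real.exp τ • a‖ = Real.exp τ * ‖a‖ := by
    rw [norm_smul, Real.norm_of_nonneg he.le]
  have hlog : Real.log ‖a‖ + τ = Real.log (Real.exp τ * ‖a‖) := by
    rw [Real.log_mul he.ne' hapos.ne', Real.log_exp, add_comm]
  have hd : |Real.exp τ * ‖a‖ - ‖b‖| ≤ D := by
    rw [← hA]; exact (abs_norm_sub_norm_le _ _).trans h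
  obtain ⟨hd1, hd2⟩ := abs_le.1 hd
  have hD : 0 ≤ D := (abs_nonneg _).trans hd
  have hmA : Real.exp τ * m ≤ Real.exp τ * ‖a‖ := by gcongr
  have hem : 0 < Real.exp τ * m := by positivity
  have hrhs : 2 * D / m * Real.exp (-τ) = D / (Real.exp τ * m / 2) := by
    rw [Real.exp_neg]; field_simp
  have hbm : Real.exp τ * m / 2 ≤ ‖b‖ := by linarith
  have hbpos : 0 < ‖b‖ := by linarith
  rw [hlog, hrhs]
  set A := Real.exp τ * ‖a‖
  have hApos : 0 < A := by linarith
  have hsmall : 0 < Real.exp τ * m / 2 := by positivity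
  rw [abs_le]
  constructor
  · have := Real.log_le_sub_one_of_pos (div_pos hApos hbpos)
    rw [Real.log_div hApos.ne' hbpos.ne'] at this
    have h2 : A / ‖b‖ - 1 = (A - ‖b‖) / ‖b‖ := by field_simp
    have h3 : (A - ‖b‖) / ‖b‖ ≤ D / (Real.exp τ * m / 2) := by gcongr
    linarith
  · have := Real.log_le_sub_one_of_pos (div_pos hbpos hApos)
    rw [Real.log_div hbpos.ne' hApos.ne'] at this
    have h2 : ‖b‖ / A - 1 = (‖b‖ - A) / A := by field_simp
    have h3 : (‖b‖ - A) / A ≤ D / (Real.exp τ * m / 2) := by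
      gcongr
      · linarith
      · linarith
    linarith

theorem tendsto_units_div_of_norm_sub_le {𝕜 : Type*} [RCLike 𝕜] {g h : ℕ → 𝕜ˣ} {u : 𝕜ˣ}
    {v x y : 𝕜} {D : ℝ} (hy : y ≠ 0) (hv : v ≠ 0) (hu : u * y = x)
    (hg : ∀ n : ℕ, ‖((n : ℝ) + 1) • x - g n * v‖ ≤ D)
    (hh : ∀ n : ℕ, ‖((n : ℝ) + 1) • y - h n * v‖ ≤ D) :
    Tendsto (fun n => g n / h n) atTop (𝓝 u) := by
  have key : ∀ (x : 𝕜) (g : ℕ → 𝕜ˣ), (∀ n : ℕ, ‖((n : ℝ) + 1) • x - g n * v‖ ≤ D) →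
      Tendsto (fun n : ℕ => ((n : ℝ) + 1)⁻¹ • ((g n : 𝕜) * v)) atTop (𝓝 x) := by
    intro x g hg
    rw [tendsto_iff_norm_sub_tendsto_zero]
    have hlim : Tendsto (fun n : ℕ => D * (1 / ((n : ℝ) + 1))) atTop (𝓝 0) := by
      simpa using (tendsto_one_div_add_atTop_nhds_zero_nat (𝕜 := ℝ)).const_mul D
    refine squeeze_zero (fun _ => norm_nonneg _) (fun n => ?_) hlim
    have hn : (0 : ℝ) < (n : ℝ) + 1 := by positivity
    have : ((n : ℝ) + 1)⁻¹ • ((g n : 𝕜) * v) - x =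
        -(((n : ℝ) + 1)⁻¹ • (((n : ℝ) + 1) • x - g n * v)) := by
      rw [smul_sub, inv_smul_smul₀ hn.ne']; ring
    rw [this, norm_neg, norm_smul, norm_inv, Real.norm_of_nonneg hn.le, mul_comm, one_div]
    gcongr
    exact hg n
  rw [Units.isEmbedding_val₀.tendsto_nhds_iff]
  have hux : (u : 𝕜) = x / y := (eq_div_iff hy).2 hu
  rw [hux]
  refine ((key x g hg).div (key y h hh) hy).congr fun n => ?_
  have hn : ((n : ℝ) + 1) ≠ 0 := by positivity
  have hn' : ((((n : ℝ) + 1)⁻¹ : ℝ) : 𝕜) ≠ 0 := by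
    exact_mod_cast inv_ne_zero hn
  have hhn := (h n).ne_zero
  simp only [Pi.div_apply, Function.comp, RCLike.real_smul_eq_coe_mul, Units.val_div_eq_div_val]
  field_simp

/-- An element of the image of the exponential has roots of all orders converging to `1`. -/
theorem exists_units_pow_eq_tendsto_one {𝕜 : Type*} [RCLike 𝕜] {u : 𝕜ˣ} {z : 𝕜}
    (hz : NormedSpace.exp z = (u : 𝕜)) :
    ∃ h : ℕ → 𝕜ˣ, Tendsto h atTop (𝓝 1) ∧ ∀ n, h n ^ (n + 1) = u := by
  have hpow : ∀ n : ℕ, NormedSpace.exp (((n : 𝕜) + 1)⁻¹ * z) ^ (n + 1) = (u : 𝕜) := by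
    intro n
    have hn : ((n : 𝕜) + 1) ≠ 0 := by exact_mod_cast n.succ_ne_zero
    rw [← NormedSpace.exp_nsmul, ← hz]
    congr 1
    rw [nsmul_eq_mul]
    push_cast
    field_simp
  have hne : ∀ n : ℕ, NormedSpace.exp (((n : 𝕜) + 1)⁻¹ * z) ≠ 0 := fun n h0 => by
    have := hpow n
    rw [h0, zero_pow n.succ_ne_zero] at this
    exact u.ne_zero this.symm
  refine ⟨fun n => Units.mk0 _ (hne n), ?_, fun n => Units.ext (by simpa using hpow n)⟩
  rw [Units.isEmbedding_val₀.tendsto_nhds_iff]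
  have h1 : Tendsto (fun n : ℕ => ((n : 𝕜) + 1)⁻¹ * z) atTop (𝓝 0) := by
    have := (tendsto_one_div_add_atTop_nhds_zero_nat (𝕜 := 𝕜)).mul_const z
    simpa using this
  have h2 : Tendsto (NormedSpace.exp : 𝕜 → 𝕜) (𝓝 0) (𝓝 1) := by
    have := (NormedSpace.exp_continuous (𝔸 := 𝕜)).tendsto 0
    rwa [NormedSpace.exp_zero] at this
  exact h2.comp h1

section Torus

variable {α β : Type*}

/-- The componentwise action of `(ℝˣ)^α × (ℂˣ)^β` on `ℝ^α × ℂ^β`. -/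
def unitsAct (g : (α → ℝˣ) × (β → ℂˣ)) (v : (α → ℝ) × (β → ℂ)) : (α → ℝ) × (β → ℂ) :=
  (fun i => (g.1 i : ℝ) * v.1 i, fun j => (g.2 j : ℂ) * v.2 j)

/-- The vector of logarithms of the absolute values of the coordinates. -/
noncomputable def logNorm (v : (α → ℝ) × (β → ℂ)) : (α → ℝ) × (β → ℝ) :=
  (fun i => Real.log ‖v.1 i‖, fun j => Real.log ‖v.2 j‖)

/-- The logarithms of the absolute values of the coordinates, as a homomorphism on
`(ℝˣ)^α × (ℂˣ)^β`. -/
noncomputable def unitsLogNorm :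
    Additive ((α → ℝˣ) × (β → ℂˣ)) →+ (α → ℝ) × (β → ℝ) where
  toFun g := logNorm (fun i => (g.toMul.1 i : ℝ), fun j => (g.toMul.2 j : ℂ))
  map_zero' := by ext <;> simp [logNorm]
  map_add' g h := by
    ext k
    · simp only [logNorm, toMul_add, Prod.fst_mul, Pi.mul_apply, Units.val_mul, norm_mul,
        Prod.fst_add, Pi.add_apply]
      exact Real.log_mul (by simp) (by simp)
    · simp only [logNorm, toMul_add, Prod.snd_mul, Pi.mul_apply, Units.val_mul, norm_mul,
        Prod.snd_add, Pi.add_apply]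
      exact Real.log_mul (by simp) (by simp)

theorem logNorm_unitsAct (g : (α → ℝˣ) × (β → ℂˣ)) {v : (α → ℝ) × (β → ℂ)}
    (hv₁ : ∀ i, v.1 i ≠ 0) (hv₂ : ∀ j, v.2 j ≠ 0) :
    logNorm (unitsAct g v) = unitsLogNorm (Additive.ofMul g) + logNorm v := by
  ext k
  · simp only [logNorm, unitsAct, norm_mul]
    exact Real.log_mul (by simp) (by simpa using hv₁ k)
  · simp only [logNorm, unitsAct, norm_mul]
    exact Real.log_mul (by simp) (by simpa using hv₂ k)

theorem continuous_unitsAct_left (v : (α → ℝ) × (β → ℂ)) :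
    Continuous fun g : (α → ℝˣ) × (β → ℂˣ) => unitsAct g v := by
  have h1 : Continuous (Units.val : ℝˣ → ℝ) := Units.continuous_val
  have h2 : Continuous (Units.val : ℂˣ → ℂ) := Units.continuous_val
  unfold unitsAct
  fun_prop

/-- An open subgroup contains every element whose real coordinates are positive. -/
theorem mem_of_mem_nhds_one_of_pos (A : Subgroup ((α → ℝˣ) × (β → ℂˣ)))
    (hA : (A : Set ((α → ℝˣ) × (β → ℂˣ))) ∈ 𝓝 1) {g : (α → ℝˣ) × (β → ℂˣ)}
    (hg : ∀ i, (0 : ℝ) < g.1 i) : g ∈ A := by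
  have h1 : ∀ i, ∃ h : ℕ → ℝˣ, Tendsto h atTop (𝓝 1) ∧ ∀ n, h n ^ (n + 1) = g.1 i := fun i =>
    exists_units_pow_eq_tendsto_one (z := Real.log (g.1 i)) (by
      rw [← Real.exp_eq_exp_ℝ, Real.exp_log (hg i)])
  have h2 : ∀ j, ∃ h : ℕ → ℂˣ, Tendsto h atTop (𝓝 1) ∧ ∀ n, h n ^ (n + 1) = g.2 j := fun j =>
    exists_units_pow_eq_tendsto_one (z := Complex.log (g.2 j)) (by
      rw [← Complex.exp_eq_exp_ℂ, Complex.exp_log (g.2 j).ne_zero])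
  choose a ha hag using h1
  choose b hb hbg using h2
  have hlim : Tendsto (fun n => ((fun i => a i n, fun j => b j n) : (α → ℝˣ) × (β → ℂˣ)))
      atTop (𝓝 1) :=
    Prod.tendsto_iff _ _ |>.2 ⟨tendsto_pi_nhds.2 ha, tendsto_pi_nhds.2 hb⟩
  obtain ⟨n, hn⟩ := (hlim.eventually hA).exists
  have : ((fun i => a i n, fun j => b j n) : (α → ℝˣ) × (β → ℂˣ)) ^ (n + 1) = g :=
    Prod.ext (funext fun i => hag i n) (funext fun j => hbg j n)
  rw [← this]
  exact A.pow_mem hn _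

variable [Fintype α] [Fintype β]

theorem isCompact_norm_unitsLogNorm_le {R : ℝ} (hR : 0 ≤ R) :
    IsCompact {g : (α → ℝˣ) × (β → ℂˣ) | ‖unitsLogNorm (Additive.ofMul g)‖ ≤ R} := by
  have : {g : (α → ℝˣ) × (β → ℂˣ) | ‖unitsLogNorm (Additive.ofMul g)‖ ≤ R} =
      (Set.univ.pi fun _ => {u : ℝˣ | |Real.log ‖(u : ℝ)‖| ≤ R}) ×ˢ
        (Set.univ.pi fun _ => {u : ℂˣ | |Real.log ‖(u : ℂ)‖| ≤ R}) := by
    ext g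
    simp [unitsLogNorm, logNorm, Prod.norm_def, pi_norm_le_iff_of_nonneg hR]
  rw [this]
  exact (isCompact_univ_pi fun _ => isCompact_units_abs_log_norm_le R).prod
    (isCompact_univ_pi fun _ => isCompact_units_abs_log_norm_le R)

theorem norm_fst_sub_lt {x y : (α → ℝ) × (β → ℂ)} {D : ℝ} (h : dist x y < D) (i : α) :
    ‖x.1 i - y.1 i‖ < D := by
  rw [← dist_eq_norm]
  exact (dist_le_pi_dist x.1 y.1 i).trans_lt ((le_max_left _ _).trans_lt h)

theorem norm_snd_sub_lt {x y : (α → ℝ) × (β → ℂ)} {D : ℝ} (h : dist x y < D) (j : β) :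
    ‖x.2 j - y.2 j‖ < D := by
  rw [← dist_eq_norm]
  exact (dist_le_pi_dist x.2 y.2 j).trans_lt ((le_max_right _ _).trans_lt h)

/-- A nonempty open set contains a point with nonzero coordinates. -/
theorem exists_mem_forall_ne_zero {C : Set ((α → ℝ) × (β → ℂ))} (hC : IsOpen C)
    (hne : C.Nonempty) : ∃ x ∈ C, (∀ i, x.1 i ≠ 0) ∧ ∀ j, x.2 j ≠ 0 := by
  obtain ⟨x, hx⟩ := hne
  set y : ℝ → (α → ℝ) × (β → ℂ) := fun ε => (fun i => x.1 i + ε, fun j => x.2 j + (ε : ℂ)) with hy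
  have hyc : Continuous y := by fun_prop
  have hyC : ∀ᶠ ε in 𝓝[≠] (0 : ℝ), y ε ∈ C := by
    refine (hyc.tendsto 0).mono_left nhdsWithin_le_nhds (hC.mem_nhds ?_)
    simpa [hy] using hx
  have hne0 : ∀ a : ℝ, ∀ᶠ ε in 𝓝[≠] (0 : ℝ), ε ≠ a := by
    intro a
    by_cases ha : a = 0
    · subst ha; exact self_mem_nhdsWithin
    · exact nhdsWithin_le_nhds (isOpen_ne.mem_nhds (Ne.symm ha))
  have h1 : ∀ᶠ ε in 𝓝[≠] (0 : ℝ), ∀ i, (y ε).1 i ≠ 0 := eventually_all.2 fun i => by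
    filter_upwards [hne0 (-x.1 i)] with ε hε h0
    exact hε (by simp only [hy] at h0; linarith)
  have h2 : ∀ᶠ ε in 𝓝[≠] (0 : ℝ), ∀ j, (y ε).2 j ≠ 0 := eventually_all.2 fun j => by
    filter_upwards [hne0 (-(x.2 j).re)] with ε hε h0
    have := congrArg Complex.re h0
    simp [hy] at this
    exact hε (by linarith)
  obtain ⟨ε, hε, hε1, hε2⟩ := (hyC.and (h1.and h2)).exists
  exact ⟨y ε, hε, hε1, hε2⟩

variable {T : Set ((α → ℝˣ) × (β → ℂˣ))} {S : Set ((α → ℝˣ) × (β → ℂˣ))}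
  {C : Set ((α → ℝ) × (β → ℂ))} {x₀ v : (α → ℝ) × (β → ℂ)} {D : ℝ}

theorem forall_ne_zero_of_coarselyDense
    (hcone : ∀ x ∈ C, ∀ t : ℝ, 0 < t → t • x ∈ C)
    (hd : ∀ x ∈ C, ∃ g ∈ S, dist x (unitsAct g v) < D)
    (hx₀ : x₀ ∈ C) (hx₁ : ∀ i, x₀.1 i ≠ 0) (hx₂ : ∀ j, x₀.2 j ≠ 0) :
    (∀ i, v.1 i ≠ 0) ∧ ∀ j, v.2 j ≠ 0 := by
  have aux : ∀ a : ℝ, 0 < a → ∃ t : ℝ, 0 < t ∧ D ≤ t * a := fun a ha =>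
    ⟨(|D| + 1) / a, by positivity, by
      rw [div_mul_cancel₀ _ ha.ne']; linarith [le_abs_self D]⟩
  constructor
  · intro i hi
    obtain ⟨t, ht, hta⟩ := aux ‖x₀.1 i‖ (norm_pos_iff.2 (hx₁ i))
    obtain ⟨g, -, hg⟩ := hd _ (hcone _ hx₀ t ht)
    have := norm_fst_sub_lt hg i
    simp only [unitsAct, hi, mul_zero, sub_zero, Prod.smul_fst, Pi.smul_apply, norm_smul,
      Real.norm_of_nonneg ht.le] at this
    linarith
  · intro j hj
    obtain ⟨t, ht, hta⟩ := aux ‖x₀.2 j‖ (norm_pos_iff.2 (hx₂ j))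
    obtain ⟨g, -, hg⟩ := hd _ (hcone _ hx₀ t ht)
    have := norm_snd_sub_lt hg j
    simp only [unitsAct, hj, mul_zero, sub_zero, Prod.smul_snd, Pi.smul_apply, norm_smul,
      Real.norm_of_nonneg ht.le] at this
    linarith

theorem exists_nat_sum_eq_of_mem_closure {G : Type*} [CommMonoid G] {T : Set G} [Fintype T]
    (f : Additive G →+ ℝ) {g : G} (hg : g ∈ Subsemigroup.closure T) :
    ∃ m : T → ℕ, ∑ t, (m t : ℝ) * f (Additive.ofMul (t : G)) = f (Additive.ofMul g) := by
  classical
  induction hg using Subsemigroup.closure_induction with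
  | mem t ht => exact ⟨Pi.single ⟨t, ht⟩ 1, by simp [Pi.single_apply]⟩
  | mul x y _ _ hx hy =>
    obtain ⟨m, hm⟩ := hx
    obtain ⟨k, hk⟩ := hy
    refine ⟨m + k, ?_⟩
    rw [ofMul_mul, map_add, ← hm, ← hk, ← Finset.sum_add_distrib]
    exact Finset.sum_congr rfl fun t _ => by push_cast [Pi.add_apply]; ring

/-- If a finitely generated semigroup has a coarsely dense orbit in an open cone, then its
generators do not lie in a closed half space, in logarithmic coordinates. -/
theorem exists_neg_of_coarselyDense (hT : T.Finite) (hC : IsOpen C)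
    (hcone : ∀ x ∈ C, ∀ t : ℝ, 0 < t → t • x ∈ C)
    (hd : ∀ x ∈ C, ∃ g ∈ Subsemigroup.closure T, dist x (unitsAct g v) < D)
    (hx₀ : x₀ ∈ C) (hx₁ : ∀ i, x₀.1 i ≠ 0) (hx₂ : ∀ j, x₀.2 j ≠ 0)
    (hv₁ : ∀ i, v.1 i ≠ 0) (hv₂ : ∀ j, v.2 j ≠ 0)
    (f : (α → ℝ) × (β → ℝ) →ₗ[ℝ] ℝ) (hf : f ≠ 0) :
    ∃ t ∈ T, f (unitsLogNorm (Additive.ofMul t)) < 0 := by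
  by_contra! hnonneg
  have := hT.fintype
  obtain ⟨ξ, hξ⟩ : ∃ ξ, f ξ = 1 := by
    obtain ⟨z, hz⟩ := DFunLike.ne_iff.1 hf
    exact ⟨(f z)⁻¹ • z, by rw [map_smul, smul_eq_mul, inv_mul_cancel₀ hz]⟩
  obtain ⟨m, hm, hm₁, hm₂⟩ : ∃ m > 0, (∀ i, m < ‖x₀.1 i‖) ∧ ∀ j, m < ‖x₀.2 j‖ := by
    have h1 : ∀ᶠ m in 𝓝[>] (0 : ℝ), ∀ i, m < ‖x₀.1 i‖ := eventually_all.2 fun i =>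
      nhdsWithin_le_nhds (Iio_mem_nhds (norm_pos_iff.2 (hx₁ i)))
    have h2 : ∀ᶠ m in 𝓝[>] (0 : ℝ), ∀ j, m < ‖x₀.2 j‖ := eventually_all.2 fun j =>
      nhdsWithin_le_nhds (Iio_mem_nhds (norm_pos_iff.2 (hx₂ j)))
    obtain ⟨m, h⟩ := (h1.and (h2.and self_mem_nhdsWithin)).exists
    exact ⟨m, h.2.2, h.1, h.2.1⟩
  set x : ℝ → (α → ℝ) × (β → ℂ) := fun σ =>
    (fun i => Real.exp (σ * ξ.1 i) • x₀.1 i, fun j => Real.exp (σ * ξ.2 j) • x₀.2 j) with hx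
  have hxc : Continuous x := by fun_prop
  have hx0 : x 0 = x₀ := by simp [hx]
  have hxlog : ∀ σ, logNorm (x σ) = logNorm x₀ + σ • ξ := by
    intro σ
    ext k
    · simp only [logNorm, hx, norm_smul, Real.norm_of_nonneg (Real.exp_pos _).le]
      rw [Real.log_mul (Real.exp_pos _).ne' (norm_ne_zero_iff.2 (hx₁ k)), Real.log_exp, add_comm]
      rfl
    · simp only [logNorm, hx, norm_smul, Real.norm_of_nonneg (Real.exp_pos _).le]
      rw [Real.log_mul (Real.exp_pos _).ne' (norm_ne_zero_iff.2 (hx₂ k)), Real.log_exp, add_comm]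
      rfl
  obtain ⟨c, hc, hxσ⟩ : ∃ c > 0, ∀ σ ∈ Set.Icc (-c) c, x σ ∈ C ∧
      (∀ i, m < ‖(x σ).1 i‖) ∧ ∀ j, m < ‖(x σ).2 j‖ := by
    have h1 : ∀ᶠ σ in 𝓝 (0 : ℝ), x σ ∈ C :=
      hxc.tendsto 0 (hC.mem_nhds (by rwa [hx0]))
    have h2 : ∀ᶠ σ in 𝓝 (0 : ℝ), ∀ i, m < ‖(x σ).1 i‖ := eventually_all.2 fun i => by
      have : Continuous fun σ => ‖(x σ).1 i‖ := by fun_prop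
      exact this.tendsto 0 (Ioi_mem_nhds (by rw [hx0]; exact hm₁ i))
    have h3 : ∀ᶠ σ in 𝓝 (0 : ℝ), ∀ j, m < ‖(x σ).2 j‖ := eventually_all.2 fun j => by
      have : Continuous fun σ => ‖(x σ).2 j‖ := by fun_prop
      exact this.tendsto 0 (Ioi_mem_nhds (by rw [hx0]; exact hm₂ j))
    obtain ⟨c, hc, h⟩ := Metric.nhds_basis_closedBall.eventually_iff.1 (h1.and (h2.and h3))
    refine ⟨c, hc, fun σ hσ => h ?_⟩
    rwa [Real.closedBall_eq_Icc, zero_sub, zero_add]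
  have hD : 0 < D := by
    obtain ⟨g, -, hg⟩ := hd _ hx₀
    exact dist_nonneg.trans_lt hg
  set F := LinearMap.toContinuousLinearMap f with hF
  refine not_exponentially_dense_of_nonneg
    (fun t : T => f (unitsLogNorm (Additive.ofMul (t : (α → ℝˣ) × (β → ℂˣ)))))
    (fun t => hnonneg t t.2) (f (1, 1)) (f (logNorm x₀) - f (logNorm v)) c (‖F‖ * (2 * D / m))
    (Real.log (2 * D / m)) hc fun τ hτ σ hσ => ?_
  obtain ⟨hσC, hσ₁, hσ₂⟩ := hxσ σ hσ
  obtain ⟨g, hgS, hg⟩ := hd _ (hcone _ hσC (Real.exp τ) (Real.exp_pos _))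
  obtain ⟨k, hk⟩ := exists_nat_sum_eq_of_mem_closure
    (f.toAddMonoidHom.comp unitsLogNorm) hgS
  refine ⟨k, ?_⟩
  have hτ' : 2 * D ≤ Real.exp τ * m := by
    rw [← div_le_iff₀ hm]
    exact (Real.log_le_iff_le_exp (by positivity)).1 hτ
  have hnorm : ‖logNorm (unitsAct g v) - (logNorm (x σ) + τ • (1, 1))‖ ≤
      2 * D / m * Real.exp (-τ) := by
    have h0 : 0 ≤ 2 * D / m * Real.exp (-τ) := by positivity
    rw [norm_prod_le_iff, pi_norm_le_iff_of_nonneg h0, pi_norm_le_iff_of_nonneg h0]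
    refine ⟨fun i => ?_, fun j => ?_⟩
    · have := abs_log_norm_sub_le hm (hσ₁ i).le (norm_fst_sub_lt hg i).le hτ'
      simpa [logNorm] using this
    · have := abs_log_norm_sub_le hm (hσ₂ j).le (norm_snd_sub_lt hg j).le hτ'
      simpa [logNorm] using this
  have hfin := (F.le_opNorm (logNorm (unitsAct g v) - (logNorm (x σ) + τ • (1, 1)))).trans
    (mul_le_mul_of_nonneg_left hnorm (norm_nonneg F))
  rw [logNorm_unitsAct g hv₁ hv₂, hxlog, ← mul_assoc, Real.norm_eq_abs] at hfin
  refine le_trans (le_of_eq ?_) hfin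
  change _ = |f _|
  have hk' : ∑ t : T, (k t : ℝ) *
      f (unitsLogNorm (Additive.ofMul (t : (α → ℝˣ) × (β → ℂˣ)))) =
      f (unitsLogNorm (Additive.ofMul g)) := hk
  rw [hk']
  simp only [map_sub, map_add, map_smul, hξ, smul_eq_mul, mul_one]
  congr 1
  ring

/-- A closed subgroup with a coarsely dense orbit in an open cone is open. -/
theorem mem_nhds_one_of_coarselyDense (A : Subgroup ((α → ℝˣ) × (β → ℂˣ)))
    (hA : IsClosed (A : Set ((α → ℝˣ) × (β → ℂˣ)))) (hC : IsOpen C)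
    (hcone : ∀ x ∈ C, ∀ t : ℝ, 0 < t → t • x ∈ C)
    (hd : ∀ x ∈ C, ∃ g ∈ A, dist x (unitsAct g v) < D)
    (hx₀ : x₀ ∈ C) (hx₁ : ∀ i, x₀.1 i ≠ 0) (hx₂ : ∀ j, x₀.2 j ≠ 0)
    (hv₁ : ∀ i, v.1 i ≠ 0) (hv₂ : ∀ j, v.2 j ≠ 0) :
    (A : Set ((α → ℝˣ) × (β → ℂˣ))) ∈ 𝓝 1 := by
  have hone : unitsAct 1 x₀ = x₀ := by ext <;> simp [unitsAct]
  have hnear : ∀ᶠ u in 𝓝 (1 : (α → ℝˣ) × (β → ℂˣ)), unitsAct u x₀ ∈ C :=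
    (continuous_unitsAct_left x₀).tendsto 1 (hC.mem_nhds (by rwa [hone]))
  have hseq : ∀ x ∈ C, ∃ g : ℕ → (α → ℝˣ) × (β → ℂˣ), (∀ n, g n ∈ A) ∧
      ∀ n : ℕ, dist (((n : ℝ) + 1) • x) (unitsAct (g n) v) < D := by
    intro x hx
    choose g hgA hg using fun n : ℕ => hd _ (hcone x hx ((n : ℝ) + 1) (by positivity))
    exact ⟨g, hgA, hg⟩
  filter_upwards [hnear] with u hu
  obtain ⟨g, hgA, hg⟩ := hseq _ hu
  obtain ⟨h, hhA, hh⟩ := hseq _ hx₀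
  have hlim : Tendsto (fun n => g n / h n) atTop (𝓝 u) := by
    refine Prod.tendsto_iff _ _ |>.2 ⟨tendsto_pi_nhds.2 fun i => ?_, tendsto_pi_nhds.2 fun j => ?_⟩
    · exact tendsto_units_div_of_norm_sub_le (hx₁ i) (hv₁ i) rfl
        (fun n => (norm_fst_sub_lt (hg n) i).le) (fun n => (norm_fst_sub_lt (hh n) i).le)
    · exact tendsto_units_div_of_norm_sub_le (hx₂ j) (hv₂ j) rfl
        (fun n => (norm_snd_sub_lt (hg n) j).le) (fun n => (norm_snd_sub_lt (hh n) j).le)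
  exact hA.mem_of_tendsto hlim (Eventually.of_forall fun n => A.div_mem (hgA n) (hhA n))

/-- If the generators do not lie in a closed half space, in logarithmic coordinates, then their
inverses lie in the closure of the semigroup they generate. -/
theorem inv_mem_closure_of_exists_neg (hT : T.Finite)
    (h : ∀ f : (α → ℝ) × (β → ℝ) →ₗ[ℝ] ℝ, f ≠ 0 →
      ∃ t ∈ T, f (unitsLogNorm (Additive.ofMul t)) < 0) :
    ∀ t ∈ T, t⁻¹ ∈ closure (Subsemigroup.closure T : Set ((α → ℝˣ) × (β → ℂˣ))) := by
  have := hT.fintype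
  set w : T → (α → ℝ) × (β → ℝ) := fun t => unitsLogNorm (Additive.ofMul t.1) with hw
  obtain ⟨c, hc, hsum⟩ := exists_pos_sum_smul_eq_zero w fun f hf => by
    obtain ⟨t, ht, hft⟩ := h f hf
    exact ⟨⟨t, ht⟩, hft⟩
  intro t ht
  refine inv_mem_closure_of_recurrent (Subsemigroup.closure T) (g := fun t : T => t.1)
    (fun t => Subsemigroup.subset_closure t.2) hc
    (isCompact_norm_unitsLogNorm_le (R := ∑ t, ‖w t‖)
      (Finset.sum_nonneg fun _ _ => norm_nonneg _)) (fun N => ?_) ⟨t, ht⟩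
  have hlog : unitsLogNorm (Additive.ofMul (∏ i : T, i.1 ^ ⌊N * c i⌋₊)) =
      ∑ i, ((⌊N * c i⌋₊ : ℝ) - N * c i) • w i := by
    have hN : ∑ i, ((N : ℝ) * c i) • w i = 0 := by
      simp only [mul_smul, ← Finset.smul_sum, hsum, smul_zero]
    simp only [sub_smul, Finset.sum_sub_distrib, hN, sub_zero]
    simp only [ofMul_prod, map_sum, ofMul_pow, map_nsmul, hw, Nat.cast_smul_eq_nsmul]
  rw [Set.mem_ofPred_eq, hlog]
  refine norm_sum_le_of_le _ fun i _ => ?_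
  rw [norm_smul]
  refine mul_le_of_le_one_left (norm_nonneg _) ?_
  have h0 : 0 ≤ N * c i := mul_nonneg (Nat.cast_nonneg _) (hc i).le
  rw [Real.norm_eq_abs, abs_le]
  constructor
  · linarith [Nat.lt_floor_add_one (N * c i)]
  · linarith [Nat.floor_le h0]

end Torus

/-- Let `V = ℝ^r × ℂ^(d-r)` and let `G = (ℝ*)^r × (ℂ*)^(d-r)` act on `V`
by componentwise scalar multiplication.  If `S` is a finitely generated subsemigroup of `G`
and for some `v₀ ∈ V` and some nonempty open cone `C` in `V` the set `S ⬝ v₀ ∩ C` is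
coarsely dense in `C`, then the closure of `S` in `G` is a subgroup of `G` containing the
identity component `G⁰ = (ℝ*₊)^r × (ℂ*)^(d-r)`. -/
theorem diagonalizable_case
    (r d : ℕ) (hrd : r ≤ d)
    (T : Set ((Fin r → ℝˣ) × (Fin (d - r) → ℂˣ))) (hTfin : T.Finite)
    (S : Subsemigroup ((Fin r → ℝˣ) × (Fin (d - r) → ℂˣ)))
    (hS : S = Subsemigroup.closure T)
    (v₀ : (Fin r → ℝ) × (Fin (d - r) → ℂ))
    (C : Set ((Fin r → ℝ) × (Fin (d - r) → ℂ)))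
    (hCne : C.Nonempty) (hCopen : IsOpen C)
    (hCcone : ∀ x ∈ C, ∀ t : ℝ, 0 < t → t • x ∈ C)
    (hcd : ∃ D : ℝ, 0 < D ∧ ∀ x ∈ C, ∃ g ∈ S,
      ((fun i => (g.1 i : ℝ) * v₀.1 i, fun j => (g.2 j : ℂ) * v₀.2 j) :
          (Fin r → ℝ) × (Fin (d - r) → ℂ)) ∈ C ∧
        dist x ((fun i => (g.1 i : ℝ) * v₀.1 i, fun j => (g.2 j : ℂ) * v₀.2 j) :
          (Fin r → ℝ) × (Fin (d - r) → ℂ)) < D) :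
    (∃ H : Subgroup ((Fin r → ℝˣ) × (Fin (d - r) → ℂˣ)),
        (H : Set ((Fin r → ℝˣ) × (Fin (d - r) → ℂˣ))) =
          closure (S : Set ((Fin r → ℝˣ) × (Fin (d - r) → ℂˣ)))) ∧
      {g : (Fin r → ℝˣ) × (Fin (d - r) → ℂˣ) | ∀ i, (0 : ℝ) < (g.1 i : ℝ)} ⊆
        closure (S : Set ((Fin r → ℝˣ) × (Fin (d - r) → ℂˣ))) := by
  obtain ⟨D, -, hD⟩ := hcd
  subst hS
  have hd : ∀ x ∈ C, ∃ g ∈ Subsemigroup.closure T, dist x (unitsAct g v₀) < D := fun x hx => by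
    obtain ⟨g, hg, -, h⟩ := hD x hx
    exact ⟨g, hg, h⟩
  obtain ⟨x₀, hx₀, hx₁, hx₂⟩ := exists_mem_forall_ne_zero hCopen hCne
  obtain ⟨hv₁, hv₂⟩ := forall_ne_zero_of_coarselyDense
    (S := (Subsemigroup.closure T : Set ((Fin r → ℝˣ) × (Fin (d - r) → ℂˣ))))
    hCcone hd hx₀ hx₁ hx₂
  have hTne : T.Nonempty := by
    obtain ⟨g, hg, -⟩ := hd x₀ hx₀
    by_contra hT
    rw [Set.not_nonempty_iff_eq_empty.1 hT, Subsemigroup.closure_empty] at hg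
    exact Subsemigroup.notMem_bot hg
  obtain ⟨H, hH⟩ := exists_subgroup_eq_closure hTne (inv_mem_closure_of_exists_neg hTfin
    (exists_neg_of_coarselyDense hTfin hCopen hCcone hd hx₀ hx₁ hx₂ hv₁ hv₂))
  refine ⟨⟨H, hH⟩, fun g hg => ?_⟩
  rw [← hH]
  refine mem_of_mem_nhds_one_of_pos H (mem_nhds_one_of_coarselyDense (D := D) H
    (hH ▸ isClosed_closure) hCopen hCcone (fun x hx => ?_) hx₀ hx₁ hx₂ hv₁ hv₂) hg
  obtain ⟨g, hg, h⟩ := hd x hx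
  have hgH : g ∈ (H : Set ((Fin r → ℝˣ) × (Fin (d - r) → ℂˣ))) := hH ▸ subset_closure hg
  exact ⟨g, hgH, h⟩
end

section
/- Let $S$ be a subsemigroup of $GL_n(\mathbb{R})$ generated by a finite set of pairwise commuting invertible matrices, acting on $\mathbb{R}^n$. Suppose there exist $v_0 \in \mathbb{R}^n$ and a nonempty open cone $C$ in $\mathbb{R}^n$ such that the orbit $\mathcal{O} = S \cdot v_0$ intersected with $C$ is coarsely dense in $C$. Then the orbit $\mathcal{O}$ is Zariski-dense in $\mathbb{R}^n$: every polynomial $p \in \mathbb{R}[X_1,\ldots,X_n]$ which vanishes at every point of $\mathcal{O}$ is the zero polynomial. -/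
/-- Euler scaling: a homogeneous polynomial of degree `n` satisfies `φ (r • x) = r ^ n * φ x`. -/
theorem MvPolynomial.IsHomogeneous.eval_smul {σ R : Type*} [CommSemiring R]
    {φ : MvPolynomial σ R} {n : ℕ} (hφ : φ.IsHomogeneous n) (r : R) (x : σ → R) :
    eval (r • x) φ = r ^ n * eval x φ := by
  rw [eval_eq, eval_eq, Finset.mul_sum]
  refine Finset.sum_congr rfl fun m hm => ?_
  have hdeg : ∑ i ∈ m.support, m i = n := by
    rw [← hφ (mem_support_iff.1 hm), Finsupp.weight_apply]
    simp [Finsupp.sum]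
  simp_rw [Pi.smul_apply, smul_eq_mul, mul_pow]
  rw [Finset.prod_mul_distrib, Finset.prod_pow_eq_pow_sum, hdeg]
  ring

open MvPolynomial Filter Topology in
/-- The zero set of a nonzero polynomial is not coarsely dense in a nonempty open cone. -/
theorem MvPolynomial.eq_zero_of_zeros_coarselyDense_cone {ι : Type*} [Fintype ι]
    {C : Set (ι → ℝ)} (hne : C.Nonempty) (hopen : IsOpen C)
    (hcone : ∀ x ∈ C, ∀ r : ℝ, 0 < r → r • x ∈ C) {D : ℝ} (p : MvPolynomial ι ℝ)
    (hp : ∀ x ∈ C, ∃ y, dist x y < D ∧ eval y p = 0) : p = 0 := by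
  have hzero : ∀ x ∈ C, eval x (homogeneousComponent p.totalDegree p) = 0 := by
    intro x hx
    set d := p.totalDegree with hd
    have hr (k : ℕ) : (0 : ℝ) < k + 1 := by positivity
    choose y hyD hy using fun k : ℕ => hp _ (hcone x hx (k + 1) (hr k))
    have ht : Tendsto (fun k : ℕ => ((k : ℝ) + 1)⁻¹) atTop (𝓝 0) := by
      simpa using tendsto_one_div_add_atTop_nhds_zero_nat (𝕜 := ℝ)
    have hz : Tendsto (fun k : ℕ => ((k : ℝ) + 1)⁻¹ • y k) atTop (𝓝 x) := by
      rw [tendsto_iff_dist_tendsto_zero]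
      refine squeeze_zero (fun _ => dist_nonneg) (fun k => ?_) (by simpa using ht.mul_const D)
      calc dist (((k : ℝ) + 1)⁻¹ • y k) x
          = dist (((k : ℝ) + 1)⁻¹ • y k) (((k : ℝ) + 1)⁻¹ • ((k : ℝ) + 1) • x) := by
            rw [inv_smul_smul₀ (hr k).ne']
        _ = ((k : ℝ) + 1)⁻¹ * dist (y k) (((k : ℝ) + 1) • x) := by
            rw [dist_smul₀, Real.norm_of_nonneg (inv_nonneg.2 (hr k).le)]
        _ ≤ ((k : ℝ) + 1)⁻¹ * D :=
            mul_le_mul_of_nonneg_left (by rw [dist_comm]; exact (hyD k).le)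
              (inv_nonneg.2 (hr k).le)
    let q : ℝ × (ι → ℝ) → ℝ := fun tz =>
      ∑ i ∈ Finset.range (d + 1), tz.1 ^ (d - i) * eval tz.2 (homogeneousComponent i p)
    have hq : Continuous q := continuous_finsetSum _ fun i _ =>
      (continuous_fst.pow _).mul ((continuous_eval _).comp continuous_snd)
    have hqlim := (hq.tendsto (0, x)).comp (ht.prodMk_nhds hz)
    have hq0 : q (0, x) = eval x (homogeneousComponent d p) := by
      rw [show q (0, x) = _ from Finset.sum_eq_single_of_mem d (by simp) fun i hi hid => by
        have : d - i ≠ 0 := by have := Finset.mem_range.1 hi; omega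
        simp [this]]
      simp
    have hqk (k : ℕ) : q (((k : ℝ) + 1)⁻¹, ((k : ℝ) + 1)⁻¹ • y k) = 0 := by
      have h : q (((k : ℝ) + 1)⁻¹, ((k : ℝ) + 1)⁻¹ • y k) =
          ((k : ℝ) + 1)⁻¹ ^ d * eval (y k) p := by
        conv_rhs => rw [← sum_homogeneousComponent p, map_sum, Finset.mul_sum]
        refine Finset.sum_congr rfl fun i hi => ?_
        have hle : i ≤ d := Nat.lt_succ_iff.1 (Finset.mem_range.1 hi)
        rw [IsHomogeneous.eval_smul (homogeneousComponent_isHomogeneous i p), ← mul_assoc, ← pow_add,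
          Nat.sub_add_cancel hle]
      rw [h, hy, mul_zero]
    rw [← hq0]
    refine tendsto_nhds_unique hqlim ?_
    simp [Function.comp_def, hqk]
  have hcomp : homogeneousComponent p.totalDegree p = 0 := by
    obtain ⟨x, hx⟩ := hne
    obtain ⟨ε, hε, hball⟩ := Metric.isOpen_iff.1 hopen x hx
    refine funext_set (fun i => Metric.ball (x i) ε) (fun i => ?_) fun z hz => ?_
    · rw [Real.ball_eq_Ioo]
      exact Set.Ioo_infinite (by linarith)
    · rw [map_zero]
      exact hzero z (hball (by rwa [ball_pi x hε]))
  by_contra hp0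
  obtain ⟨m, hm, hdeg⟩ := p.support.exists_mem_eq_sup (support_nonempty.2 hp0)
    (fun s => s.sum fun _ e => e)
  apply mem_support_iff.1 hm
  have := congrArg (coeff m) hcomp
  rwa [coeff_homogeneousComponent, coeff_zero, if_pos] at this
  exact hdeg.symm


/-- Let `S` be a subsemigroup of `GLₙ(ℝ)` generated by a finite set of
pairwise commuting matrices.  If for some `v₀ ∈ ℝⁿ` and some nonempty open cone `C` the
set `S ⬝ v₀ ∩ C` is coarsely dense in `C`, then the orbit `S ⬝ v₀` is Zariski-dense:
every polynomial vanishing on the orbit is zero. -/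
theorem orbit_zariski_dense
    {n : ℕ}
    (T : Set (GL (Fin n) ℝ)) (hTfin : T.Finite)
    (hTcomm : ∀ s ∈ T, ∀ t ∈ T, s * t = t * s)
    (S : Subsemigroup (GL (Fin n) ℝ)) (hS : S = Subsemigroup.closure T)
    (v₀ : Fin n → ℝ)
    (C : Set (Fin n → ℝ)) (hCne : C.Nonempty) (hCopen : IsOpen C)
    (hCcone : ∀ x ∈ C, ∀ r : ℝ, 0 < r → r • x ∈ C)
    (hcd : ∃ D : ℝ, 0 < D ∧ ∀ x ∈ C, ∃ s ∈ S,
      (s : Matrix (Fin n) (Fin n) ℝ).mulVec v₀ ∈ C ∧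
        dist x ((s : Matrix (Fin n) (Fin n) ℝ).mulVec v₀) < D)
    (p : MvPolynomial (Fin n) ℝ)
    (hp : ∀ s ∈ S, MvPolynomial.eval ((s : Matrix (Fin n) (Fin n) ℝ).mulVec v₀) p = 0) :
    p = 0 := by
  obtain ⟨D, -, hD⟩ := hcd
  refine MvPolynomial.eq_zero_of_zeros_coarselyDense_cone hCne hCopen hCcone (D := D) p
    fun x hx => ?_
  obtain ⟨s, hs, -, hdist⟩ := hD x hx
  exact ⟨_, hdist, hp s hs⟩
end
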